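/- Assume GRH. Then for every prime p with p ≥ 10^9, the least prime primitive root modulo p satisfies ĝ(p) ≤ ((8/5)·(2^{ω(p−1)} − 1)·log p)², where log denotes the natural logarithm. -/

import Mathlib

/-- The Generalized Riemann Hypothesis: for every Dirichlet character `χ` (to any modulus),
every zero `s` of the Dirichlet L-function `L(s, χ)` with `0 < Re s < 1` has `Re s = 1/2`. -/
def GRH : Prop :=
  ∀ (N : ℕ) (_ : NeZero N) (χ : DirichletCharacter ℂ N) (s : ℂ),
    DirichletCharacter.LFunction χ s = 0 → 0 < s.re → s.re < 1 → s.re = 1 / 2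

/-- The least prime `q` that is a primitive root modulo `p`. -/
noncomputable def leastPrimePrimitiveRoot (p : ℕ) : ℕ :=
  sInf {q : ℕ | q.Prime ∧ orderOf (q : ZMod p) = p - 1}

section
open Complex MeasureTheory Filter Topology Set

/-- integrability of the decay weight -/
lemma gp_int_weight : Integrable (fun t : ℝ => (1 + t ^ 2) ^ (-(3 / 4) : ℝ)) := by
  have h := integrable_rpow_neg_one_add_norm_sq (E := ℝ) (μ := volume) (r := 3 / 2)
    (by simp; norm_num)
  refine h.congr (Eventually.of_forall fun t => ?_)
  simp only [Real.norm_eq_abs, sq_abs]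
  norm_num

lemma gp_vert_cont {f : ℂ → ℂ} {c : ℝ} {S : Set ℂ} (hf : ContinuousOn f S)
    (hS : ∀ s : ℂ, s.re = c → s ∈ S) : Continuous fun t : ℝ => f (c + t * I) := by
  have : Continuous fun t : ℝ => (c : ℂ) + t * I := by fun_prop
  exact hf.comp_continuous this (fun t => hS _ (by simp))

lemma gp_vert_integrable {f : ℂ → ℂ} {c C : ℝ} {S : Set ℂ} (hf : ContinuousOn f S)
    (hS : ∀ s : ℂ, s.re = c → s ∈ S)
    (hb : ∀ t : ℝ, ‖f (c + t * I)‖ ≤ C * (1 + t ^ 2) ^ (-(3 / 4) : ℝ)) :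
    Integrable fun t : ℝ => f (c + t * I) := by
  refine (gp_int_weight.const_mul C).mono' (gp_vert_cont hf hS).aestronglyMeasurable ?_
  exact Eventually.of_forall hb

lemma gp_strip {f : ℂ → ℂ} {c₁ c₂ C : ℝ} (h12 : c₁ ≤ c₂)
    (hf : DifferentiableOn ℂ f {s | c₁ ≤ s.re ∧ s.re ≤ c₂})
    (hb : ∀ s : ℂ, c₁ ≤ s.re → s.re ≤ c₂ → ‖f s‖ ≤ C * (1 + s.im ^ 2) ^ (-(3 / 4) : ℝ)) :
    ∫ t : ℝ, f (c₁ + t * I) = ∫ t : ℝ, f (c₂ + t * I) := by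
  have i1 : Integrable fun t : ℝ => f (c₁ + t * I) :=
    gp_vert_integrable (C := C) hf.continuousOn (fun s hs => ⟨hs.ge, hs.le.trans h12⟩)
      (fun t => by simpa using hb (c₁ + t * I) (by simp) (by simpa))
  have i2 : Integrable fun t : ℝ => f (c₂ + t * I) :=
    gp_vert_integrable (C := C) hf.continuousOn (fun s hs => ⟨h12.trans hs.ge, hs.le⟩)
      (fun t => by simpa using hb (c₂ + t * I) (by simpa) (by simp))
  have t1 := intervalIntegral_tendsto_integral i1 tendsto_neg_atTop_atBot tendsto_id
  have t2 := intervalIntegral_tendsto_integral i2 tendsto_neg_atTop_atBot tendsto_id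
  have hd : Tendsto (fun T : ℝ => (∫ t in (-T)..T, f (c₁ + t * I)) - ∫ t in (-T)..T, f (c₂ + t * I))
      atTop (𝓝 0) := by
    have hz : Tendsto (fun T : ℝ => 2 * (C * (1 + T ^ 2) ^ (-(3 / 4) : ℝ) * |c₂ - c₁|))
        atTop (𝓝 0) := by
      have : Tendsto (fun T : ℝ => (1 + T ^ 2) ^ (-(3 / 4) : ℝ)) atTop (𝓝 0) := by
        refine (tendsto_rpow_neg_atTop (y := 3 / 4) (by norm_num)).comp ?_
        exact tendsto_atTop_add_const_left _ _ (tendsto_pow_atTop two_ne_zero)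
      simpa using ((this.const_mul C).mul_const |c₂ - c₁|).const_mul 2
    refine squeeze_zero_norm (fun T => ?_) hz
    have hr := Complex.integral_boundary_rect_eq_zero_of_differentiableOn f
      (c₁ + (-T : ℝ) * I) (c₂ + (T : ℝ) * I) (hf.mono ?_)
    · simp only [add_re, ofReal_re, mul_re, I_re, mul_zero, ofReal_im, I_im, mul_one, sub_self,
        add_zero, add_im, mul_im, zero_add, smul_eq_mul] at hr
      have b1 : ‖∫ x : ℝ in c₁..c₂, f (x + (-T : ℝ) * I)‖ ≤
          C * (1 + T ^ 2) ^ (-(3 / 4) : ℝ) * |c₂ - c₁| := by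
        refine intervalIntegral.norm_integral_le_of_norm_le_const fun x hx => ?_
        rw [uIoc_of_le h12] at hx
        simpa using hb (x + (-T : ℝ) * I) (by simpa using hx.1.le) (by simpa using hx.2)
      have b2 : ‖∫ x : ℝ in c₁..c₂, f (x + (T : ℝ) * I)‖ ≤
          C * (1 + T ^ 2) ^ (-(3 / 4) : ℝ) * |c₂ - c₁| := by
        refine intervalIntegral.norm_integral_le_of_norm_le_const fun x hx => ?_
        rw [uIoc_of_le h12] at hx
        simpa using hb (x + (T : ℝ) * I) (by simpa using hx.1.le) (by simpa using hx.2)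
      have e : I * ((∫ t in (-T)..T, f (c₁ + t * I)) - ∫ t in (-T)..T, f (c₂ + t * I)) =
          (∫ x : ℝ in c₁..c₂, f (x + (-T : ℝ) * I)) - ∫ x : ℝ in c₁..c₂, f (x + (T : ℝ) * I) := by
        linear_combination -hr
      have := congrArg norm e
      rw [norm_mul, norm_I, one_mul] at this
      rw [this]
      refine (norm_sub_le _ _).trans ?_
      linarith
    · intro s hs
      rw [mem_reProdIm] at hs
      have := hs.1
      simp only [add_re, ofReal_re, mul_re, I_re, mul_zero, ofReal_im, I_im, mul_one, sub_self,
        add_zero] at this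
      rw [uIcc_of_le h12] at this
      exact this
  have := tendsto_nhds_unique (t1.sub t2) hd
  exact sub_eq_zero.mp this

lemma gp_weight_le {s : ℂ} : (1 + ‖s‖) ^ (-(3 / 2) : ℝ) ≤ (1 + s.im ^ 2) ^ (-(3 / 4) : ℝ) := by
  have h : 1 + s.im ^ 2 ≤ (1 + ‖s‖) ^ (2 : ℝ) := by
    have := Complex.abs_im_le_norm s
    have h2 : s.im ^ 2 ≤ ‖s‖ ^ 2 := by
      rw [← sq_abs]; gcongr
    norm_num
    nlinarith [norm_nonneg s]
  calc (1 + ‖s‖) ^ (-(3 / 2) : ℝ) = ((1 + ‖s‖) ^ (2 : ℝ)) ^ (-(3 / 4) : ℝ) := by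
        rw [← Real.rpow_mul (by positivity)]; norm_num
    _ ≤ _ := Real.rpow_le_rpow_of_nonpos (by positivity) h (by norm_num)

lemma gp_half {f : ℂ → ℂ} {c C : ℝ}
    (hf : DifferentiableOn ℂ f {s | c ≤ s.re})
    (hb : ∀ s : ℂ, c ≤ s.re → ‖f s‖ ≤ C * (1 + ‖s‖) ^ (-(3 / 2) : ℝ)) :
    ∫ t : ℝ, f (c + t * I) = 0 := by
  have hC : 0 ≤ C := by
    have := (norm_nonneg _).trans (hb c (by simp))
    by_contra h
    have h2 : (0 : ℝ) < (1 + ‖(c : ℂ)‖) ^ (-(3 / 2) : ℝ) := by positivity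
    nlinarith
  have hb' : ∀ s : ℂ, c ≤ s.re → ‖f s‖ ≤ C * (1 + s.im ^ 2) ^ (-(3 / 4) : ℝ) := fun s hs =>
    (hb s hs).trans (mul_le_mul_of_nonneg_left gp_weight_le hC)
  have heq : ∀ R : ℝ, c ≤ R → ∫ t : ℝ, f (R + t * I) = ∫ t : ℝ, f (c + t * I) := fun R hR =>
    (gp_strip (C := C) hR (hf.mono fun s hs => hs.1) (fun s hs _ => hb' s hs)).symm
  have lim : Tendsto (fun R : ℝ => ∫ t : ℝ, f (R + t * I)) atTop (𝓝 (∫ _ : ℝ, (0 : ℂ))) := by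
    refine tendsto_integral_filter_of_dominated_convergence
      (fun t => C * (1 + t ^ 2) ^ (-(3 / 4) : ℝ)) ?_ ?_ (gp_int_weight.const_mul C) ?_
    · filter_upwards [eventually_ge_atTop c] with R hR
      exact (gp_vert_cont hf.continuousOn (fun s hs => by simpa [hs] using hR)).aestronglyMeasurable
    · filter_upwards [eventually_ge_atTop c] with R hR
      exact Eventually.of_forall fun t => by simpa using hb' (R + t * I) (by simpa)
    · refine Eventually.of_forall fun t => ?_
      have hz : Tendsto (fun R : ℝ => C * (1 + R) ^ (-(3 / 2) : ℝ)) atTop (𝓝 0) := by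
        have : Tendsto (fun T : ℝ => (1 + T) ^ (-(3 / 2) : ℝ)) atTop (𝓝 0) := by
          refine (tendsto_rpow_neg_atTop (y := 3 / 2) (by norm_num)).comp ?_
          exact tendsto_atTop_add_const_left _ _ tendsto_id
        simpa using this.const_mul C
      refine squeeze_zero_norm' ?_ hz
      filter_upwards [eventually_ge_atTop c, eventually_ge_atTop 0] with R hR h0
      refine (hb _ (by simpa)).trans ?_
      gcongr C * ?_
      refine Real.rpow_le_rpow_of_nonpos (by positivity) ?_ (by norm_num)
      have := Complex.re_le_norm (R + t * I)
      simp at this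
      linarith
  rw [integral_zero] at lim
  have l2 : Tendsto (fun R : ℝ => ∫ t : ℝ, f (R + t * I)) atTop (𝓝 (∫ t : ℝ, f (c + t * I))) :=
    tendsto_const_nhds.congr' (by
      filter_upwards [eventually_ge_atTop c] with R hR using (heq R hR).symm)
  exact tendsto_nhds_unique l2 lim

end

section
open Complex MeasureTheory Filter Topology Set

lemma gp_far {s w : ℂ} {r : ℝ} (hr : 0 < r) (h : r ≤ ‖s - w‖) :
    1 + ‖s‖ ≤ ((1 + ‖w‖) / r + 1) * ‖s - w‖ := by
  have h1 : ‖s‖ ≤ ‖w‖ + ‖s - w‖ := by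
    have := norm_add_le w (s - w); simpa using this
  have h2 : 1 + ‖w‖ ≤ (1 + ‖w‖) / r * ‖s - w‖ := by
    rw [div_mul_eq_mul_div, le_div_iff₀ hr]
    gcongr
  linarith

lemma gp_far' {s w : ℂ} {r : ℝ} (hr : 0 < r) (h : r ≤ ‖s - w‖) :
    ‖s - w‖⁻¹ ≤ ((1 + ‖w‖) / r + 1) * (1 + ‖s‖)⁻¹ := by
  have := gp_far hr h
  have h0 : 0 < ‖s - w‖ := hr.trans_le h
  have h1 : 0 < 1 + ‖s‖ := by positivity
  rw [inv_eq_one_div, inv_eq_one_div, mul_one_div, div_le_div_iff₀ h0 h1]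
  linarith

lemma gp_int_cauchy {α : ℝ} (hα : 0 < α) : Integrable (fun t : ℝ => ((α ^ 2 + t ^ 2 : ℝ))⁻¹) ∧
    ∫ t : ℝ, ((α ^ 2 + t ^ 2 : ℝ))⁻¹ = Real.pi / α := by
  have i1 : Integrable fun t : ℝ => ((α ^ 2 + t ^ 2 : ℝ))⁻¹ := by
    have := (integrable_inv_one_add_sq.comp_div hα.ne').const_mul ((α ^ 2)⁻¹)
    refine this.congr (Eventually.of_forall fun t => ?_)
    simp only
    rw [← mul_inv]
    congr 1
    field_simp
  have v1 : ∫ t : ℝ, ((α ^ 2 + t ^ 2 : ℝ))⁻¹ = Real.pi / α := by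
    have h : ∀ t : ℝ, ((α ^ 2 + t ^ 2 : ℝ))⁻¹ = (α ^ 2)⁻¹ * (1 + (t / α) ^ 2)⁻¹ := by
      intro t
      rw [← mul_inv]
      congr 1
      field_simp
    simp_rw [h]
    rw [integral_const_mul, Measure.integral_comp_div (fun u : ℝ => (1 + u ^ 2)⁻¹) α,
      integral_univ_inv_one_add_sq, abs_of_pos hα, smul_eq_mul]
    field_simp
  exact ⟨i1, v1⟩

lemma gp_poisson {f : ℂ → ℂ} {c₀ c C α : ℝ} (hc : c₀ < c) (hα : 0 < α)
    (hf : DifferentiableOn ℂ f {s | c₀ < s.re})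
    (hg : ∀ s : ℂ, c ≤ s.re → ‖f s‖ ≤ C * (1 + ‖s‖) ^ (1 / 2 : ℝ)) :
    Integrable (fun t : ℝ => f (c + t * I) / ((α : ℂ) ^ 2 + t ^ 2)) ∧
    ∫ t : ℝ, f (c + t * I) / ((α : ℂ) ^ 2 + t ^ 2) = Real.pi / α * f (c + α) := by
  have hopen : IsOpen {s : ℂ | c₀ < s.re} := isOpen_lt continuous_const Complex.continuous_re
  set s₀ : ℂ := c + α with hs₀
  have hs₀m : s₀ ∈ {s : ℂ | c₀ < s.re} := by simp [hs₀]; linarith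
  have hC : 0 ≤ C := by
    have := (norm_nonneg _).trans (hg c (by simp))
    by_contra h
    have h2 : (0 : ℝ) < (1 + ‖(c : ℂ)‖) ^ (1 / 2 : ℝ) := by positivity
    nlinarith
  have hds : DifferentiableOn ℂ (dslope f s₀) {s | c₀ < s.re} :=
    (Complex.differentiableOn_dslope (hopen.mem_nhds hs₀m)).2 hf
  set g : ℂ → ℂ := fun s => dslope f s₀ s / (s - (c - α : ℝ)) with hgdef
  have hne : ∀ s : ℂ, c ≤ s.re → s - (c - α : ℝ) ≠ 0 := by
    intro s hs h
    have := congrArg Complex.re h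
    simp at this; linarith
  have hfar2 : ∀ s : ℂ, c ≤ s.re → α ≤ ‖s - (c - α : ℝ)‖ := by
    intro s hs
    refine le_trans ?_ (Complex.re_le_norm _)
    simp; linarith
  have hgd : DifferentiableOn ℂ g {s | c ≤ s.re} := by
    refine (hds.mono fun s hs => lt_of_lt_of_le hc hs).div (by fun_prop) hne
  -- bound near s₀
  have hball : Metric.closedBall s₀ (α / 2) ⊆ {s : ℂ | c ≤ s.re} := by
    intro s hs
    rw [mem_closedBall_iff_norm] at hs
    have := (Complex.abs_re_le_norm (s - s₀)).trans hs
    rw [abs_le] at this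
    simp [hs₀] at this ⊢
    linarith [this.1]
  obtain ⟨M, hM⟩ := (isCompact_closedBall s₀ (α / 2)).exists_bound_of_continuousOn
    (f := fun s => g s * (((1 + ‖s‖) ^ (3 / 2 : ℝ) : ℝ) : ℂ)) (by
      refine (hgd.continuousOn.mono hball).mul ?_
      refine Continuous.continuousOn ?_
      refine continuous_ofReal.comp ?_
      exact (continuous_const.add continuous_norm).rpow_const (fun x => Or.inr (by norm_num)))
  set A₁ := (1 + ‖s₀‖) / (α / 2) + 1
  set A₂ := (1 + ‖((c - α : ℝ) : ℂ)‖) / α + 1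
  have hA₁ : 0 ≤ A₁ := by positivity
  have hA₂ : 0 ≤ A₂ := by positivity
  have hgb : ∀ s : ℂ, c ≤ s.re →
      ‖g s‖ ≤ (max M ((C + ‖f s₀‖) * A₁ * A₂)) * (1 + ‖s‖) ^ (-(3 / 2) : ℝ) := by
    intro s hs
    have hp : 0 < 1 + ‖s‖ := by positivity
    have hp' : (0 : ℝ) < (1 + ‖s‖) ^ (-(3 / 2) : ℝ) := by positivity
    rcases le_or_gt ‖s - s₀‖ (α / 2) with h | h
    · have := hM s (mem_closedBall_iff_norm.2 h)
      rw [norm_mul, norm_real, Real.norm_eq_abs, abs_of_pos (by positivity)] at this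
      have e : ‖g s‖ = (‖g s‖ * (1 + ‖s‖) ^ (3 / 2 : ℝ)) * (1 + ‖s‖) ^ (-(3 / 2) : ℝ) := by
        rw [mul_assoc, ← Real.rpow_add hp]; norm_num
      rw [e]
      gcongr
      exact this.trans (le_max_left _ _)
    · have hne0 : s ≠ s₀ := by
        rintro rfl; simp at h; linarith
      have e : g s = (f s - f s₀) / (s - s₀) / (s - (c - α : ℝ)) := by
        rw [hgdef]; simp only
        rw [dslope_of_ne _ hne0, slope_def_field]
      have b1 : ‖f s - f s₀‖ ≤ (C + ‖f s₀‖) * (1 + ‖s‖) ^ (1 / 2 : ℝ) := by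
        refine (norm_sub_le _ _).trans ?_
        have : 1 ≤ (1 + ‖s‖) ^ (1 / 2 : ℝ) :=
          Real.one_le_rpow (by linarith [norm_nonneg s]) (by norm_num)
        nlinarith [hg s hs, norm_nonneg (f s₀)]
      have b2 := gp_far' (by positivity) h.le
      have b3 := gp_far' hα (hfar2 s hs)
      have e2 : (1 + ‖s‖) ^ (-(3 / 2) : ℝ) =
          (1 + ‖s‖) ^ (1 / 2 : ℝ) * (1 + ‖s‖)⁻¹ * (1 + ‖s‖)⁻¹ := by
        rw [← Real.rpow_neg_one, ← Real.rpow_add hp, ← Real.rpow_add hp]; norm_num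
      calc ‖g s‖ = ‖f s - f s₀‖ * ‖s - s₀‖⁻¹ * ‖s - (c - α : ℝ)‖⁻¹ := by
            rw [e, norm_div, norm_div]; rfl
        _ ≤ ((C + ‖f s₀‖) * (1 + ‖s‖) ^ (1 / 2 : ℝ)) * (A₁ * (1 + ‖s‖)⁻¹) * (A₂ * (1 + ‖s‖)⁻¹) := by
            gcongr
        _ = ((C + ‖f s₀‖) * A₁ * A₂) * (1 + ‖s‖) ^ (-(3 / 2) : ℝ) := by rw [e2]; ring
        _ ≤ _ := by gcongr; exact le_max_right _ _
  have h0 := gp_half hgd hgb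
  have hden : ∀ t : ℝ, (α : ℂ) ^ 2 + t ^ 2 ≠ 0 := by
    intro t
    have : 0 < α ^ 2 + t ^ 2 := by positivity
    exact_mod_cast this.ne'
  have hline : ∀ t : ℝ, g (c + t * I) =
      f s₀ / ((α : ℂ) ^ 2 + t ^ 2) - f (c + t * I) / ((α : ℂ) ^ 2 + t ^ 2) := by
    intro t
    have hne0 : (c + t * I : ℂ) ≠ s₀ := by
      intro h
      have := congrArg Complex.re h
      simp [hs₀] at this; linarith
    have h1 : (c + t * I : ℂ) - s₀ ≠ 0 := sub_ne_zero.2 hne0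
    have h2 := hne (c + t * I) (by simp)
    rw [hgdef]; simp only
    rw [dslope_of_ne _ hne0, slope_def_field, ← sub_div, div_div, div_eq_div_iff (by
      exact mul_ne_zero h1 h2) (hden t)]
    simp only [hs₀]
    push_cast
    linear_combination (f (c + t * I) - f (c + α)) * t ^ 2 * Complex.I_sq
  obtain ⟨i1, v1⟩ := gp_int_cauchy hα
  have i2 : Integrable fun t : ℝ => f s₀ / ((α : ℂ) ^ 2 + t ^ 2) := by
    have := (i1.ofReal (𝕜 := ℂ)).const_mul (f s₀)
    refine this.congr (Eventually.of_forall fun t => ?_)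
    simp [div_eq_mul_inv]
  have i3 : Integrable fun t : ℝ => g (c + t * I) := by
    have hC' : 0 ≤ max M ((C + ‖f s₀‖) * A₁ * A₂) :=
      le_max_of_le_right (by positivity)
    refine gp_vert_integrable hgd.continuousOn (fun s hs => hs.ge)
      (C := max M ((C + ‖f s₀‖) * A₁ * A₂)) (fun t => ?_)
    refine (hgb _ (by simp)).trans ?_
    refine mul_le_mul_of_nonneg_left ?_ hC'
    simpa using gp_weight_le (s := c + t * I)
  have i4 : Integrable fun t : ℝ => f (c + t * I) / ((α : ℂ) ^ 2 + t ^ 2) := by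
    refine (i2.sub i3).congr (Eventually.of_forall fun t => ?_)
    simp only [Pi.sub_apply]
    rw [hline]; ring
  refine ⟨i4, ?_⟩
  have : ∫ t : ℝ, g (c + t * I) = (∫ t : ℝ, f s₀ / ((α : ℂ) ^ 2 + t ^ 2)) -
      ∫ t : ℝ, f (c + t * I) / ((α : ℂ) ^ 2 + t ^ 2) := by
    rw [← integral_sub i2 i4]
    exact integral_congr_ae (Eventually.of_forall hline)
  rw [h0] at this
  rw [← sub_eq_zero.mp this.symm]
  have e : ∀ t : ℝ, f s₀ / ((α : ℂ) ^ 2 + t ^ 2) = f s₀ * (((α ^ 2 + t ^ 2 : ℝ)⁻¹ : ℝ) : ℂ) := by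
    intro t; simp [div_eq_mul_inv]
  simp_rw [e]
  rw [integral_const_mul, integral_complex_ofReal, v1]
  push_cast; ring

end

section
open Complex MeasureTheory Filter Topology Set

noncomputable def gpsi (x : ℝ) : ℝ := deriv (Real.log ∘ Real.Gamma) x

lemma gpsi_diff {x : ℝ} (hx : 0 < x) : DifferentiableAt ℝ (Real.log ∘ Real.Gamma) x := by
  refine ((Real.differentiableAt_Gamma ?_).log (Real.Gamma_ne_zero ?_)) <;>
    exact fun m ↦ ne_of_gt (by linarith [m.cast_nonneg (α := ℝ)])

lemma gp_logGamma_rec {x : ℝ} (hx : 0 < x) : (Real.log ∘ Real.Gamma) (x + 1) =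
    (Real.log ∘ Real.Gamma) x + Real.log x := by
  simp only [Function.comp_apply, Real.Gamma_add_one hx.ne',
    Real.log_mul hx.ne' (Real.Gamma_pos_of_pos hx).ne', add_comm]

lemma gpsi_rec {x : ℝ} (hx : 0 < x) : gpsi (x + 1) = gpsi x + 1 / x := by
  unfold gpsi
  rw [← deriv_comp_add_const, one_div, ← Real.deriv_log,
      ← deriv_add (gpsi_diff <| by positivity) (Real.differentiableAt_log hx.ne')]
  apply EventuallyEq.deriv_eq
  filter_upwards [eventually_gt_nhds hx] with y hy using gp_logGamma_rec hy

lemma gpsi_ge {x : ℝ} (hx : 0 < x) : Real.log x ≤ gpsi (x + 1) := by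
  refine (le_of_eq ?_).trans <| Real.convexOn_log_Gamma.slope_le_deriv (mem_Ioi.mpr hx)
      (by positivity : _ < (_ : ℝ)) (by linarith : x < x + 1) (gpsi_diff <| by positivity)
  rw [slope_def_field, show x + 1 - x = (1 : ℝ) by ring, div_one, gp_logGamma_rec hx,
      add_sub_cancel_left]

lemma gpsi_le {x : ℝ} (hx : 0 < x) : gpsi x ≤ Real.log x := by
  refine (Real.convexOn_log_Gamma.deriv_le_slope (mem_Ioi.mpr hx)
      (by positivity : (0:ℝ) < x + 1) (by linarith : x < x + 1) (gpsi_diff <| by positivity)).trans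
      (le_of_eq ?_)
  rw [slope_def_field, show x + 1 - x = (1 : ℝ) by ring, div_one, gp_logGamma_rec hx,
      add_sub_cancel_left]

lemma gpsi_mono {x y : ℝ} (hx : 0 < x) (hxy : x ≤ y) : gpsi x ≤ gpsi y := by
  have := Real.convexOn_log_Gamma.monotoneOn_deriv (fun z hz => gpsi_diff hz)
  exact this (mem_Ioi.2 hx) (mem_Ioi.2 (hx.trans_le hxy)) hxy

lemma gp_Gamma_diff {z : ℂ} (hz : 0 < z.re) : DifferentiableAt ℂ Gamma z :=
  differentiableAt_Gamma _ (fun m h => by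
    have := congrArg Complex.re h
    simp at this
    linarith [m.cast_nonneg (α := ℝ)])

lemma gp_digamma_real {x : ℝ} (hx : 0 < x) : digamma (x : ℂ) = gpsi x := by
  have h1 : HasDerivAt (fun y : ℝ => Complex.Gamma y) (deriv Gamma (x : ℂ)) x :=
    (gp_Gamma_diff (z := x) (by simpa using hx)).hasDerivAt.comp_ofReal
  have hd : DifferentiableAt ℝ Real.Gamma x :=
    Real.differentiableAt_Gamma (fun m => ne_of_gt (by linarith [m.cast_nonneg (α := ℝ)]))
  have h2 : HasDerivAt (fun y : ℝ => ((Real.Gamma y : ℝ) : ℂ)) ((deriv Real.Gamma x : ℝ) : ℂ) x :=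
    hd.hasDerivAt.ofReal_comp
  have h3 : deriv Gamma (x : ℂ) = ((deriv Real.Gamma x : ℝ) : ℂ) := by
    refine h1.unique ?_
    simpa only [Complex.Gamma_ofReal] using h2
  rw [digamma_def, logDeriv_apply, h3, Complex.Gamma_ofReal]
  unfold gpsi
  have := deriv.log hd (Real.Gamma_pos_of_pos hx).ne'
  rw [Function.comp_def, this]
  push_cast; rfl

lemma gp_digamma_diff : DifferentiableOn ℂ digamma {z | 0 < z.re} := by
  have ho : IsOpen {s : ℂ | 0 < s.re} := isOpen_lt continuous_const Complex.continuous_re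
  have h : DifferentiableOn ℂ Gamma {z | 0 < z.re} := fun z hz =>
    (gp_Gamma_diff hz).differentiableWithinAt
  rw [digamma_def]
  exact (h.deriv ho).div h (fun z hz => Complex.Gamma_ne_zero_of_re_pos hz)

noncomputable def gpS (z : ℂ) : ℂ := ∑' n : ℕ, (1 / ((n : ℂ) + 1) - 1 / (n + z))

lemma gp_S_term {ε : ℝ} (hε : 0 < ε) (hε1 : ε ≤ 1) {z : ℂ} (hz : ε ≤ z.re) (n : ℕ) :
    ‖(1 / ((n : ℂ) + 1) - 1 / (n + z))‖ ≤
      (2 / ε * (1 + ‖z‖) ^ (1 / 2 : ℝ)) * ((n : ℝ) + 1) ^ (-(3 / 2) : ℝ) := by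
  have hn : (0 : ℝ) ≤ n := n.cast_nonneg
  have hn1 : (0 : ℝ) < (n : ℝ) + 1 := by positivity
  have e1 : ‖(n : ℂ) + 1‖ = n + 1 := by
    rw [← Nat.cast_add_one, Complex.norm_natCast]; push_cast; ring
  have e2 : ε * (n + 1) ≤ ‖(n : ℂ) + z‖ := by
    refine le_trans ?_ (Complex.re_le_norm _)
    simp; nlinarith
  have h0 : 0 < ‖(n : ℂ) + z‖ := lt_of_lt_of_le (by positivity) e2
  have hne : (n : ℂ) + z ≠ 0 := norm_pos_iff.1 h0
  have hne1 : (n : ℂ) + 1 ≠ 0 := norm_pos_iff.1 (by rw [e1]; positivity)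
  have e3 : ‖(1 : ℂ) / (n + z)‖ ≤ 1 / (ε * (n + 1)) := by
    rw [norm_div, norm_one]; gcongr
  set u := ‖(1 / ((n : ℂ) + 1) - 1 / (n + z))‖ with hu
  have b1 : u ≤ 2 / ε * ((n : ℝ) + 1)⁻¹ := by
    refine (norm_sub_le _ _).trans ?_
    rw [norm_div, e1, norm_one]
    have : 1 / (n + 1 : ℝ) ≤ 1 / (ε * (n + 1)) := by
      gcongr; nlinarith
    calc 1 / (n + 1 : ℝ) + _ ≤ 1 / (ε * (n + 1)) + 1 / (ε * (n + 1)) := add_le_add this e3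
      _ = _ := by field_simp; ring
  have b2 : u ≤ 2 / ε * ((1 + ‖z‖) * (((n : ℝ) + 1)⁻¹ * ((n : ℝ) + 1)⁻¹)) := by
    have : (1 / ((n : ℂ) + 1) - 1 / (n + z)) = (z - 1) * (1 / (n + z)) * (1 / (n + 1)) := by
      field_simp; ring
    rw [hu, this, norm_mul, norm_mul]
    have h1 : ‖z - 1‖ ≤ 1 + ‖z‖ := by
      have := norm_sub_le z 1; rw [norm_one] at this; linarith
    have h2 : ‖(1 : ℂ) / (n + 1)‖ = ((n : ℝ) + 1)⁻¹ := by rw [norm_div, e1, norm_one, one_div]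
    rw [h2]
    calc ‖z - 1‖ * ‖(1 : ℂ) / (n + z)‖ * ((n : ℝ) + 1)⁻¹
        ≤ (1 + ‖z‖) * (1 / (ε * (n + 1))) * ((n : ℝ) + 1)⁻¹ := by gcongr
      _ = 1 / ε * ((1 + ‖z‖) * (((n : ℝ) + 1)⁻¹ * ((n : ℝ) + 1)⁻¹)) := by field_simp
      _ ≤ _ := by gcongr; norm_num
  have hp : (0 : ℝ) < 1 + ‖z‖ := by positivity
  have hu0 : 0 ≤ u := norm_nonneg _
  have hb0 : 0 ≤ 2 / ε * ((n : ℝ) + 1)⁻¹ := by positivity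
  refine (pow_le_pow_iff_left₀ hu0 (by positivity) two_ne_zero).1 ?_
  have e4 : ((2 / ε * (1 + ‖z‖) ^ (1 / 2 : ℝ)) * ((n : ℝ) + 1) ^ (-(3 / 2) : ℝ)) ^ 2 =
      (2 / ε * ((n : ℝ) + 1)⁻¹) * (2 / ε * ((1 + ‖z‖) * (((n : ℝ) + 1)⁻¹ * ((n : ℝ) + 1)⁻¹))) := by
    have p1 : ((1 + ‖z‖) ^ (1 / 2 : ℝ)) ^ 2 = 1 + ‖z‖ := by
      rw [← Real.rpow_natCast, ← Real.rpow_mul hp.le]; norm_num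
    have p2 : (((n : ℝ) + 1) ^ (-(3 / 2) : ℝ)) ^ 2 =
        ((n : ℝ) + 1)⁻¹ * ((n : ℝ) + 1)⁻¹ * ((n : ℝ) + 1)⁻¹ := by
      rw [← Real.rpow_natCast, ← Real.rpow_mul hn1.le, ← Real.rpow_neg_one, ← Real.rpow_add hn1,
        ← Real.rpow_add hn1]; norm_num
    rw [mul_pow, mul_pow, p1, p2]; ring
  rw [e4, sq]
  exact mul_le_mul b1 b2 hu0 hb0

lemma gp_S_summable_aux : Summable fun n : ℕ => ((n : ℝ) + 1) ^ (-(3 / 2) : ℝ) := by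
  have := (summable_nat_add_iff 1).2 (Real.summable_nat_rpow (p := -(3 / 2)) |>.2 (by norm_num))
  simpa using this

lemma gp_S_summable {z : ℂ} (hz : 0 < z.re) :
    Summable fun n : ℕ => (1 / ((n : ℂ) + 1) - 1 / (n + z)) := by
  refine Summable.of_norm_bounded (gp_S_summable_aux.mul_left _)
    (fun n => gp_S_term (ε := min z.re 1) (lt_min hz one_pos) (min_le_right _ _) (min_le_left _ _) n)

lemma gp_S_growth {ε : ℝ} (hε : 0 < ε) (hε1 : ε ≤ 1) : ∃ C, ∀ z : ℂ, ε ≤ z.re →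
    ‖gpS z‖ ≤ C * (1 + ‖z‖) ^ (1 / 2 : ℝ) := by
  refine ⟨2 / ε * ∑' n : ℕ, ((n : ℝ) + 1) ^ (-(3 / 2) : ℝ), fun z hz => ?_⟩
  refine (tsum_of_norm_bounded (gp_S_summable_aux.mul_left _).hasSum
    (fun n => gp_S_term hε hε1 hz n)).trans (le_of_eq ?_)
  rw [tsum_mul_left]; ring

lemma gp_S_diff : DifferentiableOn ℂ gpS {z | 0 < z.re} := by
  have ho : IsOpen {s : ℂ | 0 < s.re} := isOpen_lt continuous_const Complex.continuous_re
  intro z hz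
  refine DifferentiableAt.differentiableWithinAt ?_
  set ε := min (z.re / 2) 1
  have hz' : 0 < z.re := hz
  have hε : 0 < ε := lt_min (by linarith) one_pos
  set U := {w : ℂ | ε < w.re} ∩ Metric.ball 0 (‖z‖ + 1)
  have hU : IsOpen U := (isOpen_lt continuous_const Complex.continuous_re).inter Metric.isOpen_ball
  have hzU : z ∈ U := ⟨lt_of_le_of_lt (min_le_left _ _) (by simp only [mem_ofPred_eq] at hz; linarith : z.re / 2 < z.re), by simp⟩
  refine (differentiableOn_tsum_of_summable_norm
    (u := fun n : ℕ => (2 / ε * (1 + (‖z‖ + 1)) ^ (1 / 2 : ℝ)) * ((n : ℝ) + 1) ^ (-(3 / 2) : ℝ))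
    (gp_S_summable_aux.mul_left _) ?_ hU ?_).differentiableAt (hU.mem_nhds hzU)
  · intro n w hw
    refine DifferentiableAt.differentiableWithinAt ?_
    have : (n : ℂ) + w ≠ 0 := by
      intro h
      have := congrArg Complex.re h
      have h1 := hw.1
      simp at this h1
      linarith [n.cast_nonneg (α := ℝ)]
    fun_prop (disch := assumption)
  · intro n w hw
    refine (gp_S_term hε (min_le_right _ _) hw.1.le n).trans ?_
    have : ‖w‖ ≤ ‖z‖ + 1 := (mem_ball_zero_iff.1 hw.2).le
    gcongr

lemma gp_digamma_series {z : ℂ} (hz : 0 < z.re) : digamma z = digamma 1 + gpS z := by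
  have ho : IsOpen {s : ℂ | 0 < s.re} := isOpen_lt continuous_const Complex.continuous_re
  have hreal : ∀ x : ℝ, 0 < x → digamma (x : ℂ) = digamma 1 + gpS x := by
    intro x hx
    have hrec : ∀ N : ℕ, ∀ y : ℝ, 0 < y → gpsi (y + N) = gpsi y + ∑ n ∈ Finset.range N, 1 / (n + y) := by
      intro N y hy
      induction N with
      | zero => simp
      | succ N ih =>
        rw [Finset.sum_range_succ, ← add_assoc, ← ih]
        push_cast
        rw [← add_assoc, gpsi_rec (by positivity), add_comm (N : ℝ) y]
    have hsum := (gp_S_summable (z := x) (by simpa using hx)).hasSum.tendsto_sum_nat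
    have hp : ∀ N : ℕ, ∑ n ∈ Finset.range N, (1 / ((n : ℂ) + 1) - 1 / (n + x)) =
        (((gpsi x - gpsi 1) + (gpsi (1 + N) - gpsi (x + N)) : ℝ) : ℂ) := by
      intro N
      rw [hrec N x hx, hrec N 1 one_pos, Finset.sum_sub_distrib]
      push_cast
      ring
    have hlim : Tendsto (fun N : ℕ => gpsi (1 + N) - gpsi (x + N)) atTop (𝓝 0) := by
      have key : ∀ a b : ℝ, Tendsto (fun N : ℕ => Real.log (a + N) - Real.log (b + N)) atTop (𝓝 0) := by
        intro a b
        have h1 : Tendsto (fun N : ℕ => (a + N) / (b + N)) atTop (𝓝 1) := by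
          have h2 : Tendsto (fun N : ℕ => (a - b) / (b + N) + 1) atTop (𝓝 (0 + 1)) := by
            refine Tendsto.add_const _ ?_
            refine Tendsto.const_div_atTop ?_ _
            exact tendsto_atTop_add_const_left _ _ tendsto_natCast_atTop_atTop
          rw [zero_add] at h2
          refine h2.congr' ?_
          filter_upwards [eventually_gt_atTop (Nat.ceil |b|)] with N hN
          have : b + N > 0 := by
            have := Nat.lt_of_ceil_lt hN
            linarith [neg_abs_le b]
          field_simp; ring
        have h3 := ((Real.continuousAt_log one_ne_zero).tendsto).comp h1
        rw [Real.log_one] at h3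
        refine h3.congr' ?_
        filter_upwards [eventually_gt_atTop (Nat.ceil |b|), eventually_gt_atTop (Nat.ceil |a|)] with N hN hN2
        have : b + N > 0 := by
          have := Nat.lt_of_ceil_lt hN
          linarith [neg_abs_le b]
        have h' : a + N > 0 := by
          have := Nat.lt_of_ceil_lt hN2
          linarith [neg_abs_le a]
        simp only [Function.comp_apply]
        rw [Real.log_div h'.ne' this.ne']
      refine tendsto_of_tendsto_of_tendsto_of_le_of_le' (key 0 x) (key 1 (x - 1)) ?_ ?_
      · filter_upwards [eventually_gt_atTop 0] with N hN
        have hN' : (0 : ℝ) < N := by exact_mod_cast hN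
        have := gpsi_ge hN'
        have h2 := gpsi_le (x := x + N) (by positivity)
        rw [add_comm (N : ℝ) 1] at this
        simp only [zero_add]; linarith
      · filter_upwards [eventually_gt_atTop 1] with N hN
        have hN' : (1 : ℝ) < N := by exact_mod_cast hN
        have := gpsi_ge (x := x - 1 + N) (by linarith)
        have h2 := gpsi_le (x := 1 + N) (by positivity)
        rw [show x - 1 + N + 1 = x + N by ring] at this
        linarith
    have hlim2 : Tendsto (fun N : ℕ => (((gpsi x - gpsi 1) + (gpsi (1 + N) - gpsi (x + N)) : ℝ) : ℂ))
        atTop (𝓝 (((gpsi x - gpsi 1) + 0 : ℝ) : ℂ)) :=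
      (Complex.continuous_ofReal.tendsto _).comp (hlim.const_add _)
    simp_rw [hp] at hsum
    have := tendsto_nhds_unique hsum hlim2
    rw [gpS, this, gp_digamma_real hx, show (1 : ℂ) = ((1 : ℝ) : ℂ) by simp, gp_digamma_real one_pos]
    push_cast; ring
  have hA1 : AnalyticOnNhd ℂ digamma {z | 0 < z.re} := gp_digamma_diff.analyticOnNhd ho
  have hA2 : AnalyticOnNhd ℂ (fun z => digamma 1 + gpS z) {z | 0 < z.re} :=
    ((differentiableOn_const _).add gp_S_diff).analyticOnNhd ho
  refine hA1.eqOn_of_preconnected_of_frequently_eq hA2 (z₀ := 1) ?_ (by simp) ?_ hz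
  · exact (convex_halfSpace_re_gt 0).isPreconnected
  · have : Tendsto (fun n : ℕ => ((1 + 1 / ((n : ℝ) + 1) : ℝ) : ℂ)) atTop (𝓝[≠] 1) := by
      refine tendsto_nhdsWithin_iff.2 ⟨?_, Eventually.of_forall fun n => ?_⟩
      · have h1 : Tendsto (fun n : ℕ => (1 + 1 / ((n : ℝ) + 1) : ℝ)) atTop (𝓝 (1 + 0)) :=
          tendsto_one_div_add_atTop_nhds_zero_nat.const_add _
        rw [add_zero] at h1
        exact (Complex.continuous_ofReal.tendsto _).comp h1
      · intro h
        have h2 : (1 + 1 / ((n : ℝ) + 1) : ℝ) = 1 := by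
          rw [mem_singleton_iff] at h
          exact Complex.ofReal_injective (by rw [h]; simp)
        have : (0 : ℝ) < 1 / ((n : ℝ) + 1) := by positivity
        linarith
    refine this.frequently (Frequently.of_forall fun n => ?_)
    exact hreal _ (by positivity)

lemma gp_digamma_growth {ε : ℝ} (hε : 0 < ε) : ∃ C, ∀ z : ℂ, ε ≤ z.re →
    ‖digamma z‖ ≤ C * (1 + ‖z‖) ^ (1 / 2 : ℝ) := by
  obtain ⟨C, hC⟩ := gp_S_growth (ε := min ε 1) (lt_min hε one_pos) (min_le_right _ _)
  refine ⟨‖digamma 1‖ + C, fun z hz => ?_⟩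
  rw [gp_digamma_series (hε.trans_le hz), add_mul]
  refine (norm_add_le _ _).trans (add_le_add ?_ (hC z ((min_le_left _ _).trans hz)))
  exact le_mul_of_one_le_right (norm_nonneg _)
    (Real.one_le_rpow (by linarith [norm_nonneg z]) (by norm_num))

lemma gp_digamma_re {z : ℂ} (hz : 0 < z.re) : gpsi z.re ≤ (digamma z).re := by
  have hx : 0 < ((z.re : ℝ) : ℂ).re := by simpa using hz
  have h1 : ((digamma (z.re : ℂ))).re = gpsi z.re := by rw [gp_digamma_real hz]; simp
  rw [← h1, gp_digamma_series hz, gp_digamma_series hx, add_re, add_re]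
  refine add_le_add le_rfl ?_
  unfold gpS
  rw [Complex.re_tsum (gp_S_summable hz), Complex.re_tsum (gp_S_summable hx)]
  refine Summable.tsum_le_tsum (fun n => ?_) (Complex.hasSum_re (gp_S_summable hx).hasSum).summable
    (Complex.hasSum_re (gp_S_summable hz).hasSum).summable
  rw [sub_re, sub_re]
  have hn : (0 : ℝ) ≤ n := n.cast_nonneg
  have a : (1 / ((n : ℂ) + z)).re ≤ 1 / (n + z.re) := by
    refine (Complex.re_le_norm _).trans ?_
    rw [norm_div, norm_one]
    have : n + z.re ≤ ‖(n : ℂ) + z‖ := by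
      refine le_trans ?_ (Complex.re_le_norm _); simp
    gcongr
  have b : (1 / ((n : ℂ) + (z.re : ℂ))).re = 1 / (n + z.re) := by
    rw [show (1 / ((n : ℂ) + (z.re : ℂ))) = ((1 / (n + z.re) : ℝ) : ℂ) by push_cast; rfl]
    exact Complex.ofReal_re _
  linarith

lemma gp_psi_54 : -(9 / 20 : ℝ) ≤ gpsi (5 / 4) := by
  have h1 := gpsi_rec (x := 5 / 4) (by norm_num)
  have h2 := gpsi_rec (x := 9 / 4) (by norm_num)
  have h3 := gpsi_ge (x := 9 / 4) (by norm_num)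
  norm_num at h1 h2 h3
  have : (0.8 : ℝ) ≤ Real.log (9 / 4) := by
    have h : (4 : ℝ) ≤ Real.log ((9 / 4) ^ 5) := by
      rw [Real.le_log_iff_exp_le (by norm_num), show (4 : ℝ) = ((4 : ℕ) : ℝ) * 1 by norm_num,
        Real.exp_nat_mul]
      have := Real.exp_one_lt_d9
      refine (pow_le_pow_left₀ (Real.exp_pos 1).le this.le 4).trans (by norm_num)
    rw [Real.log_pow] at h
    push_cast at h
    linarith
  norm_num at this
  linarith

end

section
open Complex MeasureTheory Filter Topology Set

lemma gp_bc {Z : ℂ → ℂ} {w : ℂ} {R M : ℝ} (hR : 0 < R) (hM : 0 < M)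
    (hZ : DifferentiableOn ℂ Z (Metric.ball w R)) (hnz : ∀ u ∈ Metric.ball w R, Z u ≠ 0)
    (hb : ∀ u ∈ Metric.ball w R, ‖Z u‖ ≤ Real.exp M * ‖Z w‖) :
    ∃ g : ℂ → ℂ, ∀ u ∈ Metric.ball w R, HasDerivAt g (logDeriv Z u) u ∧ Z u = Z w * exp (g u) ∧
      ‖g u‖ ≤ 2 * M * ‖u - w‖ / (R - ‖u - w‖) := by
  have hw : w ∈ Metric.ball w R := Metric.mem_ball_self hR
  have hld : DifferentiableOn ℂ (logDeriv Z) (Metric.ball w R) :=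
    (hZ.deriv Metric.isOpen_ball).div hZ hnz
  obtain ⟨g0, hg0⟩ := hld.isExactOn_ball
  set g : ℂ → ℂ := fun u => g0 u - g0 w with hg
  have hgd : ∀ u ∈ Metric.ball w R, HasDerivAt g (logDeriv Z u) u := fun u hu =>
    (hg0 u hu).sub_const _
  have hgw : g w = 0 := by simp [hg]
  have hZe : ∀ u ∈ Metric.ball w R, Z u = Z w * exp (g u) := by
    have hd : ∀ u ∈ Metric.ball w R, HasDerivAt (fun u => Z u * exp (- g u)) 0 u := by
      intro u hu
      have h1 := ((hZ u hu).differentiableAt (Metric.isOpen_ball.mem_nhds hu)).hasDerivAt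
      have h2 := (hgd u hu).neg.cexp
      refine (h1.mul h2).congr_deriv ?_
      rw [logDeriv_apply]
      field_simp [hnz u hu]
      ring
    intro u hu
    have hc := (convex_ball w R).is_const_of_fderivWithin_eq_zero (𝕜 := ℂ)
      (f := fun u => Z u * exp (- g u)) (fun v hv => (hd v hv).differentiableAt.differentiableWithinAt)
      (fun v hv => by
        rw [fderivWithin_of_isOpen Metric.isOpen_ball hv]
        have := (hd v hv).hasFDerivAt.fderiv
        rw [this]; ext; simp) hu hw
    simp only [hgw, neg_zero, Complex.exp_zero, mul_one] at hc
    rw [← hc, mul_assoc, ← Complex.exp_add]; simp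
  refine ⟨g, fun u hu => ⟨hgd u hu, hZe u hu, ?_⟩⟩
  have key := Complex.borelCaratheodory_zero (f := fun v => g (w + v)) (R := R) (M := M)
    (z := u - w) hM ?_ ?_ hR ?_ ?_
  · simpa using key
  · intro v hv
    have hv' : w + v ∈ Metric.ball w R := by simpa using hv
    have h := (hgd _ hv')
    have h2 : HasDerivAt (fun v => w + v) 1 v := (hasDerivAt_id v).const_add w
    exact (h.comp v h2).differentiableAt.differentiableWithinAt
  · intro v hv
    have hv' : w + v ∈ Metric.ball w R := by simpa using hv
    have h := hb _ hv'
    rw [hZe _ hv', norm_mul, Complex.norm_exp, mul_comm] at h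
    have h0 : 0 < ‖Z w‖ := norm_pos_iff.2 (hnz w hw)
    exact Real.exp_le_exp.1 (le_of_mul_le_mul_right h h0)
  · simpa [dist_eq_norm] using hu
  · simp [hgw]

lemma gp_growth {Z : ℂ → ℂ} {c : ℝ} (hc : 1 / 2 < c) (hc1 : c ≤ 1) (hd : Differentiable ℂ Z)
    (hg : ∃ C, ∀ s : ℂ, 1 / 4 ≤ s.re → ‖Z s‖ ≤ C * (1 + ‖s‖) ^ 2)
    (hnz : ∀ s : ℂ, 1 / 2 < s.re → Z s ≠ 0)
    (hl : ∃ c0 > 0, ∀ s : ℂ, 2 ≤ s.re → c0 ≤ ‖Z s‖) :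
    ∃ C, 0 ≤ C ∧ ∀ s : ℂ, c ≤ s.re → ‖logDeriv Z s‖ ≤ C * (1 + ‖s‖) ^ (1 / 2 : ℝ) ∧
      ‖Z s‖⁻¹ ≤ C * Real.exp (C * (1 + ‖s‖) ^ (1 / 2 : ℝ)) := by
  obtain ⟨C, hC⟩ := hg
  obtain ⟨c0, hc0, hl⟩ := hl
  set δ := c - 1 / 2 with hδ
  have hδ0 : 0 < δ := by linarith
  have hδ1 : δ ≤ 1 / 2 := by linarith
  have hCpos : 0 < C := by
    have := (norm_pos_iff.2 (hnz 1 (by norm_num))).trans_le (hC 1 (by norm_num))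
    by_contra h
    have : C * (1 + ‖(1 : ℂ)‖) ^ 2 ≤ 0 := mul_nonpos_of_nonpos_of_nonneg (by linarith) (by positivity)
    linarith
  set K := (C * 36 / c0) with hK
  have hK0 : 0 < K := by positivity
  set M0 := 4 * (K + 1) ^ (1 / 4 : ℝ) with hM0
  have hM0p : 0 < M0 := by positivity
  set D := 2 * M0 * (2 + δ / 4) / (δ / 4) with hD
  have hDp : 0 < D := by positivity
  refine ⟨D + D / (δ / 4) + c0⁻¹, by positivity, fun s hs => ?_⟩
  set Y := (1 + ‖s‖) ^ (1 / 2 : ℝ) with hY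
  have hY1 : 1 ≤ Y := Real.one_le_rpow (by linarith [norm_nonneg s]) (by norm_num)
  set w := s + 2 with hw
  have hball : ∀ u ∈ Metric.ball w (2 + δ / 2), 1 / 2 < u.re ∧ ‖u‖ ≤ ‖s‖ + 5 := by
    intro u hu
    rw [mem_ball_iff_norm] at hu
    constructor
    · have := (Complex.abs_re_le_norm (u - w)).trans hu.le
      rw [abs_le] at this
      have h2 := this.1
      simp [hw] at h2
      linarith
    · have h1 : ‖u‖ ≤ ‖u - w‖ + ‖w‖ := by simpa using norm_add_le (u - w) w
      have h2 : ‖w‖ ≤ ‖s‖ + 2 := by simpa using norm_add_le s 2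
      linarith
  have hwl := hl w (by simp [hw]; linarith)
  have hw0 : 0 < ‖Z w‖ := hc0.trans_le hwl
  have hexp : ∀ u ∈ Metric.ball w (2 + δ / 2), ‖Z u‖ ≤ Real.exp (M0 * Y) * ‖Z w‖ := by
    intro u hu
    obtain ⟨h1, h2⟩ := hball u hu
    have b1 : ‖Z u‖ ≤ K * (1 + ‖s‖) ^ 2 * c0 := by
      refine (hC u (by linarith)).trans ?_
      have : (1 + ‖u‖) ≤ 6 * (1 + ‖s‖) := by linarith [norm_nonneg s]
      calc C * (1 + ‖u‖) ^ 2 ≤ C * (6 * (1 + ‖s‖)) ^ 2 := by gcongr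
        _ = _ := by rw [hK]; field_simp; ring
    refine b1.trans (mul_le_mul ?_ hwl hc0.le (Real.exp_pos _).le)
    have hp : (0 : ℝ) < 1 + ‖s‖ := by positivity
    have h3 : K * (1 + ‖s‖) ^ 2 ≤ (K + 1) * (1 + ‖s‖) ^ 2 := by gcongr; linarith
    refine h3.trans ?_
    rw [← Real.log_le_iff_le_exp (by positivity)]
    refine (Real.log_le_rpow_div (by positivity) (by norm_num : (0 : ℝ) < 1 / 4)).trans (le_of_eq ?_)
    rw [Real.mul_rpow (by positivity) (by positivity), ← Real.rpow_natCast (1 + ‖s‖) 2,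
      ← Real.rpow_mul hp.le, hM0, hY]
    norm_num
    ring
  obtain ⟨g, hgg⟩ := gp_bc (by positivity : 0 < 2 + δ / 2) (by positivity : 0 < M0 * Y)
    hd.differentiableOn (fun u hu => hnz u (hball u hu).1) hexp
  have hgb : ∀ u, ‖u - w‖ ≤ 2 + δ / 4 → u ∈ Metric.ball w (2 + δ / 2) ∧ ‖g u‖ ≤ D * Y := by
    intro u hu
    have hu' : u ∈ Metric.ball w (2 + δ / 2) := by rw [mem_ball_iff_norm]; linarith
    refine ⟨hu', (hgg u hu').2.2.trans ?_⟩
    have : D * Y = 2 * (M0 * Y) * (2 + δ / 4) / (δ / 4) := by rw [hD]; ring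
    rw [this]
    have : δ / 4 ≤ 2 + δ / 2 - ‖u - w‖ := by linarith
    gcongr
  have hsw : ‖s - w‖ = 2 := by simp [hw]
  obtain ⟨hsb, hsg⟩ := hgb s (by rw [hsw]; linarith)
  have hX : (0 : ℝ) ≤ c0⁻¹ := by positivity
  have hX2 : (0 : ℝ) ≤ D / (δ / 4) := by positivity
  constructor
  · have hder := Complex.norm_deriv_le_of_forall_mem_sphere_norm_le (f := g) (c := s) (R := δ / 4)
      (C := D * Y) (by positivity) (by
        refine DifferentiableOn.diffContOnCl ?_
        rw [closure_ball _ (by positivity)]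
        intro u hu
        rw [mem_closedBall_iff_norm] at hu
        have : ‖u - w‖ ≤ 2 + δ / 4 := by
          have := norm_add_le (u - s) (s - w)
          rw [sub_add_sub_cancel, hsw] at this; linarith
        exact (hgg u (hgb u this).1).1.differentiableAt.differentiableWithinAt) (by
        intro u hu
        rw [mem_sphere_iff_norm] at hu
        have : ‖u - w‖ ≤ 2 + δ / 4 := by
          have := norm_add_le (u - s) (s - w)
          rw [sub_add_sub_cancel, hsw] at this; linarith
        exact (hgb u this).2)
    rw [(hgg s hsb).1.deriv] at hder
    refine hder.trans ?_
    rw [mul_div_right_comm]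
    gcongr
    linarith
  · rw [(hgg s hsb).2.1, norm_mul, mul_inv, Complex.norm_exp, ← Real.exp_neg]
    have h1 : ‖Z w‖⁻¹ ≤ c0⁻¹ := by gcongr
    have h2 : -(g s).re ≤ D * Y := by
      have := (abs_le.1 (Complex.abs_re_le_norm (g s))).1
      linarith
    have h3 : D * Y ≤ (D + D / (δ / 4) + c0⁻¹) * Y := by gcongr; linarith
    have h4 : c0⁻¹ ≤ D + D / (δ / 4) + c0⁻¹ := by linarith
    gcongr
    · exact h1.trans h4
    · linarith

end

section
open Complex MeasureTheory Filter Topology Set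
open scoped ComplexConjugate

noncomputable def gpX (A κ : ℝ) (Z : ℂ → ℂ) (s : ℂ) : ℂ := exp (A * s) * Gamma ((s + κ) / 2) * Z s

noncomputable def gpG (A κ : ℝ) (Z : ℂ → ℂ) (s : ℂ) : ℂ :=
  A + digamma ((s + κ) / 2) / 2 + logDeriv Z s

structure GPD (Z : ℂ → ℂ) (A κ : ℝ) : Prop where
  diff : Differentiable ℂ Z
  growth : ∃ C, ∀ s : ℂ, 1 / 4 ≤ s.re → ‖Z s‖ ≤ C * (1 + ‖s‖) ^ 2
  nz : ∀ s : ℂ, 1 / 2 < s.re → Z s ≠ 0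
  low : ∃ c0 > 0, ∀ s : ℂ, 2 ≤ s.re → c0 ≤ ‖Z s‖
  rl : ∃ B, ∀ x h : ℝ, 2 ≤ x → 0 < h → ‖Z x‖ ≤ B * ‖Z (x + h)‖
  fe : ∀ s : ℂ, 0 < s.re → s.re < 1 → ‖gpX A κ Z s‖ = ‖gpX A κ Z (1 - conj s)‖
  kap : 0 ≤ κ

lemma gp_gamma_ratio {k : ℝ} (hk : 0 < k) : ∃ B, 0 ≤ B ∧ ∀ z : ℂ, 1 / 8 ≤ z.re →
    ‖Gamma z‖ ≤ B * ‖Gamma (z + k)‖ := by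
  set B0 := ∫ x : ℝ in 0..1, ‖(x : ℂ) ^ (((1 / 8 : ℝ) : ℂ) - 1) * (1 - (x : ℂ)) ^ ((k : ℂ) - 1)‖ with hB0
  have hIntg := (betaIntegral_convergent (u := ((1 / 8 : ℝ) : ℂ)) (v := k) (by simp) (by simpa using hk)).norm
  have hB00 : 0 ≤ B0 := intervalIntegral.integral_nonneg (by norm_num) (fun x _ => norm_nonneg _)
  have hg : 0 < Real.Gamma k := Real.Gamma_pos_of_pos hk
  refine ⟨B0 / Real.Gamma k, by positivity, fun z hz => ?_⟩
  have h1 := Gamma_mul_Gamma_eq_betaIntegral (s := z) (t := k) (by linarith) (by simpa using hk)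
  have h2 : ‖betaIntegral z k‖ ≤ B0 := by
    refine intervalIntegral.norm_integral_le_of_norm_le (by norm_num) ?_ hIntg
    refine Eventually.of_forall fun x hx => ?_
    rw [norm_mul, norm_mul]
    refine mul_le_mul_of_nonneg_right ?_ (norm_nonneg _)
    rw [Complex.norm_cpow_eq_rpow_re_of_pos hx.1, Complex.norm_cpow_eq_rpow_re_of_pos hx.1]
    refine Real.rpow_le_rpow_of_exponent_ge hx.1 hx.2 ?_
    simp only [sub_re, ofReal_re, one_re]
    linarith
  have h3 := congrArg norm h1
  rw [norm_mul, norm_mul, Complex.Gamma_ofReal, norm_real, Real.norm_eq_abs, abs_of_pos hg] at h3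
  rw [div_mul_eq_mul_div, le_div_iff₀ hg, h3, mul_comm]
  gcongr

namespace GPD
variable {Z : ℂ → ℂ} {A κ : ℝ}

lemma X_ne (D : GPD Z A κ) {s : ℂ} (hs : 1 / 2 < s.re) : gpX A κ Z s ≠ 0 := by
  unfold gpX
  have : 0 < ((s + κ) / 2).re := by
    have := D.kap
    simp; linarith
  exact mul_ne_zero (mul_ne_zero (exp_ne_zero _) (Gamma_ne_zero_of_re_pos this)) (D.nz s hs)

lemma X_diff (D : GPD Z A κ) {s : ℂ} (hs : 0 < s.re) : DifferentiableAt ℂ (gpX A κ Z) s := by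
  have h0 : 0 < ((s + κ) / 2).re := by
    have := D.kap
    simp; linarith
  unfold gpX
  have h1 : DifferentiableAt ℂ (fun s : ℂ => Gamma ((s + κ) / 2)) s := by
    have := gp_Gamma_diff h0
    exact DifferentiableAt.comp s this (by fun_prop)
  have := D.diff s
  exact ((by fun_prop : DifferentiableAt ℂ (fun s : ℂ => exp (A * s)) s).mul h1).mul this

lemma X_logDeriv (D : GPD Z A κ) {s : ℂ} (hs : 1 / 2 < s.re) :
    logDeriv (gpX A κ Z) s = gpG A κ Z s := by
  have h0 : 0 < ((s + κ) / 2).re := by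
    have := D.kap
    simp; linarith
  have e1 : HasDerivAt (fun s : ℂ => exp (A * s)) (exp (A * s) * (A * 1)) s :=
    ((hasDerivAt_id s).const_mul (A : ℂ)).cexp
  have e2 : HasDerivAt (fun s : ℂ => Gamma ((s + κ) / 2)) (deriv Gamma ((s + κ) / 2) * (1 / 2)) s :=
    HasDerivAt.comp s (gp_Gamma_diff h0).hasDerivAt (((hasDerivAt_id s).add_const (κ : ℂ)).div_const 2)
  have e3 := (D.diff s).hasDerivAt
  have e4 := ((e1.mul e2).mul e3).deriv
  have hG := Gamma_ne_zero_of_re_pos h0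
  have hZ := D.nz s hs
  have hE := exp_ne_zero (A * s)
  rw [logDeriv_apply]
  have e5 : gpX A κ Z = ((fun s : ℂ => exp (A * s)) * fun s : ℂ => Gamma ((s + κ) / 2)) * Z := by
    ext s; simp [gpX]
  rw [e5, e4]
  simp only [Pi.mul_apply, gpG, digamma_def, logDeriv_apply]
  field_simp

lemma X_le (D : GPD Z A κ) {s : ℂ} {h : ℝ} (hh : 0 < h) (hh1 : h < 1 / 2) (hs : 1 / 2 - h / 2 ≤ s.re) :
    ‖gpX A κ Z s‖ ≤ ‖gpX A κ Z (s + h)‖ := by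
  have hκ := D.kap
  obtain ⟨CZ, hCZ⟩ := D.growth
  obtain ⟨CL, hCL0, hCL⟩ := gp_growth (c := 1 / 2 + h / 2) (by linarith) (by linarith) D.diff D.growth D.nz D.low
  obtain ⟨BR, hBR⟩ := D.rl
  obtain ⟨BG, hBG0, hBG⟩ := gp_gamma_ratio (k := h / 2) (by linarith)
  have hCZ0 : 0 ≤ CZ := by
    have := (norm_nonneg _).trans (hCZ 1 (by norm_num))
    by_contra h'
    have : CZ * (1 + ‖(1 : ℂ)‖) ^ 2 < 0 := mul_neg_of_neg_of_pos (by linarith) (by positivity)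
    linarith
  set f : ℂ → ℂ := fun w => gpX A κ Z (w + (1 / 2 - h / 2 : ℝ)) / gpX A κ Z (w + (1 / 2 + h / 2 : ℝ)) with hf
  have hne : ∀ w : ℂ, 0 ≤ w.re → gpX A κ Z (w + (1 / 2 + h / 2 : ℝ)) ≠ 0 := by
    intro w hw
    refine D.X_ne ?_
    simp; linarith
  have hfe : ∀ w : ℂ, 0 ≤ w.re → ‖f w‖ ≤ Real.exp (-A * h) * BG *
      (‖Z (w + (1 / 2 - h / 2 : ℝ))‖ * ‖Z (w + (1 / 2 + h / 2 : ℝ))‖⁻¹) := by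
    intro w hw
    rw [hf]; simp only [gpX]
    set a := w + (1 / 2 - h / 2 : ℝ) with ha
    have hb : w + (1 / 2 + h / 2 : ℝ) = a + h := by rw [ha]; push_cast; ring
    rw [hb]
    have har : 1 / 8 ≤ ((a + κ) / 2).re := by simp [ha]; linarith
    have hgr := hBG ((a + κ) / 2) har
    have hb2 : (a + h + κ) / 2 = (a + κ) / 2 + ((h / 2 : ℝ) : ℂ) := by push_cast; ring
    rw [hb2]
    have hgp : 0 < ‖Gamma ((a + κ) / 2 + ((h / 2 : ℝ) : ℂ))‖ := by
      refine norm_pos_iff.2 (Gamma_ne_zero_of_re_pos ?_)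
      rw [add_re, ofReal_re]; linarith
    have hex : ‖exp (A * a)‖ = Real.exp (-A * h) * ‖exp (A * (a + h))‖ := by
      rw [Complex.norm_exp, Complex.norm_exp, ← Real.exp_add]
      congr 1; simp; ring
    have hep : 0 < ‖exp (A * (a + h))‖ := norm_pos_iff.2 (exp_ne_zero _)
    rw [norm_div, norm_mul, norm_mul, norm_mul, norm_mul, hex]
    have : Real.exp (-A * h) * ‖exp (A * (a + h))‖ * ‖Gamma ((a + κ) / 2)‖ * ‖Z a‖ /
        (‖exp (A * (a + h))‖ * ‖Gamma ((a + κ) / 2 + ((h / 2 : ℝ) : ℂ))‖ * ‖Z (a + h)‖) =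
        Real.exp (-A * h) * (‖Gamma ((a + κ) / 2)‖ / ‖Gamma ((a + κ) / 2 + ((h / 2 : ℝ) : ℂ))‖) *
        (‖Z a‖ * ‖Z (a + h)‖⁻¹) := by
      rw [← div_eq_mul_inv]
      field_simp
    rw [this]
    gcongr
    rw [div_le_iff₀ hgp]; exact hgr
  have key := PhragmenLindelof.right_half_plane_of_bounded_on_real (f := f) (C := 1)
    (z := s - (1 / 2 - h / 2 : ℝ)) ?_ ?_ ?_ ?_ ?_
  · rw [hf] at key; simp only [sub_add_cancel] at key
    have hb : s - (1 / 2 - h / 2 : ℝ) + (1 / 2 + h / 2 : ℝ) = s + h := by push_cast; ring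
    rw [hb, norm_div, div_le_one (norm_pos_iff.2 (D.X_ne (by simp; linarith)))] at key
    exact key
  · have hcl : closure {z : ℂ | 0 < z.re} = {z : ℂ | 0 ≤ z.re} := by
      simp
    refine DifferentiableOn.diffContOnCl ?_
    rw [hcl]
    intro w hw
    refine DifferentiableAt.differentiableWithinAt ?_
    have hw' : 0 ≤ w.re := hw
    have d1 : DifferentiableAt ℂ (fun w : ℂ => gpX A κ Z (w + (1 / 2 - h / 2 : ℝ))) w :=
      DifferentiableAt.comp w (D.X_diff (by simp; linarith)) (by fun_prop)
    have d2 : DifferentiableAt ℂ (fun w : ℂ => gpX A κ Z (w + (1 / 2 + h / 2 : ℝ))) w :=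
      DifferentiableAt.comp w (D.X_diff (by simp; linarith)) (by fun_prop)
    exact d1.div d2 (hne w hw')
  · refine ⟨1, by norm_num, 1 + CL, ?_⟩
    refine Asymptotics.IsBigO.of_bound (Real.exp (-A * h) * BG * (CZ * (2 * Real.exp 2) * (CL * Real.exp (2 * CL)))) ?_
    refine eventually_inf_principal.2 (Eventually.of_forall fun w hw => ?_)
    have hw' : 0 ≤ w.re := le_of_lt hw
    refine (hfe w hw').trans ?_
    rw [Real.norm_eq_abs, abs_of_pos (Real.exp_pos _), Real.rpow_one, mul_assoc, mul_assoc, mul_assoc, mul_assoc]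
    refine mul_le_mul_of_nonneg_left (mul_le_mul_of_nonneg_left ?_ hBG0) (Real.exp_pos _).le
    have g1 : ‖Z (w + (1 / 2 - h / 2 : ℝ))‖ ≤ CZ * (2 * Real.exp 2) * Real.exp ‖w‖ := by
      refine (hCZ _ (by simp; linarith)).trans ?_
      have n1 : ‖w + (1 / 2 - h / 2 : ℝ)‖ ≤ ‖w‖ + 1 := by
        refine (norm_add_le _ _).trans ?_
        rw [norm_real, Real.norm_eq_abs, abs_of_pos (by linarith)]; linarith
      rw [mul_assoc, mul_assoc]
      refine mul_le_mul_of_nonneg_left ?_ hCZ0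
      rw [← Real.exp_add]
      have q := Real.quadratic_le_exp_of_nonneg (x := 2 + ‖w‖) (by positivity)
      have : (1 + ‖w + (1 / 2 - h / 2 : ℝ)‖) ^ 2 ≤ (2 + ‖w‖) ^ 2 :=
        pow_le_pow_left₀ (by positivity) (by linarith) 2
      nlinarith [norm_nonneg w]
    have g2 : ‖Z (w + (1 / 2 + h / 2 : ℝ))‖⁻¹ ≤ CL * Real.exp (2 * CL) * Real.exp (CL * ‖w‖) := by
      refine (hCL _ (by simp; linarith)).2.trans ?_
      have n1 : ‖w + (1 / 2 + h / 2 : ℝ)‖ ≤ ‖w‖ + 1 := by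
        refine (norm_add_le _ _).trans ?_
        rw [norm_real, Real.norm_eq_abs, abs_of_pos (by linarith)]; linarith
      rw [mul_assoc, ← Real.exp_add]
      refine mul_le_mul_of_nonneg_left (Real.exp_le_exp.2 ?_) hCL0
      have : (1 + ‖w + (1 / 2 + h / 2 : ℝ)‖) ^ (1 / 2 : ℝ) ≤ 2 + ‖w‖ := by
        refine (Real.rpow_le_rpow_of_exponent_le (y := 1 / 2) (z := 1) ?_ (by norm_num)).trans ?_
        · linarith [norm_nonneg (w + (1 / 2 + h / 2 : ℝ))]
        · rw [Real.rpow_one]; linarith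
      nlinarith
    calc _ ≤ (CZ * (2 * Real.exp 2) * Real.exp ‖w‖) * (CL * Real.exp (2 * CL) * Real.exp (CL * ‖w‖)) := by
          gcongr
      _ = _ := by
        rw [show (1 + CL) * ‖w‖ = ‖w‖ + CL * ‖w‖ by ring, Real.exp_add]; ring
  · refine ⟨Real.exp (-A * h) * BG * |BR|, eventually_map.2 ?_⟩
    filter_upwards [eventually_ge_atTop 2] with x hx
    refine (hfe x (by simp; linarith)).trans ?_
    refine mul_le_mul_of_nonneg_left ?_ (by positivity)
    have h1 := hBR (x + (1 / 2 - h / 2)) h (by linarith) hh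
    rw [← div_eq_mul_inv, div_le_iff₀ (norm_pos_iff.2 (D.nz _ (by simp; linarith)))]
    have e1 : (x : ℂ) + (1 / 2 - h / 2 : ℝ) = ((x + (1 / 2 - h / 2) : ℝ) : ℂ) := by push_cast; ring
    have e2 : (x : ℂ) + (1 / 2 + h / 2 : ℝ) = ((x + (1 / 2 - h / 2) : ℝ) : ℂ) + h := by push_cast; ring
    rw [e1, e2]
    refine h1.trans ?_
    gcongr
    exact le_abs_self _
  · intro x
    rw [hf]; simp only
    rw [norm_div, D.fe _ (by simp; linarith) (by simp; linarith)]
    have : 1 - conj (↑x * I + ((1 / 2 - h / 2 : ℝ) : ℂ)) = ↑x * I + ((1 / 2 + h / 2 : ℝ) : ℂ) := by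
      simp only [map_add, map_mul, conj_ofReal, conj_I]; push_cast; ring
    rw [this, div_self (norm_ne_zero_iff.2 (hne _ (by simp)))]
  · simp only [sub_re, ofReal_re]; linarith

lemma G_nonneg (D : GPD Z A κ) {s : ℂ} (hs : 1 / 2 < s.re) : 0 ≤ (gpG A κ Z s).re := by
  rw [← D.X_logDeriv hs]
  have hX := D.X_ne hs
  set u : ℝ → ℂ := fun h => gpX A κ Z (s + h) / gpX A κ Z s with hu
  have hd : HasDerivAt u (logDeriv (gpX A κ Z) s) 0 := by
    have h1 := (D.X_diff (s := s) (by linarith)).hasDerivAt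
    have h2 : HasDerivAt (fun h : ℝ => s + (h : ℂ)) 1 0 :=
      (Complex.ofRealCLM.hasDerivAt (x := (0 : ℝ))).const_add s
    have h3 : HasDerivAt (gpX A κ Z) (deriv (gpX A κ Z) s) (s + ((0 : ℝ) : ℂ)) := by simpa using h1
    have h4 := (HasDerivAt.comp (0 : ℝ) h3 h2).div_const (gpX A κ Z s)
    refine h4.congr_deriv ?_
    rw [logDeriv_apply, mul_one]
  have hn := hd.norm_sq
  have hu0 : u 0 = 1 := by simp [hu, hX]
  have hn' := hn.hasDerivWithinAt (s := Ioi 0)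
  rw [hasDerivWithinAt_iff_tendsto_slope' (by simp)] at hn'
  have : 0 ≤ 2 * inner ℝ (u 0) (logDeriv (gpX A κ Z) s) := by
    refine ge_of_tendsto hn' ?_
    filter_upwards [Ioo_mem_nhdsGT (show (0 : ℝ) < 1 / 2 by norm_num)] with h hh
    rw [slope_def_field]
    refine div_nonneg ?_ (by linarith [hh.1])
    have h1 := D.X_le hh.1 hh.2 (s := s) (by linarith [hh.1])
    have h2 : 1 ≤ ‖u h‖ := by
      rw [hu]; simp only [norm_div]
      rw [one_le_div (norm_pos_iff.2 hX)]; exact h1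
    simp only [hu0, norm_one]
    nlinarith
  rw [hu0] at this
  simp at this
  exact this

end GPD

end

section
open Complex MeasureTheory Filter Topology Set
open scoped ComplexConjugate

/-- the weight function -/
noncomputable def gpW (y : ℝ) : ℝ := y ^ (-(1 / 2) : ℝ) * max 0 (Real.log y)

noncomputable def gpf0 (a : ℂ) : ℝ → ℂ := indicator (Ioc 0 1) (fun t : ℝ => (t : ℂ) ^ a)

lemma gp_mellin_log {s : ℂ} (hs : -(1 / 2) < s.re) :
    HasMellin (fun t => -((Real.log t : ℂ) • gpf0 (1 / 2) t)) s (1 / (s + 1 / 2) ^ 2) := by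
  have hbot : gpf0 (1 / 2) =O[𝓝[>] 0] (fun t : ℝ => t ^ (-(-(1 / 2)) : ℝ)) := by
    refine Asymptotics.IsBigO.of_bound 1 ?_
    filter_upwards [self_mem_nhdsWithin] with t ht
    have ht' : 0 < t := ht
    unfold gpf0
    refine (norm_indicator_le_norm_self _ _).trans ?_
    rw [Complex.norm_cpow_eq_rpow_re_of_pos ht', Real.norm_eq_abs, abs_of_pos (by positivity)]
    simp
  have htop : gpf0 (1 / 2) =O[atTop] (fun t : ℝ => t ^ (-(s.re + 1) : ℝ)) := by
    refine Asymptotics.IsBigO.of_bound 1 ?_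
    filter_upwards [eventually_gt_atTop 1] with t ht
    have : gpf0 (1 / 2) t = 0 := by
      unfold gpf0
      exact indicator_of_notMem (fun h => by linarith [h.2]) _
    rw [this]; simp
  have hloc : LocallyIntegrableOn (gpf0 (1 / 2)) (Ioi 0) := by
    have h := (hasMellin_cpow_Ioc (1 / 2) (s := 1) (by simp; norm_num)).1
    unfold MellinConvergent at h
    refine IntegrableOn.locallyIntegrableOn (h.congr_fun (fun t _ => ?_) measurableSet_Ioi)
    simp [gpf0]
  obtain ⟨h1, h2⟩ := mellin_hasDerivAt_of_isBigO_rpow hloc htop (by linarith) hbot hs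
  have h3 : HasDerivAt (mellin (gpf0 (1 / 2))) (-1 / (s + 1 / 2) ^ 2) s := by
    have hne : s + 1 / 2 ≠ 0 := by
      intro h
      have := congrArg Complex.re h
      simp at this; linarith
    have h4 : HasDerivAt (fun s : ℂ => 1 / (s + 1 / 2)) (-1 / (s + 1 / 2) ^ 2) s := by
      have := ((hasDerivAt_id s).add_const (1 / 2 : ℂ)).fun_inv hne
      simpa using this
    refine h4.congr_of_eventuallyEq ?_
    have ho : IsOpen {s : ℂ | -(1 / 2) < s.re} := isOpen_lt continuous_const Complex.continuous_re
    filter_upwards [ho.mem_nhds hs] with w hw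
    have hw' : -(1 / 2) < w.re := hw
    exact (hasMellin_cpow_Ioc (1 / 2) (s := w) (by simp; linarith)).2
  have h5 := h2.unique h3
  have h6 := hasMellin_const_smul (R := ℂ) h1 (-1)
  rw [h5] at h6
  convert h6 using 1
  · ext t; simp
  · simp [neg_div]

lemma gp_log_val {t : ℝ} (ht : 0 < t) :
    -((Real.log t : ℂ) • gpf0 (1 / 2) t) = ((gpW (1 / t) : ℝ) : ℂ) := by
  unfold gpf0 gpW
  have e : ((1 / t) ^ (-(1 / 2) : ℝ) : ℝ) = t ^ (1 / 2 : ℝ) := by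
    rw [one_div, Real.inv_rpow ht.le, Real.rpow_neg ht.le, inv_inv]
  rw [e, show Real.log (1 / t) = -Real.log t by rw [one_div, Real.log_inv]]
  rcases le_or_gt t 1 with h | h
  · rw [indicator_of_mem (show t ∈ Ioc 0 1 from ⟨ht, h⟩), max_eq_right (by linarith [Real.log_nonpos ht.le h])]
    push_cast
    rw [Complex.ofReal_cpow ht.le, smul_eq_mul]
    push_cast; ring
  · rw [indicator_of_notMem (fun h' => by linarith [h'.2]), max_eq_left (by linarith [Real.log_pos h])]
    simp

lemma gpW_cont : ContinuousOn gpW (Ioi 0) := by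
  intro y hy
  have hy' : y ≠ 0 := ne_of_gt hy
  refine ContinuousAt.continuousWithinAt ?_
  unfold gpW
  exact (Real.continuousAt_rpow_const _ _ (Or.inl hy')).mul (continuousAt_const.max (Real.continuousAt_log hy'))

lemma gp_inv {f : ℝ → ℂ} {F : ℂ → ℂ} {σ x : ℝ} (hx : 0 < x)
    (hf : ∀ t : ℝ, HasMellin f (σ + t * I) (F (σ + t * I)))
    (hF : Integrable fun t : ℝ => F (σ + t * I)) (hc : ContinuousAt f (1 / x)) :
    ∫ t : ℝ, (x : ℂ) ^ (σ + t * I) * F (σ + t * I) = 2 * Real.pi * f (1 / x) := by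
  have e : ∀ t : ℝ, mellin f (σ + t * I) = F (σ + t * I) := fun t => (hf t).2
  have h := mellinInv_mellin_eq σ f (x := 1 / x) (by positivity) (by simpa using (hf 0).1) (by
    unfold VerticalIntegrable; simp_rw [e]; exact hF) hc
  unfold mellinInv at h
  simp_rw [e] at h
  have e2 : ∀ t : ℝ, ((1 / x : ℝ) : ℂ) ^ (-(σ + t * I : ℂ)) = (x : ℂ) ^ (σ + t * I : ℂ) := by
    intro t
    rw [one_div, ofReal_inv, Complex.inv_cpow _ _ (by
      rw [Complex.arg_ofReal_of_nonneg hx.le]; exact Real.pi_pos.ne), Complex.cpow_neg, inv_inv]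
  simp_rw [e2] at h
  rw [← h]
  have : (2 * Real.pi : ℂ) ≠ 0 := by
    have := Real.pi_pos.ne'
    simp [this]
  simp only [smul_eq_mul]
  rw [real_smul]
  push_cast
  rw [← mul_assoc, mul_one_div_cancel this, one_mul]

lemma gp_kernel_norm (α t : ℝ) : ‖((α : ℂ) + t * I) ^ 2‖ = α ^ 2 + t ^ 2 := by
  rw [norm_pow, Complex.sq_norm, Complex.normSq_apply]; simp; ring

lemma gp_kernel_integrable {α : ℝ} (hα : 0 < α) : Integrable fun t : ℝ => 1 / ((α : ℂ) + t * I) ^ 2 := by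
  refine (gp_int_cauchy hα).1.mono' ?_ ?_
  · refine Continuous.aestronglyMeasurable ?_
    refine continuous_const.div (by fun_prop) (fun t h => ?_)
    have := gp_kernel_norm α t
    rw [h] at this
    have : 0 < α ^ 2 + t ^ 2 := by positivity
    simp_all
  · refine Eventually.of_forall fun t => ?_
    rw [norm_div, gp_kernel_norm α, norm_one, one_div]

lemma gp_perron {σ y : ℝ} (hσ : -(1 / 2) < σ) (hy : 0 < y) :
    ∫ t : ℝ, (y : ℂ) ^ (σ + t * I) * (1 / (σ + t * I + 1 / 2) ^ 2) = (2 * Real.pi * gpW y : ℂ) := by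
  have := gp_inv (f := fun t => -((Real.log t : ℂ) • gpf0 (1 / 2) t))
    (F := fun s => 1 / (s + 1 / 2) ^ 2) (σ := σ) hy (fun t => gp_mellin_log (by simpa using hσ)) ?_ ?_
  · rw [this, gp_log_val (by positivity), one_div_one_div]
  · refine (gp_kernel_integrable (α := σ + 1 / 2) (by linarith)).congr (Eventually.of_forall fun t => ?_)
    simp only
    push_cast
    congr 2; ring
  · have : ContinuousAt (fun t : ℝ => ((gpW (1 / t) : ℝ) : ℂ)) (1 / y) := by
      refine Complex.continuous_ofReal.continuousAt.comp ?_
      refine ContinuousAt.comp (g := gpW) (f := fun t : ℝ => 1 / t) ?_ (continuousAt_const.div continuousAt_id (by positivity))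
      exact gpW_cont.continuousAt (Ioi_mem_nhds (by simpa using hy))
    refine this.congr ?_
    filter_upwards [Ioi_mem_nhds (show 0 < 1 / y by positivity)] with t ht
    exact (gp_log_val ht).symm

/-- The pole term. -/
lemma gp_perron_pole {x : ℝ} (hx : 1 < x) :
    ∫ t : ℝ, (x : ℂ) ^ (((2 : ℝ) : ℂ) + t * I) * (1 / (((2 : ℝ) : ℂ) + t * I - 1) * (1 / (((2 : ℝ) : ℂ) + t * I + 1 / 2) ^ 2)) =
    2 * Real.pi * ((4 / 9 * x - 4 / 9 * x ^ (-(1 / 2) : ℝ) - 2 / 3 * gpW x : ℝ) : ℂ) := by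
  have hx0 : 0 < x := by linarith
  set f : ℝ → ℂ := fun t => ((4 / 9 : ℂ) • gpf0 (-1) t - (4 / 9 : ℂ) • gpf0 (1 / 2) t) -
    (2 / 3 : ℂ) • (-((Real.log t : ℂ) • gpf0 (1 / 2) t)) with hf
  have hM : ∀ s : ℂ, 1 < s.re → HasMellin f s (1 / (s - 1) * (1 / (s + 1 / 2) ^ 2)) := by
    intro s hs
    have m1 := hasMellin_cpow_Ioc (-1) (s := s) (by simpa using hs)
    have m2 := hasMellin_cpow_Ioc (1 / 2) (s := s) (by simp; linarith)
    have m3 := gp_mellin_log (s := s) (by linarith)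
    have n1 := hasMellin_const_smul (R := ℂ) m1.1 (4 / 9)
    have n2 := hasMellin_const_smul (R := ℂ) m2.1 (4 / 9)
    have n3 := hasMellin_const_smul (R := ℂ) m3.1 (2 / 3)
    have n4 := hasMellin_sub n1.1 n2.1
    have n5 := hasMellin_sub n4.1 n3.1
    rw [n4.2, n1.2, n2.2, n3.2, m1.2, m2.2, m3.2] at n5
    refine ⟨n5.1, n5.2.trans ?_⟩
    have h1 : s - 1 ≠ 0 := by
      intro h
      have := congrArg Complex.re h
      simp at this; linarith
    have h2 : s + 1 / 2 ≠ 0 := by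
      intro h
      have := congrArg Complex.re h
      simp at this; linarith
    have h3 : s + -1 ≠ 0 := h1
    simp only [smul_eq_mul]
    rw [← sub_eq_add_neg]
    set a := 1 / (s - 1) with ha
    set b := 1 / (s + 1 / 2) with hb
    have ea : a * (s - 1) = 1 := by rw [ha]; field_simp
    have eb : b * (s + 1 / 2) = 1 := by rw [hb, one_div_mul_cancel h2]
    have eE : a - b - 3 / 2 * (a * b) = 0 := by linear_combination (-a) * eb + b * ea
    have e2 : 1 / (s + 1 / 2) ^ 2 = b ^ 2 := by rw [hb, div_pow, one_pow]
    rw [e2]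
    linear_combination (4 / 9 + 2 / 3 * b) * eE
  have hval : ∀ t : ℝ, 0 < t → t < 1 →
      f t = ((4 / 9 * (1 / t) - 4 / 9 * t ^ (1 / 2 : ℝ) - 2 / 3 * gpW (1 / t) : ℝ) : ℂ) := by
    intro t ht ht1
    rw [hf]; simp only
    rw [gp_log_val ht]
    unfold gpf0
    rw [indicator_of_mem (show t ∈ Ioc 0 1 from ⟨ht, ht1.le⟩), indicator_of_mem (show t ∈ Ioc 0 1 from ⟨ht, ht1.le⟩)]
    push_cast
    rw [Complex.ofReal_cpow ht.le, Complex.cpow_neg_one]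
    simp
  have hx1 : 1 / x < 1 := by rw [div_lt_one hx0]; exact hx
  have := gp_inv (f := f) (F := fun s => 1 / (s - 1) * (1 / (s + 1 / 2) ^ 2)) (σ := 2) hx0
    (fun t => hM _ (by simp)) ?_ ?_
  · rw [this, hval _ (by positivity) hx1, one_div_one_div]
    congr 5
    rw [one_div, Real.inv_rpow hx0.le, Real.rpow_neg hx0.le]
  · refine (gp_kernel_integrable (α := 5 / 2) (by norm_num)).mono ?_ (Eventually.of_forall fun t => ?_)
    · refine Continuous.aestronglyMeasurable ?_
      refine (continuous_const.div (by fun_prop) (fun t h => ?_)).mul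
        (continuous_const.div (by fun_prop) (fun t h => ?_))
      · have := congrArg Complex.re h
        simp at this; norm_num at this
      · have := congrArg Complex.re (pow_eq_zero_iff two_ne_zero |>.1 h)
        simp at this; norm_num at this
    · rw [norm_mul]
      have e : (((2 : ℝ) : ℂ) + t * I + 1 / 2) = ((5 / 2 : ℝ) : ℂ) + t * I := by push_cast; ring
      rw [e]
      refine mul_le_of_le_one_left (norm_nonneg _) ?_
      rw [norm_div, norm_one]
      refine div_le_one_of_le₀ ?_ (norm_nonneg _)
      refine le_trans ?_ (Complex.re_le_norm _)
      simp; norm_num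
  · have : ContinuousAt (fun t : ℝ => ((4 / 9 * (1 / t) - 4 / 9 * t ^ (1 / 2 : ℝ) - 2 / 3 * gpW (1 / t) : ℝ) : ℂ)) (1 / x) := by
      refine Complex.continuous_ofReal.continuousAt.comp ?_
      have c1 : ContinuousAt (fun t : ℝ => 1 / t) (1 / x) := continuousAt_const.div continuousAt_id (by positivity)
      have c2 : ContinuousAt (fun t : ℝ => gpW (1 / t)) (1 / x) := by
        refine ContinuousAt.comp (g := gpW) (f := fun t : ℝ => 1 / t) ?_ c1
        exact gpW_cont.continuousAt (Ioi_mem_nhds (by simpa using hx0))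
      have c3 : ContinuousAt (fun t : ℝ => t ^ (1 / 2 : ℝ)) (1 / x) :=
        Real.continuousAt_rpow_const _ _ (Or.inl (by positivity))
      exact ((c1.const_mul _).sub (c3.const_mul _)).sub (c2.const_mul _)
    refine this.congr ?_
    filter_upwards [Ioo_mem_nhds (show 0 < 1 / x by positivity) hx1] with t ht
    exact (hval t ht.1 ht.2).symm

end

section
open Complex MeasureTheory Filter Topology Set
open scoped ComplexConjugate

lemma gp_kern {w s : ℂ} {r : ℝ} (hr : 0 < r) (h : r ≤ ‖s - w‖) :
    ‖1 / (s - w) ^ 2‖ ≤ ((1 + ‖w‖) / r + 1) ^ 2 * ((1 + ‖s‖)⁻¹) ^ 2 := by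
  rw [norm_div, norm_one, norm_pow, one_div, ← inv_pow, ← mul_pow]
  exact pow_le_pow_left₀ (by positivity) (gp_far' hr h) 2

lemma gp_decay {C K X u : ℝ} {s a b k : ℂ} (hK : 0 ≤ K) (hX : 0 ≤ X) (ha : ‖a‖ ≤ C * (1 + ‖s‖) ^ (1 / 2 : ℝ))
    (hb : ‖b‖ ≤ X) (hk : ‖k‖ ≤ K * ((1 + ‖s‖)⁻¹) ^ 2) (hu : s.im = u) :
    ‖a * (b * k)‖ ≤ (C * X * K) * (1 + u ^ 2) ^ (-(3 / 4) : ℝ) := by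
  have h1 : 0 < 1 + ‖s‖ := by positivity
  have hC : 0 ≤ C := by
    by_contra h
    have : C * (1 + ‖s‖) ^ (1 / 2 : ℝ) < 0 := mul_neg_of_neg_of_pos (by linarith) (by positivity)
    linarith [norm_nonneg a]
  rw [norm_mul, norm_mul]
  calc ‖a‖ * (‖b‖ * ‖k‖) ≤ (C * (1 + ‖s‖) ^ (1 / 2 : ℝ)) * (X * (K * ((1 + ‖s‖)⁻¹) ^ 2)) := by gcongr
    _ = (C * X * K) * (1 + ‖s‖) ^ (-(3 / 2) : ℝ) := by
      have : (1 + ‖s‖) ^ (-(3 / 2) : ℝ) = (1 + ‖s‖) ^ (1 / 2 : ℝ) * ((1 + ‖s‖)⁻¹) ^ 2 := by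
        rw [← Real.rpow_neg_one, ← Real.rpow_natCast, ← Real.rpow_mul h1.le, ← Real.rpow_add h1]
        norm_num
      rw [this]; ring
    _ ≤ _ := by
      rw [← hu]
      exact mul_le_mul_of_nonneg_left gp_weight_le (by positivity)

lemma gp_xpow {x : ℝ} (hx : 1 ≤ x) {s : ℂ} {c : ℝ} (h : s.re ≤ c) : ‖(x : ℂ) ^ s‖ ≤ x ^ c := by
  rw [Complex.norm_cpow_eq_rpow_re_of_pos (by linarith)]
  exact Real.rpow_le_rpow_of_exponent_le hx h

namespace GPD
variable {Z : ℂ → ℂ} {A κ : ℝ}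

lemma L_diff (D : GPD Z A κ) : DifferentiableOn ℂ (logDeriv Z) {s | 1 / 2 < s.re} := by
  have ho : IsOpen {s : ℂ | 1 / 2 < s.re} := isOpen_lt continuous_const Complex.continuous_re
  have : DifferentiableOn ℂ (deriv Z) {s | 1 / 2 < s.re} := D.diff.differentiableOn.deriv ho
  exact this.div D.diff.differentiableOn (fun s hs => D.nz s hs)

lemma P_diff (D : GPD Z A κ) {x : ℝ} (hx : 1 ≤ x) : DifferentiableOn ℂ
    (fun s => logDeriv Z s * ((x : ℂ) ^ s * (1 / (s - (-(1 / 2))) ^ 2))) {s | 1 / 2 < s.re} := by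
  refine D.L_diff.mul (DifferentiableOn.mul ?_ ?_)
  · have : (x : ℂ) ≠ 0 := by exact_mod_cast (by linarith : x ≠ 0)
    exact fun s _ => (DifferentiableAt.const_cpow differentiableAt_id (Or.inl this)).differentiableWithinAt
  · refine DifferentiableOn.div (by fun_prop) (by fun_prop) (fun s hs h => ?_)
    have h2 := congrArg re (pow_eq_zero_iff (two_ne_zero) |>.1 h)
    have hs' : 1 / 2 < s.re := hs
    simp at h2; linarith

lemma P_bound (D : GPD Z A κ) {x c : ℝ} (hx : 1 ≤ x) (hc : 1 / 2 < c) (hc1 : c ≤ 1) :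
    ∃ C, ∀ s : ℂ, c ≤ s.re → s.re ≤ 2 → ‖logDeriv Z s * ((x : ℂ) ^ s * (1 / (s - (-(1 / 2))) ^ 2))‖
      ≤ C * (1 + s.im ^ 2) ^ (-(3 / 4) : ℝ) := by
  obtain ⟨CL, hCL0, hCL⟩ := gp_growth hc hc1 D.diff D.growth D.nz D.low
  refine ⟨CL * x ^ (2 : ℝ) * ((1 + ‖(-(1 / 2) : ℂ)‖) / 1 + 1) ^ 2, fun s h1 h2 => ?_⟩
  refine gp_decay (by positivity) (by positivity) (hCL s h1).1 (gp_xpow hx h2) (gp_kern one_pos ?_) rfl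
  refine le_trans ?_ (Complex.re_le_norm _)
  simp; linarith

lemma shift (D : GPD Z A κ) {x c : ℝ} (hx : 1 ≤ x) (hc : 1 / 2 < c) (hc1 : c ≤ 1) :
    ∫ t : ℝ, logDeriv Z (c + t * I) * ((x : ℂ) ^ (c + t * I) * (1 / (c + t * I - (-(1 / 2))) ^ 2)) =
    ∫ t : ℝ, logDeriv Z ((2 : ℝ) + t * I) * ((x : ℂ) ^ ((2 : ℝ) + t * I) * (1 / ((2 : ℝ) + t * I - (-(1 / 2))) ^ 2)) := by
  obtain ⟨C, hC⟩ := D.P_bound hx hc hc1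
  exact gp_strip (f := fun s => logDeriv Z s * ((x : ℂ) ^ s * (1 / (s - (-(1 / 2))) ^ 2))) (C := C)
    (by linarith : c ≤ 2) ((D.P_diff hx).mono fun s hs => lt_of_lt_of_le hc hs.1) hC

lemma P_int (D : GPD Z A κ) {x c : ℝ} (hx : 1 ≤ x) (hc : 1 / 2 < c) (hc1 : c ≤ 1) :
    Integrable fun t : ℝ => logDeriv Z (c + t * I) * ((x : ℂ) ^ (c + t * I) * (1 / (c + t * I - (-(1 / 2))) ^ 2)) := by
  obtain ⟨C, hC⟩ := D.P_bound hx hc hc1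
  refine gp_vert_integrable (f := fun s => logDeriv Z s * ((x : ℂ) ^ s * (1 / (s - (-(1 / 2))) ^ 2))) (C := C)
    (D.P_diff hx).continuousOn (fun s hs => ?_) (fun t => ?_)
  · simp [hs]; linarith
  · simpa using hC (c + t * I) (by simp) (by simp; linarith)

lemma conj_bound (D : GPD Z A κ) {x c B : ℝ} (hx : 1 ≤ x) (hc : 1 / 2 < c) (hc1 : c ≤ 1)
    (hB : ∀ t : ℝ, ‖logDeriv Z ((5 / 4 : ℝ) + t * I)‖ ≤ B) :
    Integrable (fun t : ℝ => conj (logDeriv Z (c + t * I)) *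
      ((x : ℂ) ^ (c + t * I) * (1 / (c + t * I - (-(1 / 2))) ^ 2))) ∧
    ‖∫ t : ℝ, conj (logDeriv Z (c + t * I)) * ((x : ℂ) ^ (c + t * I) * (1 / (c + t * I - (-(1 / 2))) ^ 2))‖
      ≤ B * x ^ (2 * c - 5 / 4) * (Real.pi / (2 * c - 3 / 4)) := by
  obtain ⟨CL, hCL0, hCL⟩ := gp_growth hc hc1 D.diff D.growth D.nz D.low
  have hx0 : (x : ℂ) ≠ 0 := by exact_mod_cast (by linarith : x ≠ 0)
  set a : ℂ := ((2 * c + 1 / 2 : ℝ) : ℂ) with ha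
  set f : ℂ → ℂ := fun s => logDeriv Z s * ((x : ℂ) ^ ((2 * c : ℝ) - s) * (1 / (s - a) ^ 2)) with hf
  have hb0 : ∀ s : ℂ, s.re ≤ max c (5 / 4) → 1 / 4 ≤ ‖s - a‖ := by
    intro s hs
    rw [norm_sub_rev]
    refine le_trans ?_ (Complex.re_le_norm _)
    rw [ha, sub_re, ofReal_re]
    have : max c (5 / 4) = 5 / 4 := max_eq_right (by linarith)
    linarith
  have hd : DifferentiableOn ℂ f {s | 1 / 2 < s.re ∧ s.re ≤ max c (5 / 4)} := by
    refine (D.L_diff.mono fun s hs => hs.1).mul (DifferentiableOn.mul ?_ ?_)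
    · exact fun s _ => (DifferentiableAt.const_cpow (by fun_prop) (Or.inl hx0)).differentiableWithinAt
    · refine DifferentiableOn.div (by fun_prop) (by fun_prop) (fun s hs h => ?_)
      have h2 := pow_eq_zero_iff (two_ne_zero) |>.1 h
      have := hb0 s hs.2
      rw [h2, norm_zero] at this; linarith
  have hbd : ∃ C, ∀ s : ℂ, c ≤ s.re → s.re ≤ max c (5 / 4) → ‖f s‖ ≤ C * (1 + s.im ^ 2) ^ (-(3 / 4) : ℝ) := by
    refine ⟨CL * x ^ c * ((1 + ‖a‖) / (1 / 4) + 1) ^ 2, fun s h1 h2 => ?_⟩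
    refine gp_decay (by positivity) (by positivity) (hCL s h1).1 (gp_xpow hx ?_) (gp_kern (by norm_num) (hb0 s h2)) rfl
    rw [sub_re, ofReal_re]; linarith
  obtain ⟨C, hC⟩ := hbd
  have he : ∀ t : ℝ, conj (logDeriv Z (c + t * I)) * ((x : ℂ) ^ (c + t * I) * (1 / (c + t * I - (-(1 / 2))) ^ 2))
      = conj (f (c + t * I)) := by
    intro t
    simp only [hf, map_mul, map_div₀, map_pow, map_one]
    congr 2
    · have h := Complex.cpow_conj (x : ℂ) (((2 * c : ℝ) : ℂ) - (c + t * I))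
        (by rw [Complex.arg_ofReal_of_nonneg (by linarith)]; exact Real.pi_pos.ne)
      rw [conj_ofReal] at h
      rw [← h]
      congr 1
      simp only [map_sub, map_add, map_mul, conj_ofReal, conj_I]
      push_cast; ring
    · congr 1
      simp only [ha, map_sub, map_add, map_mul, conj_ofReal, conj_I]
      push_cast; ring
  simp_rw [he]
  have i1 : Integrable fun t : ℝ => f (c + t * I) := by
    refine gp_vert_integrable (C := C) hd.continuousOn (fun s hs => ?_) (fun t => ?_)
    · exact ⟨by rw [hs]; exact hc, by rw [hs]; exact le_max_left _ _⟩
    · simpa using hC (c + t * I) (by simp) (by simp)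
  refine ⟨(Complex.conjCLE.toContinuousLinearMap.integrable_comp i1 :), ?_⟩
  rw [integral_conj, RCLike.norm_conj]
  have hm : max c (5 / 4) = 5 / 4 := max_eq_right (by linarith)
  have hs := gp_strip (f := f) (C := C) (le_max_left c (5 / 4)) (hd.mono fun s hs => ⟨lt_of_lt_of_le hc hs.1, hs.2⟩) hC
  rw [hs, hm]
  obtain ⟨j1, j2⟩ := gp_int_cauchy (α := 2 * c - 3 / 4) (by linarith)
  rw [← j2, ← integral_const_mul]
  refine norm_integral_le_of_norm_le (j1.const_mul _) (Eventually.of_forall fun t => ?_)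
  simp only [hf]
  rw [norm_mul, norm_mul]
  have e1 : ‖(x : ℂ) ^ (((2 * c : ℝ) : ℂ) - (((5 / 4 : ℝ) : ℂ) + t * I))‖ = x ^ (2 * c - 5 / 4) := by
    rw [Complex.norm_cpow_eq_rpow_re_of_pos (by linarith)]; simp
  have e2 : ‖1 / (((5 / 4 : ℝ) : ℂ) + t * I - a) ^ 2‖ = ((2 * c - 3 / 4) ^ 2 + t ^ 2)⁻¹ := by
    rw [norm_div, norm_one, one_div]
    have : (((5 / 4 : ℝ) : ℂ) + t * I - a) ^ 2 = (((2 * c - 3 / 4 : ℝ) : ℂ) + ((-t : ℝ) : ℂ) * I) ^ 2 := by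
      rw [ha]; push_cast; ring
    rw [this, gp_kernel_norm, neg_sq]
  rw [e1, e2, ← mul_assoc]
  have h0 : 0 ≤ x ^ (2 * c - 5 / 4) := by positivity
  have h00 : 0 ≤ ((2 * c - 3 / 4) ^ 2 + t ^ 2)⁻¹ := by positivity
  gcongr
  exact hB t

lemma main_bound (D : GPD Z A κ) {x c B : ℝ} (hx : 1 ≤ x) (hc : 1 / 2 < c) (hc1 : c ≤ 1)
    (hB : ∀ t : ℝ, ‖logDeriv Z ((5 / 4 : ℝ) + t * I)‖ ≤ B) :
    ‖∫ t : ℝ, logDeriv Z ((2 : ℝ) + t * I) * ((x : ℂ) ^ ((2 : ℝ) + t * I) * (1 / ((2 : ℝ) + t * I - (-(1 / 2))) ^ 2))‖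
    ≤ x ^ c * (Real.pi / (c + 1 / 2)) * (2 * A + 2 * Real.log ((2 * c + 1 / 2 + κ) / 2 + 1) + 9 / 10
        + 2 * (logDeriv Z ((2 * c + 1 / 2 : ℝ) : ℂ)).re) + 4 * Real.pi * |A| * gpW x
      + B * x ^ (2 * c - 5 / 4) * (Real.pi / (2 * c - 3 / 4)) := by
  have hκ := D.kap
  have hxp : 0 < x := by linarith
  have hx0 : (x : ℂ) ≠ 0 := by exact_mod_cast hxp.ne'
  obtain ⟨CL, hCL0, hCL⟩ := gp_growth hc hc1 D.diff D.growth D.nz D.low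
  obtain ⟨CD, hCD⟩ := gp_digamma_growth (ε := 1 / 4) (by norm_num)
  obtain ⟨j1, j2⟩ := D.conj_bound hx hc hc1 hB
  have i1 := D.P_int hx hc hc1
  rw [← D.shift hx hc hc1]
  set k : ℝ → ℂ := fun t => (x : ℂ) ^ (c + t * I) * (1 / (c + t * I - (-(1 / 2))) ^ 2) with hk
  have hkval : ∫ t, k t = (2 * Real.pi * gpW x : ℂ) := by
    rw [← gp_perron (σ := c) (by linarith) hxp]
    simp only [hk, sub_neg_eq_add]
  have hknorm : ∀ t, ‖k t‖ = x ^ c * ((c + 1 / 2) ^ 2 + t ^ 2)⁻¹ := by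
    intro t
    simp only [hk]
    rw [norm_mul, norm_div, norm_one, one_div, Complex.norm_cpow_eq_rpow_re_of_pos hxp]
    have : ((c : ℂ) + t * I - (-(1 / 2))) ^ 2 = (((c + 1 / 2 : ℝ) : ℂ) + t * I) ^ 2 := by
      push_cast; ring
    rw [this, gp_kernel_norm]
    simp
  have hkint : Integrable k := by
    refine ((gp_int_cauchy (α := c + 1 / 2) (by linarith)).1.const_mul (x ^ c)).mono' ?_
      (Eventually.of_forall fun t => (hknorm t).le)
    refine Measurable.aestronglyMeasurable ?_
    rw [hk]; fun_prop
  set P : ℂ → ℂ := fun s => 2 * gpG A κ Z s + (digamma ((s + κ) / 2) + 2 * (2 / (s + κ)) + ((9 / 10 : ℝ) : ℂ)) with hP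
  set u : ℝ → ℂ := fun t => logDeriv Z (c + t * I) + conj (logDeriv Z (c + t * I)) + 2 * A with hu
  have hub : ∀ t, ‖u t‖ ≤ (P (c + t * I)).re := by
    intro t
    set s : ℂ := c + t * I with hs
    have hsr : s.re = c := by simp [hs]
    have hz : 1 / 4 ≤ ((s + κ) / 2).re := by simp [hsr]; linarith
    have hG := D.G_nonneg (s := s) (by rw [hsr]; exact hc)
    set z := (s + κ) / 2 with hz'
    have hz0 : 0 ≤ (1 / z).re := by
      rw [one_div, inv_re]; exact div_nonneg (by linarith) (normSq_nonneg _)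
    have hadd := Complex.digamma_apply_add_one z (by
      intro m hm
      rw [hm] at hz
      simp at hz
      have : (0 : ℝ) ≤ m := Nat.cast_nonneg m
      linarith)
    have hlow : -(9 / 20) ≤ (digamma (z + 1)).re := by
      have h1 := gp_digamma_re (z := z + 1) (by simp; linarith)
      have h2 := gpsi_mono (x := 5 / 4) (y := (z + 1).re) (by norm_num) (by simp; linarith)
      linarith [gp_psi_54]
    rw [hadd, add_re, ← one_div] at hlow
    have e2 : (2 : ℂ) / (s + κ) = 1 / z := by
      rw [hz', one_div_div]
    have eu : u t = ((2 * (gpG A κ Z s).re - (digamma z).re : ℝ) : ℂ) := by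
      simp only [hu, ← hs]
      rw [Complex.add_conj]
      rw [gpG, ← hz']
      simp only [add_re, ofReal_re, div_ofNat_re]
      push_cast; ring
    have eP : (P s).re = 2 * (gpG A κ Z s).re + ((digamma z).re + 2 * (1 / z).re + 9 / 10) := by
      simp only [hP]
      rw [e2, ← hz']
      simp only [add_re, ofReal_re]
      rw [show ((2 : ℂ) * gpG A κ Z s).re = 2 * (gpG A κ Z s).re by simp,
        show ((2 : ℂ) * (1 / z)).re = 2 * (1 / z).re by
          rw [mul_re]; simp]
    rw [eu, eP, norm_real, Real.norm_eq_abs, abs_le]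
    constructor <;> linarith
  have hPd : DifferentiableOn ℂ P {s | 1 / 2 < s.re} := by
    have hzd : DifferentiableOn ℂ (fun s : ℂ => digamma ((s + κ) / 2)) {s | 1 / 2 < s.re} := by
      refine DifferentiableOn.comp gp_digamma_diff (by fun_prop) (fun s hs => ?_)
      have hs' : 1 / 2 < s.re := hs
      simp; linarith
    have hL := D.L_diff
    have hi : DifferentiableOn ℂ (fun s : ℂ => (2 : ℂ) / (s + κ)) {s | 1 / 2 < s.re} := by
      refine DifferentiableOn.div (by fun_prop) (by fun_prop) (fun s hs h => ?_)
      have hs' : 1 / 2 < s.re := hs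
      have := congrArg re h
      simp at this; linarith
    have hG : DifferentiableOn ℂ (gpG A κ Z) {s | 1 / 2 < s.re} := by
      unfold gpG
      exact ((differentiableOn_const _).add (hzd.div_const 2)).add hL
    exact (hG.const_mul 2).add ((hzd.add (hi.const_mul 2)).add (differentiableOn_const _))
  have hPg : ∃ C, ∀ s : ℂ, c ≤ s.re → ‖P s‖ ≤ C * (1 + ‖s‖) ^ (1 / 2 : ℝ) := by
    have hCD0 : 0 ≤ CD := by
      have := (norm_nonneg _).trans (hCD 1 (by norm_num))
      by_contra h'
      have : CD * (1 + ‖(1 : ℂ)‖) ^ (1 / 2 : ℝ) < 0 := mul_neg_of_neg_of_pos (by linarith) (by positivity)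
      linarith
    refine ⟨2 * |A| + 2 * CL + 2 * (CD * (1 + κ) ^ (1 / 2 : ℝ)) + 9, fun s hs => ?_⟩
    set w := (1 + ‖s‖) ^ (1 / 2 : ℝ) with hw
    have hw1 : 1 ≤ w := Real.one_le_rpow (by linarith [norm_nonneg s]) (by norm_num)
    have b1 := (hCL s hs).1
    have b2 : ‖digamma ((s + κ) / 2)‖ ≤ CD * (1 + κ) ^ (1 / 2 : ℝ) * w := by
      refine (hCD _ (by simp; linarith)).trans ?_
      rw [mul_assoc, hw, ← Real.mul_rpow (by positivity) (by positivity)]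
      gcongr
      rw [norm_div]
      have : ‖s + (κ : ℂ)‖ ≤ ‖s‖ + κ := (norm_add_le _ _).trans (by simp [abs_of_nonneg hκ])
      have h2 : ‖(2 : ℂ)‖ = 2 := by simp
      rw [h2]
      nlinarith [norm_nonneg s, norm_nonneg (s + (κ : ℂ))]
    have b3 : ‖(2 : ℂ) / (s + κ)‖ ≤ 4 := by
      have : 1 / 2 ≤ ‖s + (κ : ℂ)‖ := le_trans (by simp; linarith) (Complex.re_le_norm _)
      rw [norm_div, div_le_iff₀ (by linarith)]
      simp; linarith
    have t1 : ‖P s‖ ≤ 2 * (|A| + ‖digamma ((s + κ) / 2)‖ / 2 + ‖logDeriv Z s‖) +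
        (‖digamma ((s + κ) / 2)‖ + 2 * ‖(2 : ℂ) / (s + κ)‖ + 9 / 10) := by
      simp only [hP]
      refine (norm_add_le _ _).trans (add_le_add ?_ ((norm_add_le _ _).trans (add_le_add ((norm_add_le _ _).trans ?_) ?_)))
      · rw [norm_mul, gpG]
        simp only [RCLike.norm_ofNat]
        refine mul_le_mul_of_nonneg_left ?_ (by norm_num)
        refine (norm_add_le _ _).trans (add_le_add ((norm_add_le _ _).trans ?_) le_rfl)
        rw [norm_real, norm_div]; simp
      · rw [norm_mul]; simp
      · rw [norm_real, Real.norm_eq_abs, abs_of_pos (by norm_num)]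
    have := abs_nonneg A
    nlinarith
  obtain ⟨CP, hCP⟩ := hPg
  obtain ⟨p1, p2⟩ := gp_poisson (f := P) (c₀ := 1 / 2) (α := c + 1 / 2) hc (by linarith) hPd hCP
  have hdec : ∀ t : ℝ, logDeriv Z (c + t * I) * k t = u t * k t - 2 * A * k t - conj (logDeriv Z (c + t * I)) * k t := by
    intro t; simp only [hu]; ring
  have i2 : Integrable fun t => 2 * A * k t := hkint.const_mul _
  have i3 : Integrable fun t => u t * k t := by
    refine ((i1.add i2).add j1).congr (Eventually.of_forall fun t => ?_)
    simp only [Pi.add_apply, hu, hk]; ring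
  have hI : ∫ t : ℝ, logDeriv Z (c + t * I) * k t = (∫ t, u t * k t) - 2 * A * (2 * Real.pi * gpW x)
      - ∫ t : ℝ, conj (logDeriv Z (c + t * I)) * k t := by
    simp_rw [hdec]
    have i4 : Integrable fun t => u t * k t - 2 * A * k t := i3.sub i2
    have j1' : Integrable (fun t : ℝ => conj (logDeriv Z (c + t * I)) * k t) := j1
    rw [integral_sub i4 j1', integral_sub i3 i2, integral_const_mul, hkval]
  have hpr : ∀ t : ℝ, (P (c + t * I)).re * ((c + 1 / 2) ^ 2 + t ^ 2)⁻¹ =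
      RCLike.re (P (c + t * I) / (((c + 1 / 2 : ℝ) : ℂ) ^ 2 + (t : ℂ) ^ 2)) := by
    intro t
    have : (((c + 1 / 2 : ℝ) : ℂ) ^ 2 + (t : ℂ) ^ 2) = (((c + 1 / 2) ^ 2 + t ^ 2 : ℝ) : ℂ) := by push_cast; ring
    rw [this]
    show _ = (P (c + t * I) / _).re
    rw [div_ofReal_re]
    exact (div_eq_mul_inv _ _).symm
  have hum : ‖∫ t, u t * k t‖ ≤ x ^ c * (Real.pi / (c + 1 / 2)) * (P ((2 * c + 1 / 2 : ℝ) : ℂ)).re := by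
    have hre : ∫ t : ℝ, (P (c + t * I)).re * ((c + 1 / 2) ^ 2 + t ^ 2)⁻¹ = Real.pi / (c + 1 / 2) * (P ((2 * c + 1 / 2 : ℝ) : ℂ)).re := by
      simp_rw [hpr]
      rw [integral_re p1, p2]
      have : (c : ℂ) + ((c + 1 / 2 : ℝ) : ℂ) = ((2 * c + 1 / 2 : ℝ) : ℂ) := by push_cast; ring
      rw [this, ← ofReal_div]
      exact re_ofReal_mul _ _
    have hin : Integrable fun t : ℝ => (P (c + t * I)).re * ((c + 1 / 2) ^ 2 + t ^ 2)⁻¹ := by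
      simp_rw [hpr]
      exact p1.re
    rw [mul_assoc, ← hre, ← integral_const_mul]
    refine norm_integral_le_of_norm_le (hin.const_mul _) (Eventually.of_forall fun t => ?_)
    rw [norm_mul, hknorm]
    have := hub t
    have h0 : 0 ≤ x ^ c * ((c + 1 / 2) ^ 2 + t ^ 2)⁻¹ := by positivity
    nlinarith
  have hPv : (P ((2 * c + 1 / 2 : ℝ) : ℂ)).re ≤ 2 * A + 2 * Real.log ((2 * c + 1 / 2 + κ) / 2 + 1) + 9 / 10
        + 2 * (logDeriv Z ((2 * c + 1 / 2 : ℝ) : ℂ)).re := by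
    set y : ℝ := (2 * c + 1 / 2 + κ) / 2 with hy
    have hy0 : 0 < y := by rw [hy]; linarith
    have e1 : (((2 * c + 1 / 2 : ℝ) : ℂ) + κ) / 2 = (y : ℂ) := by rw [hy]; push_cast; ring
    have e2 : (2 : ℂ) / (((2 * c + 1 / 2 : ℝ) : ℂ) + κ) = ((1 / y : ℝ) : ℂ) := by
      rw [← one_div_div, e1]; push_cast; ring
    simp only [hP, gpG]
    rw [e1, e2, gp_digamma_real hy0]
    have h1 := gpsi_rec hy0
    have h2 := gpsi_le (x := y + 1) (by linarith)
    have e3 : (2 * (↑A + ↑(gpsi y) / 2 + logDeriv Z ↑(2 * c + 1 / 2)) + (↑(gpsi y) + 2 * ((1 / y : ℝ) : ℂ) + ((9 / 10 : ℝ) : ℂ)) : ℂ)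
      = ((2 * A + 2 * gpsi y + 2 * (1 / y) + 9 / 10 : ℝ) : ℂ) + ((2 : ℝ) : ℂ) * logDeriv Z ↑(2 * c + 1 / 2) := by
      push_cast; ring
    rw [e3, add_re, ofReal_re, re_ofReal_mul]
    linarith
  rw [hI]
  have hW : 0 ≤ gpW x := by unfold gpW; positivity
  have n2 : ‖(2 * A * (2 * Real.pi * gpW x) : ℂ)‖ = 4 * Real.pi * |A| * gpW x := by
    rw [show (2 * A * (2 * Real.pi * gpW x) : ℂ) = ((4 * Real.pi * A * gpW x : ℝ) : ℂ) by push_cast; ring]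
    rw [norm_real, Real.norm_eq_abs, abs_mul, abs_mul, abs_of_nonneg hW, abs_of_pos (by positivity)]
  refine (norm_sub_le _ _).trans (add_le_add ((norm_sub_le _ _).trans (add_le_add ?_ n2.le)) j2)
  refine hum.trans (mul_le_mul_of_nonneg_left hPv (by positivity))

lemma final_bound (D : GPD Z A κ) {x B : ℝ} (hx : 1 ≤ x)
    (hB : ∀ t : ℝ, ‖logDeriv Z ((5 / 4 : ℝ) + t * I)‖ ≤ B) :
    ‖∫ t : ℝ, logDeriv Z ((2 : ℝ) + t * I) * ((x : ℂ) ^ ((2 : ℝ) + t * I) * (1 / ((2 : ℝ) + t * I - (-(1 / 2))) ^ 2))‖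
    ≤ 2 * Real.pi * (x ^ (1 / 2 : ℝ) * (A + Real.log ((3 / 2 + κ) / 2 + 1) + 9 / 20
        + (logDeriv Z ((3 / 2 : ℝ) : ℂ)).re) + 2 * |A| * gpW x + 2 * B * x ^ (-(1 / 4) : ℝ)) := by
  have hκ := D.kap
  set f : ℝ → ℝ := fun c => x ^ c * (Real.pi / (c + 1 / 2)) * (2 * A + 2 * Real.log ((2 * c + 1 / 2 + κ) / 2 + 1) + 9 / 10
        + 2 * (logDeriv Z ((2 * c + 1 / 2 : ℝ) : ℂ)).re) + 4 * Real.pi * |A| * gpW x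
      + B * x ^ (2 * c - 5 / 4) * (Real.pi / (2 * c - 3 / 4)) with hf
  have hval : f (1 / 2) = 2 * Real.pi * (x ^ (1 / 2 : ℝ) * (A + Real.log ((3 / 2 + κ) / 2 + 1) + 9 / 20
        + (logDeriv Z ((3 / 2 : ℝ) : ℂ)).re) + 2 * |A| * gpW x + 2 * B * x ^ (-(1 / 4) : ℝ)) := by
    simp only [hf]
    rw [show (2 * (1 / 2) + 1 / 2 : ℝ) = 3 / 2 by norm_num, show (2 * (1 / 2) - 5 / 4 : ℝ) = -(1 / 4) by norm_num,
      show (2 * (1 / 2) - 3 / 4 : ℝ) = 1 / 4 by norm_num, show (1 / 2 + 1 / 2 : ℝ) = 1 by norm_num]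
    ring
  have hcont : ContinuousAt f (1 / 2) := by
    have hx0 : x ≠ 0 := by linarith
    have c1 : ContinuousAt (fun c : ℝ => x ^ c) (1 / 2) := Real.continuousAt_const_rpow hx0
    have c2 : ContinuousAt (fun c : ℝ => x ^ (2 * c - 5 / 4)) (1 / 2) :=
      ContinuousAt.comp (f := fun c : ℝ => 2 * c - 5 / 4) (Real.continuousAt_const_rpow hx0) (by fun_prop)
    have c3 : ContinuousAt (fun c : ℝ => Real.log ((2 * c + 1 / 2 + κ) / 2 + 1)) (1 / 2) := by
      refine ContinuousAt.log (by fun_prop) ?_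
      linarith
    have c4 : ContinuousAt (fun c : ℝ => (logDeriv Z ((2 * c + 1 / 2 : ℝ) : ℂ)).re) (1 / 2) := by
      have ho : IsOpen {s : ℂ | 1 / 2 < s.re} := isOpen_lt continuous_const Complex.continuous_re
      have h1 : ContinuousAt (logDeriv Z) (((2 * (1 / 2) + 1 / 2 : ℝ) : ℝ) : ℂ) := by
        refine D.L_diff.continuousOn.continuousAt (ho.mem_nhds ?_)
        rw [mem_ofPred_eq, ofReal_re]; norm_num
      have h2 : ContinuousAt (fun c : ℝ => ((2 * c + 1 / 2 : ℝ) : ℂ)) (1 / 2) := by fun_prop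
      exact Complex.continuous_re.continuousAt.comp (ContinuousAt.comp (f := fun c : ℝ => ((2 * c + 1 / 2 : ℝ) : ℂ)) h1 h2)
    have c5 : ContinuousAt (fun c : ℝ => Real.pi / (c + 1 / 2)) (1 / 2) :=
      continuousAt_const.div (by fun_prop) (by norm_num)
    have c6 : ContinuousAt (fun c : ℝ => Real.pi / (2 * c - 3 / 4)) (1 / 2) :=
      continuousAt_const.div (by fun_prop) (by norm_num)
    exact (((c1.mul c5).mul (((continuousAt_const.add (c3.const_mul 2)).add continuousAt_const).add (c4.const_mul 2))).add
      continuousAt_const).add ((c2.const_mul B).mul c6)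
  rw [← hval]
  refine ge_of_tendsto (hcont.tendsto.mono_left (nhdsWithin_le_nhds (s := Ioi (1 / 2)))) ?_
  filter_upwards [Ioo_mem_nhdsGT (show (1 / 2 : ℝ) < 1 by norm_num)] with c hc
  exact D.main_bound hx hc.1 hc.2.le hB

end GPD

end

section
open Complex MeasureTheory Filter Topology Set
open scoped ComplexConjugate

lemma gp_ident {f g : ℂ → ℂ} {c d : ℝ} (hf : DifferentiableOn ℂ f {s | c < s.re}) (hg : DifferentiableOn ℂ g {s | c < s.re})
    (h : ∀ s : ℂ, d < s.re → f s = g s) {s : ℂ} (hs : c < s.re) : f s = g s := by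
  have ho : IsOpen {s : ℂ | c < s.re} := isOpen_lt continuous_const Complex.continuous_re
  have ho' : IsOpen {s : ℂ | d < s.re} := isOpen_lt continuous_const Complex.continuous_re
  have hp : IsPreconnected {s : ℂ | c < s.re} := (convex_halfSpace_re_gt c).isPreconnected
  have hz : (((max c d + 1 : ℝ)) : ℂ) ∈ {s : ℂ | c < s.re} := by
    rw [mem_ofPred_eq, ofReal_re]; linarith [le_max_left c d]
  refine (hf.analyticOnNhd ho).eqOn_of_preconnected_of_eventuallyEq (hg.analyticOnNhd ho) hp hz ?_ hs
  have : (((max c d + 1 : ℝ)) : ℂ) ∈ {s : ℂ | d < s.re} := by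
    rw [mem_ofPred_eq, ofReal_re]; linarith [le_max_right c d]
  filter_upwards [ho'.mem_nhds this] with w hw using h w hw

lemma gp_conj_ext {Z W : ℂ → ℂ} (hZ : Differentiable ℂ Z) (hW : Differentiable ℂ W)
    (h : ∀ s : ℂ, 1 < s.re → W s = conj (Z (conj s))) (s : ℂ) : W s = conj (Z (conj s)) := by
  have hd : Differentiable ℂ (fun s => conj (Z (conj s))) := fun s => by
    have := (hZ (conj s)).star_star
    simpa [Function.comp_def] using this
  refine gp_ident (c := s.re - 1) (d := 1) hW.differentiableOn hd.differentiableOn h (by linarith)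

noncomputable def gpJ (R : ℝ → ℂ) (s : ℂ) : ℂ := ∫ t in Ioi (1 : ℝ), R t * (t : ℂ) ^ (-(s + 1))

lemma gpJ_int {R : ℝ → ℂ} {B : ℝ} (hR : Measurable R) (hB : ∀ t, 1 ≤ t → ‖R t‖ ≤ B) {s : ℂ} (hs : 0 < s.re) :
    IntegrableOn (fun t : ℝ => R t * (t : ℂ) ^ (-(s + 1))) (Ioi 1) ∧ ‖gpJ R s‖ ≤ B / s.re := by
  have hi : IntegrableOn (fun t : ℝ => B * t ^ (-(s.re + 1))) (Ioi 1) :=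
    ((integrableOn_Ioi_rpow_iff (by norm_num)).2 (by linarith)).const_mul B
  have hb : ∀ t ∈ Ioi (1 : ℝ), ‖R t * (t : ℂ) ^ (-(s + 1))‖ ≤ B * t ^ (-(s.re + 1)) := by
    intro t ht
    have ht' : 1 < t := ht
    rw [norm_mul, Complex.norm_cpow_eq_rpow_re_of_pos (by linarith)]
    have : (-(s + 1)).re = -(s.re + 1) := by simp
    rw [this]
    exact mul_le_mul_of_nonneg_right (hB t ht'.le) (by positivity)
  refine ⟨hi.mono' (by fun_prop) (ae_restrict_of_forall_mem measurableSet_Ioi hb), ?_⟩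
  have h1 := norm_integral_le_of_norm_le hi (ae_restrict_of_forall_mem measurableSet_Ioi hb)
  rw [integral_const_mul, integral_Ioi_rpow_of_lt (by linarith) (by norm_num)] at h1
  refine h1.trans (le_of_eq ?_)
  simp
  field_simp

lemma gpJ_diff {R : ℝ → ℂ} {B : ℝ} (hR : Measurable R) (hB : ∀ t, 1 ≤ t → ‖R t‖ ≤ B) :
    DifferentiableOn ℂ (gpJ R) {s | 0 < s.re} := by
  set g : ℝ → ℂ := indicator (Ioi 1) R with hg
  have hB0 : 0 ≤ B := (norm_nonneg _).trans (hB 1 le_rfl)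
  have hgm : Measurable g := hR.indicator measurableSet_Ioi
  have hgb : ∀ t, ‖g t‖ ≤ B := by
    intro t
    by_cases h : t ∈ Ioi (1 : ℝ)
    · rw [hg, indicator_of_mem h]; exact hB t (le_of_lt h)
    · rw [hg, indicator_of_notMem h, norm_zero]; exact hB0
  have e : gpJ R = fun s => mellin g (-s) := by
    ext s
    unfold gpJ mellin
    have : ∀ t : ℝ, (t : ℂ) ^ (-s - 1) • g t = indicator (Ioi 1) (fun t : ℝ => R t * (t : ℂ) ^ (-(s + 1))) t := by
      intro t
      by_cases h : t ∈ Ioi (1 : ℝ)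
      · rw [hg, indicator_of_mem h, indicator_of_mem h, smul_eq_mul, mul_comm]; ring_nf
      · rw [hg, indicator_of_notMem h, indicator_of_notMem h, smul_zero]
    simp_rw [this]
    rw [setIntegral_indicator measurableSet_Ioi]
    congr 2
    ext t; simp; try (intro h; linarith)
  rw [e]
  intro s hs
  have hs' : 0 < s.re := hs
  refine DifferentiableAt.differentiableWithinAt ?_
  have hm : DifferentiableAt ℂ (mellin g) (-s) := by
    refine mellin_differentiableAt_of_isBigO_rpow (a := 0) (b := -s.re - 1) ?_ ?_ (by simpa using hs') ?_ (by simp)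
    · refine LocallyIntegrable.locallyIntegrableOn ?_ _
      refine (locallyIntegrable_const B).mono hgm.aestronglyMeasurable (Eventually.of_forall fun t => ?_)
      rw [Real.norm_eq_abs]; exact (hgb t).trans (le_abs_self B)
    · refine Asymptotics.IsBigO.of_bound B (Eventually.of_forall fun t => ?_)
      simpa using hgb t
    · refine Asymptotics.IsBigO.of_bound 1 ?_
      filter_upwards [Ioo_mem_nhdsGT (show (0 : ℝ) < 1 by norm_num)] with t ht
      have : g t = 0 := by rw [hg, indicator_of_notMem]; simp; exact ht.2.le
      rw [this]; simp
  exact DifferentiableAt.comp (g := mellin g) (f := fun s : ℂ => -s) s hm (differentiableAt_id.neg)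

lemma gp_Lgrowth {Z P Q : ℂ → ℂ} {R : ℝ → ℂ} {B : ℝ} (hZ : Differentiable ℂ Z) (hP : Differentiable ℂ P)
    (hQ : Differentiable ℂ Q) (hR : Measurable R) (hB : ∀ t, 1 ≤ t → ‖R t‖ ≤ B)
    (hPb : ∀ s, ‖P s‖ ≤ (1 + ‖s‖) ^ 2) (hQb : ∀ s, ‖Q s‖ ≤ (1 + ‖s‖) ^ 2)
    (h : ∀ s : ℂ, 1 < s.re → Z s = P s + Q s * gpJ R s) :
    ∃ C, ∀ s : ℂ, 1 / 4 ≤ s.re → ‖Z s‖ ≤ C * (1 + ‖s‖) ^ 2 := by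
  refine ⟨1 + 4 * B, fun s hs => ?_⟩
  have hB0 : 0 ≤ B := (norm_nonneg _).trans (hB 1 le_rfl)
  have e := gp_ident (g := fun s => P s + Q s * gpJ R s) (c := 0) (d := 1) hZ.differentiableOn
    (hP.differentiableOn.add (hQ.differentiableOn.mul (gpJ_diff hR hB))) h (s := s) (by linarith)
  rw [e]
  have hJ : ‖gpJ R s‖ ≤ 4 * B := by
    refine (gpJ_int hR hB (by linarith)).2.trans ?_
    rw [div_le_iff₀ (by linarith)]
    nlinarith
  refine (norm_add_le _ _).trans ?_
  rw [norm_mul, add_mul, one_mul, mul_comm (4 * B)]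
  exact add_le_add (hPb s) (mul_le_mul (hQb s) hJ (norm_nonneg _) (by positivity))

lemma gp_partial {N : ℕ} [NeZero N] {χ : DirichletCharacter ℂ N} (hχ : χ ≠ 1) (n : ℕ) :
    ‖∑ k ∈ Finset.range n, χ (k : ZMod N)‖ ≤ N := by
  have hN : ∑ k ∈ Finset.range N, χ (k : ZMod N) = 0 := by
    have h := χ.sum_eq_zero_of_ne_one hχ
    rw [← h]
    refine Finset.sum_bij' (fun k _ => (k : ZMod N)) (fun a _ => a.val) ?_ ?_ ?_ ?_ ?_
    · simp
    · intro a _; simpa using ZMod.val_lt a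
    · intro k hk; exact ZMod.val_cast_of_lt (by simpa using hk)
    · intro a _; simp
    · simp
  induction n using Nat.strong_induction_on with
  | _ n ih =>
    rcases lt_or_ge n N with h | h
    · refine (norm_sum_le _ _).trans ?_
      calc ∑ k ∈ Finset.range n, ‖χ (k : ZMod N)‖ ≤ ∑ k ∈ Finset.range n, (1 : ℝ) :=
            Finset.sum_le_sum fun k _ => DirichletCharacter.norm_le_one χ _
        _ ≤ N := by simp; exact h.le
    · obtain ⟨m, rfl⟩ := Nat.exists_eq_add_of_le h
      rw [Finset.sum_range_add, hN, zero_add]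
      have : ∀ k, χ ((N + k : ℕ) : ZMod N) = χ (k : ZMod N) := by intro k; simp
      simp_rw [this]
      exact ih m (by have := NeZero.pos N; omega)

lemma gp_chi_LSeries {N : ℕ} [NeZero N] {χ : DirichletCharacter ℂ N} (hχ : χ ≠ 1) : ∃ C, ∀ s : ℂ, 1 / 4 ≤ s.re →
    ‖DirichletCharacter.LFunction χ s‖ ≤ C * (1 + ‖s‖) ^ 2 := by
  set R : ℝ → ℂ := fun t => ∑ k ∈ Finset.Icc 1 ⌊t⌋₊, χ (k : ZMod N) with hR
  have hb : ∀ n : ℕ, ‖∑ k ∈ Finset.Icc 1 n, χ (k : ZMod N)‖ ≤ 2 * N := by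
    intro n
    have h1 := gp_partial hχ (n + 1)
    have h2 := gp_partial hχ 1
    have : ∑ k ∈ Finset.Icc 1 n, χ (k : ZMod N) = ∑ k ∈ Finset.range (n + 1), χ (k : ZMod N) - ∑ k ∈ Finset.range 1, χ (k : ZMod N) := by
      rw [← Finset.sum_Ico_eq_sub _ (by omega)]; rfl
    rw [this]
    refine (norm_sub_le _ _).trans (by linarith)
  refine gp_Lgrowth (Z := DirichletCharacter.LFunction χ) (P := fun _ => 0) (Q := fun s => s) (R := R) (B := 2 * N)
    (DirichletCharacter.differentiable_LFunction hχ) (by fun_prop) (by fun_prop)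
    ((measurable_from_nat (f := fun n : ℕ => ∑ k ∈ Finset.Icc 1 n, χ (k : ZMod N))).comp Nat.measurable_floor)
    (fun t _ => hb _) (fun s => by simp; positivity) (fun s => by nlinarith [norm_nonneg s]) (fun s hs => ?_)
  rw [DirichletCharacter.LFunction_eq_LSeries χ hs, zero_add]
  refine LSeries_eq_mul_integral _ le_rfl (by linarith) (DirichletCharacter.LSeriesSummable_of_one_lt_re χ hs) ?_
  refine Asymptotics.IsBigO.of_bound (2 * N) (Eventually.of_forall fun n => ?_)
  simpa using hb n

lemma gp_zeta_LSeries : ∃ C, ∀ s : ℂ, 1 / 4 ≤ s.re →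
    ‖DirichletCharacter.LFunctionTrivChar₁ 1 s‖ ≤ C * (1 + ‖s‖) ^ 2 := by
  set R : ℝ → ℂ := fun t => ((t - ⌊t⌋₊ : ℝ) : ℂ) with hR
  have hRm : Measurable R := by rw [hR]; fun_prop
  have hRb : ∀ t, 1 ≤ t → ‖R t‖ ≤ 1 := by
    intro t ht
    have h1 := Nat.floor_le (by linarith : 0 ≤ t)
    have h2 := Nat.lt_floor_add_one t
    rw [hR]; simp only [norm_real, Real.norm_eq_abs]
    rw [abs_le]; constructor <;> linarith
  refine gp_Lgrowth (Z := DirichletCharacter.LFunctionTrivChar₁ 1) (P := fun s => s) (Q := fun s => -(s * (s - 1))) (R := R) (B := 1)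
    (DirichletCharacter.differentiable_LFunctionTrivChar₁ 1) (by fun_prop) (by fun_prop) hRm hRb
    (fun s => by nlinarith [norm_nonneg s]) (fun s => ?_) (fun s hs => ?_)
  · rw [norm_neg, norm_mul]
    have : ‖s - 1‖ ≤ ‖s‖ + 1 := (norm_sub_le _ _).trans (by simp)
    nlinarith [norm_nonneg s, norm_nonneg (s - 1)]
  · have hs1 : s ≠ 1 := by rintro rfl; simp at hs
    rw [DirichletCharacter.LFunctionTrivChar₁, Function.update_of_ne hs1, DirichletCharacter.LFunctionTrivChar,
      DirichletCharacter.LFunction_modOne_eq, ← LSeries_one_eq_riemannZeta hs]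
    have h1 := LSeries_eq_mul_integral (1 : ℕ → ℂ) (r := 1) zero_le_one hs (LSeriesSummable_one_iff.2 hs) (by
      refine Asymptotics.IsBigO.of_bound 1 (Eventually.of_forall fun n => ?_)
      simp)
    rw [h1]
    obtain ⟨i1, -⟩ := gpJ_int hRm hRb (s := s) (by linarith)
    have i2 : IntegrableOn (fun t : ℝ => (t : ℂ) ^ (-s)) (Ioi 1) :=
      integrableOn_Ioi_cpow_of_lt (by simpa using hs) (by norm_num)
    have e : ∫ t in Ioi (1 : ℝ), (∑ k ∈ Finset.Icc 1 ⌊t⌋₊, (1 : ℕ → ℂ) k) * (t : ℂ) ^ (-(s + 1)) = 1 / (s - 1) - gpJ R s := by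
      have i3 := integral_Ioi_cpow_of_lt (a := -s) (by simpa using hs) (c := 1) (by norm_num)
      have : (1 : ℂ) / (s - 1) = ∫ t in Ioi (1 : ℝ), (t : ℂ) ^ (-s) := by
        rw [i3, ofReal_one, one_cpow, show (-s + 1 : ℂ) = -(s - 1) by ring, neg_div_neg_eq]
      rw [this, gpJ, ← integral_sub i2 i1]
      refine setIntegral_congr_fun measurableSet_Ioi fun t ht => ?_
      have ht' : 1 < t := ht
      have ht0 : (t : ℂ) ≠ 0 := by exact_mod_cast (by linarith : t ≠ 0)
      simp only [hR, Pi.one_apply, Finset.sum_const, Nat.card_Icc, Nat.add_sub_cancel, nsmul_eq_mul, mul_one]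
      rw [show (t : ℂ) ^ (-s) = t * (t : ℂ) ^ (-(s + 1)) by
        rw [show -s = 1 + -(s + 1) by ring, cpow_add _ _ ht0, cpow_one]]
      push_cast; ring
    rw [e]
    have : s - 1 ≠ 0 := sub_ne_zero.2 hs1
    field_simp
    ring

end

section
open Complex MeasureTheory Filter Topology Set
open scoped ComplexConjugate
lemma gp_X_norm {q κ : ℝ} (hq : 0 < q) (Z : ℂ → ℂ) (s : ℂ) : ‖gpX (1 / 2 * Real.log (q / Real.pi)) κ Z s‖ =
    Real.exp (1 / 2 * Real.log q * s.re) * Real.exp (1 / 2 * Real.log Real.pi * κ) * ‖Gammaℝ (s + κ) * Z s‖ := by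
  have hpi := Real.pi_pos
  unfold gpX
  rw [Gammaℝ_def, norm_mul, norm_mul, norm_mul, norm_mul, Complex.norm_exp, Complex.norm_cpow_eq_rpow_re_of_pos hpi,
    Real.rpow_def_of_pos hpi]
  have : Real.exp ((((1 / 2 * Real.log (q / Real.pi) : ℝ) : ℂ) * s).re) =
      Real.exp (1 / 2 * Real.log q * s.re) * Real.exp (1 / 2 * Real.log Real.pi * κ) *
      Real.exp (Real.log Real.pi * (-(s + κ) / 2).re) := by
    rw [← Real.exp_add, ← Real.exp_add, re_ofReal_mul, Real.log_div hq.ne' hpi.ne']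
    congr 1
    simp; ring
  rw [this]; ring

lemma gp_X_conj {A κ : ℝ} {Z W : ℂ → ℂ} (h : ∀ s, W s = conj (Z (conj s))) (s : ℂ) :
    ‖gpX A κ W s‖ = ‖gpX A κ Z (conj s)‖ := by
  have : gpX A κ Z (conj s) = conj (gpX A κ W s) := by
    unfold gpX
    rw [h s, map_mul, map_mul, conj_conj, ← exp_conj, ← Gamma_conj]
    congr 3
    · simp
    · rw [map_div₀, map_add, conj_ofReal, Complex.conj_ofNat]
  rw [this, RCLike.norm_conj]

lemma gp_low {a : ℕ → ℂ} (ha : ∀ n, ‖a n‖ ≤ 1) (ha1 : a 1 = 1) {s : ℂ} (hs : 2 ≤ s.re) :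
    ‖LSeries a s - 1‖ ≤ 2 / 3 := by
  have hz := hasSum_zeta_two
  have hb : ∀ n, ‖LSeries.term a s n‖ ≤ 1 / (n : ℝ) ^ 2 := by
    intro n
    rcases Nat.eq_zero_or_pos n with rfl | hn
    · simp
    · rw [LSeries.norm_term_eq, if_neg hn.ne']
      have hn1 : (1 : ℝ) ≤ n := by exact_mod_cast hn
      have : (n : ℝ) ^ 2 ≤ (n : ℝ) ^ s.re := by
        rw [← Real.rpow_natCast]
        exact Real.rpow_le_rpow_of_exponent_le hn1 (by simpa using hs)
      exact div_le_div₀ zero_le_one (ha n) (by positivity) this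
  have hsum : Summable (LSeries.term a s) := Summable.of_norm_bounded hz.summable hb
  have e1 : LSeries a s = 1 + ∑' n, ite (n = 1) 0 (LSeries.term a s n) := by
    unfold LSeries
    rw [hsum.tsum_eq_add_tsum_ite 1]
    simp [LSeries.term, ha1]
  have e2 := hz.summable.tsum_eq_add_tsum_ite 1
  rw [hz.tsum_eq] at e2
  rw [e1, add_sub_cancel_left]
  have hpi : Real.pi ^ 2 / 6 - 1 ≤ 2 / 3 := by
    nlinarith [Real.pi_lt_d2, Real.pi_pos]
  have hs2 : Summable fun n : ℕ => ite (n = 1) 0 (1 / (n : ℝ) ^ 2) := by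
    refine Summable.of_nonneg_of_le (fun n => ?_) (fun n => ?_) hz.summable
    · split_ifs <;> positivity
    · split_ifs
      · positivity
      · exact le_rfl
  have := tsum_of_norm_bounded hs2.hasSum (f := fun n => ite (n = 1) 0 (LSeries.term a s n)) (fun n => by
    split_ifs
    · simp
    · exact hb n)
  refine this.trans ?_
  simp only [Nat.cast_one, one_pow, div_one] at e2
  linarith

lemma gp_low' {a : ℕ → ℂ} (ha : ∀ n, ‖a n‖ ≤ 1) (ha1 : a 1 = 1) {s : ℂ} (hs : 2 ≤ s.re) :
    1 / 3 ≤ ‖LSeries a s‖ ∧ ‖LSeries a s‖ ≤ 2 := by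
  have h := gp_low ha ha1 hs
  have h1 : ‖(1 : ℂ)‖ ≤ ‖LSeries a s‖ + ‖LSeries a s - 1‖ := by
    have := norm_sub_le (LSeries a s) (LSeries a s - 1)
    simpa using this
  have h2 : ‖LSeries a s‖ ≤ ‖LSeries a s - 1‖ + ‖(1 : ℂ)‖ := by
    have := norm_add_le (LSeries a s - 1) 1
    simpa using this
  rw [norm_one] at h1 h2
  constructor <;> linarith

lemma gp_L_conj {N : ℕ} [NeZero N] {χ : DirichletCharacter ℂ N} (hχ : χ ≠ 1) (s : ℂ) :
    DirichletCharacter.LFunction χ⁻¹ s = conj (DirichletCharacter.LFunction χ (conj s)) := by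
  refine gp_conj_ext (DirichletCharacter.differentiable_LFunction hχ)
    (DirichletCharacter.differentiable_LFunction (inv_ne_one.2 hχ)) (fun s hs => ?_) s
  rw [DirichletCharacter.LFunction_eq_LSeries _ hs, DirichletCharacter.LFunction_eq_LSeries _ (by simpa using hs)]
  unfold LSeries
  rw [conj_tsum]
  refine tsum_congr fun n => ?_
  rcases Nat.eq_zero_or_pos n with rfl | hn
  · simp
  · rw [LSeries.term_of_ne_zero hn.ne', LSeries.term_of_ne_zero hn.ne', map_div₀, ← MulChar.star_apply']
    congr 1
    have h := Complex.cpow_conj (n : ℂ) (conj s) (by rw [natCast_arg]; exact Real.pi_pos.ne)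
    rw [conj_conj] at h
    rw [h]; simp

lemma gp_z_eq {s : ℂ} (hs : s ≠ 1) : DirichletCharacter.LFunctionTrivChar₁ 1 s = (s - 1) * riemannZeta s := by
  rw [DirichletCharacter.LFunctionTrivChar₁, Function.update_of_ne hs, DirichletCharacter.LFunctionTrivChar,
      DirichletCharacter.LFunction_modOne_eq]

lemma gp_z_conj (s : ℂ) : DirichletCharacter.LFunctionTrivChar₁ 1 s =
    conj (DirichletCharacter.LFunctionTrivChar₁ 1 (conj s)) := by
  refine gp_conj_ext (DirichletCharacter.differentiable_LFunctionTrivChar₁ 1)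
    (DirichletCharacter.differentiable_LFunctionTrivChar₁ 1) (fun s hs => ?_) s
  have h1 : s ≠ 1 := by rintro rfl; simp at hs
  have h2 : conj s ≠ 1 := by
    intro h; rw [← conj_conj s, h] at h1; simp at h1
  rw [gp_z_eq h1, gp_z_eq h2, ← LSeries_one_eq_riemannZeta hs, ← LSeries_one_eq_riemannZeta (by simpa using hs)]
  rw [map_mul, map_sub, conj_conj, map_one]
  congr 1
  unfold LSeries
  rw [conj_tsum]
  refine tsum_congr fun n => ?_
  rcases Nat.eq_zero_or_pos n with rfl | hn
  · simp
  · rw [LSeries.term_of_ne_zero hn.ne', LSeries.term_of_ne_zero hn.ne', map_div₀]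
    congr 1
    · simp
    have h := Complex.cpow_conj (n : ℂ) (conj s) (by rw [natCast_arg]; exact Real.pi_pos.ne)
    rw [conj_conj] at h
    rw [h]; simp

lemma gp_root {p : ℕ} [Fact p.Prime] {χ : DirichletCharacter ℂ p} (hχ : χ ≠ 1) : ‖DirichletCharacter.rootNumber χ‖ = 1 := by
  have h1 := gaussSum_mul_gaussSum_eq_card hχ (ψ := ZMod.stdAddChar) (ZMod.isPrimitive_stdAddChar p)
  rw [← star_gaussSum_eq, ZMod.card] at h1
  have h2 : ‖gaussSum χ (ZMod.stdAddChar (N := p))‖ ^ 2 = p := by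
    have := congrArg norm h1
    rw [norm_mul, norm_star] at this
    rw [sq, this]; simp
  have hp : (0 : ℝ) < p := by exact_mod_cast (Fact.out : p.Prime).pos
  unfold DirichletCharacter.rootNumber
  rw [norm_div, norm_div, norm_pow, norm_I, one_pow, div_one,
    Complex.norm_natCast_cpow_of_pos (Fact.out : p.Prime).pos]
  have : ((1 / 2 : ℂ)).re = 1 / 2 := by simp
  rw [this, ← Real.sqrt_eq_rpow, div_eq_one_iff_eq (by positivity), ← h2, Real.sqrt_sq (norm_nonneg _)]

lemma gp_primitive {p : ℕ} [Fact p.Prime] {χ : DirichletCharacter ℂ p} (hχ : χ ≠ 1) : χ.IsPrimitive := by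
  rcases (Nat.dvd_prime (Fact.out : p.Prime)).1 (DirichletCharacter.conductor_dvd_level χ) with h | h
  · exact absurd ((DirichletCharacter.eq_one_iff_conductor_eq_one).2 h) hχ
  · exact h

lemma gp_GPD_chi (hG : GRH) {p : ℕ} [Fact p.Prime] {χ : DirichletCharacter ℂ p} (hχ : χ ≠ 1) :
    ∃ κ : ℝ, κ ≤ 1 ∧ GPD (DirichletCharacter.LFunction χ) (1 / 2 * Real.log (p / Real.pi)) κ := by
  have hp := (Fact.out : p.Prime)
  have hp0 : (0 : ℝ) < p := by exact_mod_cast hp.pos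
  have hκ : ∃ κ : ℝ, 0 ≤ κ ∧ κ ≤ 1 ∧ (∀ s, DirichletCharacter.gammaFactor χ s = Gammaℝ (s + κ)) ∧
      (∀ s, DirichletCharacter.gammaFactor χ⁻¹ s = Gammaℝ (s + κ)) := by
    rcases χ.even_or_odd with h | h
    · have h' : χ⁻¹.Even := by
        unfold DirichletCharacter.Even at *
        rw [← MulChar.star_apply', h]; simp
      exact ⟨0, le_rfl, zero_le_one, fun s => by rw [h.gammaFactor_def]; simp, fun s => by rw [h'.gammaFactor_def]; simp⟩
    · have h' : χ⁻¹.Odd := by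
        unfold DirichletCharacter.Odd at *
        rw [← MulChar.star_apply', h]; simp
      exact ⟨1, zero_le_one, le_rfl, fun s => by rw [h.gammaFactor_def]; simp, fun s => by rw [h'.gammaFactor_def]; simp⟩
  obtain ⟨κ, hκ0, hκ1, hg1, hg2⟩ := hκ
  have ha : ∀ n : ℕ, ‖χ (n : ZMod p)‖ ≤ 1 := fun n => DirichletCharacter.norm_le_one χ _
  have hlow : ∀ s : ℂ, 2 ≤ s.re → 1 / 3 ≤ ‖DirichletCharacter.LFunction χ s‖ ∧ ‖DirichletCharacter.LFunction χ s‖ ≤ 2 := by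
    intro s hs
    rw [DirichletCharacter.LFunction_eq_LSeries χ (by linarith)]
    exact gp_low' ha (by simp) hs
  refine ⟨κ, hκ1, DirichletCharacter.differentiable_LFunction hχ, gp_chi_LSeries hχ, ?_, ?_, ?_, ?_, hκ0⟩
  · intro s hs h
    rcases lt_or_ge s.re 1 with h1 | h1
    · have := hG p ⟨hp.ne_zero⟩ χ s h (by linarith) h1
      linarith
    · exact DirichletCharacter.LFunction_ne_zero_of_one_le_re χ (Or.inl hχ) h1 h
  · exact ⟨1 / 3, by norm_num, fun s hs => (hlow s hs).1⟩
  · refine ⟨6, fun x h hx hh => ?_⟩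
    have h1 := (hlow x (by simpa using hx)).2
    have h2 := (hlow (x + h) (by simp; linarith)).1
    linarith
  · intro s h0 h1
    have e : 1 - conj s = conj (1 - s) := by simp
    rw [e, ← gp_X_conj (gp_L_conj hχ), gp_X_norm hp0, gp_X_norm hp0]
    have l1 : Gammaℝ (s + κ) * DirichletCharacter.LFunction χ s = DirichletCharacter.completedLFunction χ s := by
      rw [DirichletCharacter.LFunction_eq_completed_div_gammaFactor χ s (Or.inr hp.one_lt.ne'), hg1,
        mul_div_cancel₀ _ (Gammaℝ_ne_zero_of_re_pos (by simp; linarith))]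
    have l2 : Gammaℝ (1 - s + κ) * DirichletCharacter.LFunction χ⁻¹ (1 - s) = DirichletCharacter.completedLFunction χ⁻¹ (1 - s) := by
      rw [DirichletCharacter.LFunction_eq_completed_div_gammaFactor χ⁻¹ (1 - s) (Or.inr hp.one_lt.ne'), hg2,
        mul_div_cancel₀ _ (Gammaℝ_ne_zero_of_re_pos (by simp; linarith))]
    have fe := DirichletCharacter.IsPrimitive.completedLFunction_one_sub (gp_primitive hχ) (1 - s)
    rw [sub_sub_cancel] at fe
    rw [l1, l2, fe, norm_mul, norm_mul, gp_root hχ, Complex.norm_natCast_cpow_of_pos hp.pos, Real.rpow_def_of_pos hp0]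
    have : Real.exp (1 / 2 * Real.log p * (1 - s).re) = Real.exp (1 / 2 * Real.log p * s.re) * Real.exp (Real.log p * (1 - s - 1 / 2).re) := by
      rw [← Real.exp_add]; congr 1; simp; ring
    rw [this]; ring

lemma gp_GPD_zeta (hG : GRH) : GPD (DirichletCharacter.LFunctionTrivChar₁ 1) (1 / 2 * Real.log (1 / Real.pi)) 2 := by
  have hlow : ∀ s : ℂ, 2 ≤ s.re → 1 / 3 ≤ ‖riemannZeta s‖ ∧ ‖riemannZeta s‖ ≤ 2 := by
    intro s hs
    rw [← LSeries_one_eq_riemannZeta (by linarith)]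
    exact gp_low' (by simp) (by simp) hs
  have hne : ∀ s : ℂ, 2 ≤ s.re → s ≠ 1 := by rintro s hs rfl; norm_num at hs
  refine ⟨DirichletCharacter.differentiable_LFunctionTrivChar₁ 1, gp_zeta_LSeries, ?_, ?_, ?_, ?_, by norm_num⟩
  · intro s hs h
    by_cases hs1 : s = 1
    · rw [hs1] at h; exact DirichletCharacter.LFunctionTrivChar₁_apply_one_ne_zero 1 h
    rw [gp_z_eq hs1, mul_eq_zero, sub_eq_zero] at h
    rcases lt_or_ge s.re 1 with h1 | h1
    · have := hG 1 ⟨one_ne_zero⟩ 1 s (by rw [DirichletCharacter.LFunction_modOne_eq]; exact h.resolve_left hs1) (by linarith) h1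
      linarith
    · exact riemannZeta_ne_zero_of_one_le_re h1 (h.resolve_left hs1)
  · refine ⟨1 / 3, by norm_num, fun s hs => ?_⟩
    rw [gp_z_eq (hne s hs), norm_mul]
    have h1 : 1 ≤ ‖s - 1‖ := le_trans (by simp; linarith) (re_le_norm _)
    nlinarith [(hlow s hs).1]
  · refine ⟨6, fun x h hx hh => ?_⟩
    have hx' : 2 ≤ ((x : ℂ)).re := by simpa using hx
    have hxh' : 2 ≤ ((x : ℂ) + h).re := by simp; linarith
    have h1 := (hlow x hx').2
    have h2 := (hlow (x + h) hxh').1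
    rw [gp_z_eq (hne _ hx'), gp_z_eq (hne _ hxh'), norm_mul, norm_mul]
    have e1 : ‖(x : ℂ) - 1‖ = x - 1 := by
      rw [show (x : ℂ) - 1 = ((x - 1 : ℝ) : ℂ) by push_cast; ring, norm_real, Real.norm_eq_abs, abs_of_pos (by linarith)]
    have e2 : ‖(x : ℂ) + h - 1‖ = x + h - 1 := by
      rw [show (x : ℂ) + h - 1 = ((x + h - 1 : ℝ) : ℂ) by push_cast; ring, norm_real, Real.norm_eq_abs, abs_of_pos (by linarith)]
    rw [e1, e2]
    nlinarith
  · intro s h0 h1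
    have e : 1 - conj s = conj (1 - s) := by simp
    rw [e, ← gp_X_conj gp_z_conj, gp_X_norm one_pos, gp_X_norm one_pos]
    have key : ∀ w : ℂ, 0 < w.re → w.re < 1 → Gammaℝ (w + (2 : ℝ)) * DirichletCharacter.LFunctionTrivChar₁ 1 w =
        w * (w - 1) * completedRiemannZeta w / (2 * Real.pi) := by
      intro w hw hw1
      have w0 : w ≠ 0 := by rintro rfl; simp at hw
      have w1 : w ≠ 1 := by rintro rfl; simp at hw1
      have hg := Gammaℝ_ne_zero_of_re_pos hw
      rw [gp_z_eq w1, riemannZeta_def_of_ne_zero w0, ofReal_ofNat, Gammaℝ_add_two w0]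
      field_simp
    rw [key s h0 h1, key (1 - s) (by simp; linarith) (by simp; linarith), completedRiemannZeta_one_sub]
    simp only [Real.log_one, mul_zero, zero_mul, Real.exp_zero, one_mul]
    congr 2
    ring

end

section
open Complex MeasureTheory Filter Topology Set
open scoped ComplexConjugate

lemma gp_kint {x : ℝ} (hx : 0 < x) : Integrable fun t : ℝ => (x : ℂ) ^ (((2 : ℝ) : ℂ) + t * I) *
    (1 / (((2 : ℝ) : ℂ) + t * I - (-(1 / 2))) ^ 2) := by
  have hxc : (x : ℂ) ≠ 0 := by exact_mod_cast hx.ne'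
  refine (((gp_kernel_integrable (α := 5 / 2) (by norm_num)).norm).const_mul (x ^ (2 : ℝ))).mono' ?_
    (Eventually.of_forall fun t => ?_)
  · refine Continuous.aestronglyMeasurable ?_
    refine Continuous.mul ?_ (continuous_const.div (by fun_prop) (fun t h => ?_))
    · exact Continuous.const_cpow (by fun_prop) (Or.inl hxc)
    · have := congrArg Complex.re (pow_eq_zero_iff two_ne_zero |>.1 h)
      simp at this; norm_num at this
  · have e : (((2 : ℝ) : ℂ) + t * I - (-(1 / 2))) = ((5 / 2 : ℝ) : ℂ) + t * I := by push_cast; ring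
    rw [e, norm_mul, Complex.norm_cpow_eq_rpow_re_of_pos hx]
    simp

lemma gp_polint {x : ℝ} (hx : 0 < x) : Integrable fun t : ℝ => 1 / (((2 : ℝ) : ℂ) + t * I - 1) * ((x : ℂ) ^ (((2 : ℝ) : ℂ) + t * I) *
    (1 / (((2 : ℝ) : ℂ) + t * I - (-(1 / 2))) ^ 2)) := by
  refine (gp_kint hx).bdd_mul (c := 1) ?_ (Eventually.of_forall fun t => ?_)
  · refine Continuous.aestronglyMeasurable ?_
    refine continuous_const.div (by fun_prop) (fun t h => ?_)
    have := congrArg Complex.re h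
    simp at this; norm_num at this
  · rw [norm_div, norm_one]
    refine div_le_one_of_le₀ ?_ (norm_nonneg _)
    refine le_trans ?_ (Complex.re_le_norm _)
    simp; norm_num

lemma gpW_zero {y : ℝ} (h0 : 0 ≤ y) (h : y ≤ 1) : gpW y = 0 := by
  unfold gpW
  rw [max_eq_left (Real.log_nonpos h0 h), mul_zero]

lemma gp_sum {a : ℕ → ℂ} (ha : LSeriesSummable a 2) {x : ℝ} (hx : 0 < x) :
    ∫ t : ℝ, LSeries a (((2 : ℝ) : ℂ) + t * I) * ((x : ℂ) ^ (((2 : ℝ) : ℂ) + t * I) *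
      (1 / (((2 : ℝ) : ℂ) + t * I - (-(1 / 2))) ^ 2)) =
    2 * Real.pi * ∑ n ∈ Finset.range (⌊x⌋₊ + 1), a n * (gpW (x / n) : ℂ) := by
  have hnorm : ∀ (n : ℕ) (t : ℝ), ‖LSeries.term a (((2 : ℝ) : ℂ) + t * I) n‖ = ‖LSeries.term a 2 n‖ := by
    intro n t
    rw [LSeries.norm_term_eq, LSeries.norm_term_eq]
    simp
  set k : ℝ → ℂ := fun t => (x : ℂ) ^ (((2 : ℝ) : ℂ) + t * I) *
      (1 / (((2 : ℝ) : ℂ) + t * I - (-(1 / 2))) ^ 2) with hk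
  have hki : Integrable k := gp_kint hx
  have hIntg : ∀ n : ℕ, Integrable fun t : ℝ => LSeries.term a (((2 : ℝ) : ℂ) + t * I) n * k t := by
    intro n
    refine hki.bdd_mul (c := ‖LSeries.term a 2 n‖) ?_ (Eventually.of_forall fun t => (hnorm n t).le)
    refine Continuous.aestronglyMeasurable ?_
    rcases Nat.eq_zero_or_pos n with rfl | hn
    · simp only [LSeries.term_zero]; fun_prop
    · have hn0 : (n : ℂ) ≠ 0 := by exact_mod_cast hn.ne'
      simp only [LSeries.term_of_ne_zero hn.ne']
      refine continuous_const.div (Continuous.const_cpow (by fun_prop) (Or.inl hn0)) (fun t => ?_)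
      simp [Complex.cpow_eq_zero_iff, hn0]
  have hs : Summable fun n : ℕ => ∫ t : ℝ, ‖LSeries.term a (((2 : ℝ) : ℂ) + t * I) n * k t‖ := by
    simp only [norm_mul, hnorm, integral_const_mul]
    exact ha.norm.mul_right _
  have h := hasSum_integral_of_summable_integral_norm hIntg hs
  have hval : ∀ n : ℕ, ∫ t : ℝ, LSeries.term a (((2 : ℝ) : ℂ) + t * I) n * k t = 2 * Real.pi * (a n * (gpW (x / n) : ℂ)) := by
    intro n
    rcases Nat.eq_zero_or_pos n with rfl | hn
    · simp [gpW]
    · have hn0 : (0 : ℝ) < n := by exact_mod_cast hn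
      have hn1 : (n : ℂ) ≠ 0 := by exact_mod_cast hn.ne'
      have := gp_perron (σ := 2) (y := x / n) (by norm_num) (by positivity)
      have e : ∀ t : ℝ, LSeries.term a (((2 : ℝ) : ℂ) + t * I) n * k t =
          a n * (((x / n : ℝ) : ℂ) ^ (((2 : ℝ) : ℂ) + t * I) * (1 / (((2 : ℝ) : ℂ) + t * I + 1 / 2) ^ 2)) := by
        intro t
        rw [LSeries.term_of_ne_zero hn.ne', hk]
        simp only [sub_neg_eq_add]
        rw [ofReal_div, Complex.div_cpow_ofReal_nonneg hx.le hn0.le, ofReal_natCast]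
        ring
      simp only [e]
      rw [integral_const_mul, this]
      ring
  simp only [hval] at h
  have e2 : ∀ t : ℝ, LSeries a (((2 : ℝ) : ℂ) + t * I) * k t = ∑' n, LSeries.term a (((2 : ℝ) : ℂ) + t * I) n * k t := by
    intro t
    rw [tsum_mul_right]; rfl
  change ∫ t : ℝ, LSeries a (((2 : ℝ) : ℂ) + t * I) * k t = _
  simp only [e2]
  rw [← h.tsum_eq, Finset.mul_sum]
  refine tsum_eq_sum fun n hn => ?_
  rw [Finset.mem_range, not_lt] at hn
  have h1 : x < n := (Nat.floor_lt hx.le).1 (by omega)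
  have h0 : (0 : ℝ) < n := hx.trans h1
  rw [gpW_zero (by positivity) ((div_le_one h0).2 h1.le)]
  simp

/-- absolute value of the logarithmic derivative of zeta -/
noncomputable def gpV (σ : ℝ) : ℝ := ∑' n : ℕ, ‖LSeries.term (fun n => (ArithmeticFunction.vonMangoldt n : ℂ)) σ n‖

lemma gp_V_bound {a : ℕ → ℂ} (h : ∀ n, ‖a n‖ ≤ ArithmeticFunction.vonMangoldt n) {s : ℂ} (hs : 1 < s.re) :
    ‖LSeries a s‖ ≤ gpV s.re := by
  have hS := (ArithmeticFunction.LSeriesSummable_vonMangoldt (s := (s.re : ℂ)) (by simpa using hs)).norm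
  unfold gpV LSeries
  refine tsum_of_norm_bounded hS.hasSum fun n => ?_
  rw [LSeries.norm_term_eq, LSeries.norm_term_eq]
  split_ifs
  · rfl
  · simp only [ofReal_re]
    gcongr
    rw [norm_real, Real.norm_of_nonneg ArithmeticFunction.vonMangoldt_nonneg]
    exact h n

lemma gp_V_eq {σ : ℝ} : LSeries (fun n => (ArithmeticFunction.vonMangoldt n : ℂ)) σ = gpV σ := by
  unfold gpV LSeries
  rw [ofReal_tsum]
  refine tsum_congr fun n => ?_
  rcases Nat.eq_zero_or_pos n with rfl | hn
  · simp
  have hn0 : (0 : ℝ) < n := by exact_mod_cast hn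
  have : LSeries.term (fun n => (ArithmeticFunction.vonMangoldt n : ℂ)) σ n = ((ArithmeticFunction.vonMangoldt n / (n : ℝ) ^ σ : ℝ) : ℂ) := by
    rw [LSeries.term_of_ne_zero hn.ne']
    push_cast
    rw [ofReal_cpow hn0.le]; simp
  rw [this, norm_real, Real.norm_of_nonneg (div_nonneg ArithmeticFunction.vonMangoldt_nonneg (by positivity))]

lemma gp_Z1_logDeriv {s : ℂ} (hs : 1 < s.re) : logDeriv (DirichletCharacter.LFunctionTrivChar₁ 1) s =
    1 / (s - 1) - LSeries (fun n => (ArithmeticFunction.vonMangoldt n : ℂ)) s := by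
  have h1 : s ≠ 1 := by rintro rfl; simp at hs
  rw [ArithmeticFunction.LSeries_vonMangoldt_eq_deriv_riemannZeta_div hs]
  have he : DirichletCharacter.LFunctionTrivChar₁ 1 =ᶠ[𝓝 s] fun s => (s - 1) * riemannZeta s := by
    filter_upwards [isOpen_ne.mem_nhds h1] with z hz using gp_z_eq hz
  have hz := riemannZeta_ne_zero_of_one_le_re hs.le
  rw [logDeriv_apply, he.deriv_eq, gp_z_eq h1, ← logDeriv_apply (fun s => (s - 1) * riemannZeta s),
    logDeriv_mul (f := fun s : ℂ => s - 1) (g := riemannZeta) s (sub_ne_zero.2 h1) hz (by fun_prop) (differentiableAt_riemannZeta h1),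
    logDeriv_apply, logDeriv_apply]
  have : deriv (fun s : ℂ => s - 1) s = 1 := by simp
  rw [this]; ring

lemma gp_V_le (hG : GRH) {σ : ℝ} (hσ : 1 < σ) :
    gpV σ ≤ 1 / (σ - 1) - 1 / 2 * Real.log Real.pi + 1 / 2 * Real.log ((σ + 2) / 2) := by
  have h := (gp_GPD_zeta hG).G_nonneg (s := σ) (by simp; linarith)
  unfold gpG at h
  rw [gp_Z1_logDeriv (by simpa using hσ), gp_V_eq] at h
  have e1 : ((σ : ℂ) + (2 : ℝ)) / 2 = (((σ + 2) / 2 : ℝ) : ℂ) := by push_cast; ring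
  rw [e1, gp_digamma_real (by linarith)] at h
  have e2 : (((1 / 2 * Real.log (1 / Real.pi) : ℝ) : ℂ) + ((gpsi ((σ + 2) / 2) : ℝ) : ℂ) / 2 + (1 / ((σ : ℂ) - 1) - (gpV σ : ℂ)))
      = ((1 / 2 * Real.log (1 / Real.pi) + gpsi ((σ + 2) / 2) / 2 + (1 / (σ - 1) - gpV σ) : ℝ) : ℂ) := by push_cast; ring
  rw [e2, ofReal_re, one_div Real.pi, Real.log_inv] at h
  have := gpsi_le (x := (σ + 2) / 2) (by linarith)
  linarith

lemma gp_chi_logDeriv {N : ℕ} [NeZero N] (χ : DirichletCharacter ℂ N) {s : ℂ} (hs : 1 < s.re) :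
    logDeriv (DirichletCharacter.LFunction χ) s =
    - LSeries (fun n => χ n * (ArithmeticFunction.vonMangoldt n : ℂ)) s := by
  have := DirichletCharacter.LSeries_twist_vonMangoldt_eq χ hs
  rw [logDeriv_apply, DirichletCharacter.deriv_LFunction_eq_deriv_LSeries _ hs, DirichletCharacter.LFunction_eq_LSeries _ hs]
  have e : (fun n : ℕ => χ n * (ArithmeticFunction.vonMangoldt n : ℂ)) = (fun n : ℕ => χ n) * (fun n : ℕ => (ArithmeticFunction.vonMangoldt n : ℂ)) := rfl
  rw [e, this]; ring

lemma gp_chi_le {N : ℕ} (χ : DirichletCharacter ℂ N) (n : ℕ) :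
    ‖χ n * (ArithmeticFunction.vonMangoldt n : ℂ)‖ ≤ ArithmeticFunction.vonMangoldt n := by
  rw [norm_mul, norm_real, Real.norm_of_nonneg ArithmeticFunction.vonMangoldt_nonneg]
  exact mul_le_of_le_one_left ArithmeticFunction.vonMangoldt_nonneg (DirichletCharacter.norm_le_one χ _)

lemma gp_S_chi (hG : GRH) {p : ℕ} [Fact p.Prime] {χ : DirichletCharacter ℂ p} (hχ : χ ≠ 1) {x : ℝ} (hx : 1 ≤ x) :
    ‖∑ n ∈ Finset.range (⌊x⌋₊ + 1), χ n * (ArithmeticFunction.vonMangoldt n : ℂ) * (gpW (x / n) : ℂ)‖ ≤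
    x ^ (1 / 2 : ℝ) * (1 / 2 * Real.log (p / Real.pi) + Real.log (9 / 4) + 9 / 20 + gpV (3 / 2))
      + |Real.log (p / Real.pi)| * gpW x + 2 * gpV (5 / 4) * x ^ (-(1 / 4) : ℝ) := by
  obtain ⟨κ, hκ1, D⟩ := gp_GPD_chi hG hχ
  have hκ := D.kap
  have h := D.final_bound hx (B := gpV (5 / 4)) (fun t => by
    have hs : (((5 / 4 : ℝ) : ℂ) + t * I).re = 5 / 4 := by simp
    have := gp_V_bound (gp_chi_le χ) (s := ((5 / 4 : ℝ) : ℂ) + t * I) (by rw [hs]; norm_num)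
    rw [gp_chi_logDeriv χ (by rw [hs]; norm_num), norm_neg]
    rwa [hs] at this)
  have h2 : ∀ t : ℝ, logDeriv (DirichletCharacter.LFunction χ) (((2 : ℝ) : ℂ) + t * I) =
      - LSeries (fun n => χ n * (ArithmeticFunction.vonMangoldt n : ℂ)) (((2 : ℝ) : ℂ) + t * I) :=
    fun t => gp_chi_logDeriv χ (by simp)
  simp only [h2, neg_mul] at h
  rw [integral_neg, norm_neg, gp_sum (a := fun n => χ n * (ArithmeticFunction.vonMangoldt n : ℂ)) (DirichletCharacter.LSeriesSummable_twist_vonMangoldt χ (by simp)) (by linarith)] at h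
  have hpi := Real.pi_pos
  rw [norm_mul, norm_mul, Complex.norm_ofNat, norm_real, Real.norm_of_nonneg hpi.le] at h
  have h := le_of_mul_le_mul_left h (by positivity)
  refine h.trans ?_
  have e1 : 2 * |1 / 2 * Real.log (p / Real.pi)| = |Real.log (p / Real.pi)| := by
    rw [abs_mul, abs_of_pos (by norm_num)]; ring
  rw [e1]
  have e2 : Real.log ((3 / 2 + κ) / 2 + 1) ≤ Real.log (9 / 4) := Real.log_le_log (by linarith) (by linarith)
  have e3 : (logDeriv (DirichletCharacter.LFunction χ) ((3 / 2 : ℝ) : ℂ)).re ≤ gpV (3 / 2) := by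
    refine (re_le_norm _).trans ?_
    rw [gp_chi_logDeriv χ (by rw [ofReal_re]; norm_num), norm_neg]
    have := gp_V_bound (gp_chi_le χ) (s := ((3 / 2 : ℝ) : ℂ)) (by rw [ofReal_re]; norm_num)
    rwa [ofReal_re] at this
  have hx0 : 0 ≤ x := by linarith
  gcongr

lemma gp_S_zeta (hG : GRH) {x : ℝ} (hx : 1 < x) :
    4 / 9 * x - 4 / 9 * x ^ (-(1 / 2) : ℝ) - 2 / 3 * gpW x -
    (x ^ (1 / 2 : ℝ) * (- 1 / 2 * Real.log Real.pi + Real.log (11 / 4) + 9 / 20 + (2 - gpV (3 / 2)))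
      + Real.log Real.pi * gpW x + 2 * (4 + gpV (5 / 4)) * x ^ (-(1 / 4) : ℝ)) ≤
    ∑ n ∈ Finset.range (⌊x⌋₊ + 1), ArithmeticFunction.vonMangoldt n * gpW (x / n) := by
  have D := gp_GPD_zeta hG
  have hpi := Real.pi_pos
  have hx0 : 0 < x := by linarith
  have h := D.final_bound hx.le (B := 4 + gpV (5 / 4)) (fun t => by
    have hs : (((5 / 4 : ℝ) : ℂ) + t * I).re = 5 / 4 := by simp
    have := gp_V_bound (a := fun n => (ArithmeticFunction.vonMangoldt n : ℂ)) (fun n => by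
      rw [norm_real, Real.norm_of_nonneg ArithmeticFunction.vonMangoldt_nonneg])
      (s := ((5 / 4 : ℝ) : ℂ) + t * I) (by rw [hs]; norm_num)
    rw [hs] at this
    rw [gp_Z1_logDeriv (by rw [hs]; norm_num)]
    refine (norm_sub_le _ _).trans (add_le_add ?_ this)
    rw [norm_div, norm_one, div_le_iff₀']
    · have := re_le_norm (((5 / 4 : ℝ) : ℂ) + t * I - 1)
      rw [sub_re, hs, one_re] at this
      linarith
    · have := re_le_norm (((5 / 4 : ℝ) : ℂ) + t * I - 1)
      rw [sub_re, hs, one_re] at this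
      linarith)
  have hPi : Integrable fun t : ℝ => logDeriv (DirichletCharacter.LFunctionTrivChar₁ 1) (((2 : ℝ) : ℂ) + t * I) *
      ((x : ℂ) ^ (((2 : ℝ) : ℂ) + t * I) * (1 / (((2 : ℝ) : ℂ) + t * I - (-(1 / 2))) ^ 2)) := by
    obtain ⟨C, hC⟩ := D.P_bound hx.le (by norm_num : (1 / 2 : ℝ) < 1) le_rfl
    refine gp_vert_integrable (f := fun s => logDeriv (DirichletCharacter.LFunctionTrivChar₁ 1) s * ((x : ℂ) ^ s * (1 / (s - (-(1 / 2))) ^ 2))) (C := C)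
      (D.P_diff hx.le).continuousOn (fun s hs => ?_) (fun t => ?_)
    · simp [hs]; norm_num
    · simpa using hC (((2 : ℝ) : ℂ) + t * I) (by simp) (by simp)
  have hpol := gp_polint hx0
  have hpv := gp_perron_pole hx
  have hsum := gp_sum (a := fun n => (ArithmeticFunction.vonMangoldt n : ℂ)) (ArithmeticFunction.LSeriesSummable_vonMangoldt (s := 2) (by simp)) hx0
  have h2 : ∀ t : ℝ, LSeries (fun n => (ArithmeticFunction.vonMangoldt n : ℂ)) (((2 : ℝ) : ℂ) + t * I) = 1 / (((2 : ℝ) : ℂ) + t * I - 1) -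
      logDeriv (DirichletCharacter.LFunctionTrivChar₁ 1) (((2 : ℝ) : ℂ) + t * I) := by
    intro t
    rw [gp_Z1_logDeriv (by simp)]; ring
  simp only [h2, sub_mul] at hsum
  rw [integral_sub hpol hPi] at hsum
  have hpv' : ∫ t : ℝ, 1 / (((2 : ℝ) : ℂ) + t * I - 1) * ((x : ℂ) ^ (((2 : ℝ) : ℂ) + t * I) *
    (1 / (((2 : ℝ) : ℂ) + t * I - (-(1 / 2))) ^ 2)) = 2 * Real.pi * ((4 / 9 * x - 4 / 9 * x ^ (-(1 / 2) : ℝ) - 2 / 3 * gpW x : ℝ) : ℂ) := by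
    rw [← hpv]
    refine integral_congr_ae (Eventually.of_forall fun t => ?_)
    simp only [sub_neg_eq_add]; ring
  rw [hpv'] at hsum
  set J := ∫ t : ℝ, logDeriv (DirichletCharacter.LFunctionTrivChar₁ 1) (((2 : ℝ) : ℂ) + t * I) *
      ((x : ℂ) ^ (((2 : ℝ) : ℂ) + t * I) * (1 / (((2 : ℝ) : ℂ) + t * I - (-(1 / 2))) ^ 2)) with hJ
  set S := ∑ n ∈ Finset.range (⌊x⌋₊ + 1), ArithmeticFunction.vonMangoldt n * gpW (x / n) with hS
  set P := 4 / 9 * x - 4 / 9 * x ^ (-(1 / 2) : ℝ) - 2 / 3 * gpW x with hP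
  have hsum' : J = ((2 * Real.pi * (P - S) : ℝ) : ℂ) := by
    have : ∑ n ∈ Finset.range (⌊x⌋₊ + 1), (ArithmeticFunction.vonMangoldt n : ℂ) * (gpW (x / n) : ℂ) = (S : ℂ) := by
      rw [hS]; push_cast; rfl
    rw [this] at hsum
    push_cast
    linear_combination -hsum
  rw [hsum', norm_real, Real.norm_eq_abs] at h
  have h := (le_abs_self _).trans h
  have h := le_of_mul_le_mul_left h (by positivity)
  have e0 : Real.log (1 / Real.pi) = - Real.log Real.pi := by rw [one_div, Real.log_inv]
  have hlp : 0 ≤ Real.log Real.pi := Real.log_nonneg (by linarith [Real.pi_gt_three])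
  have e1 : 2 * |1 / 2 * Real.log (1 / Real.pi)| = Real.log Real.pi := by
    rw [e0, abs_mul, abs_neg, abs_of_nonneg hlp, abs_of_pos (by norm_num)]; ring
  have e2 : (3 / 2 + (2:ℝ)) / 2 + 1 = 11 / 4 := by norm_num
  have e3 : (logDeriv (DirichletCharacter.LFunctionTrivChar₁ 1) ((3 / 2 : ℝ) : ℂ)).re = 2 - gpV (3 / 2) := by
    rw [gp_Z1_logDeriv (by rw [ofReal_re]; norm_num), gp_V_eq, sub_re, ofReal_re]
    congr 1
    rw [show (1 : ℂ) / (((3 / 2 : ℝ) : ℂ) - 1) = ((2 : ℝ) : ℂ) by push_cast; norm_num, ofReal_re]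
  rw [e1, e2, e3, e0] at h
  have e4 : 1 / 2 * -Real.log Real.pi = -1 / 2 * Real.log Real.pi := by ring
  rw [e4] at h
  linarith

end

section
open Complex MeasureTheory Filter Topology Set
open scoped ComplexConjugate

lemma gp_num {K L s l V V' P a b r : ℝ} (hK : 1 ≤ K) (hL : 207 / 10 ≤ L) (hs : s = 8 / 5 * K * L)
    (hl0 : 0 ≤ l) (hl : l ≤ 2114 / 10000 * s) (hV : V ≤ 171 / 100) (hV0' : 0 ≤ V') (hV' : V' ≤ 37 / 10)
    (hP : 114 / 100 ≤ P) (hP' : P ≤ 12 / 10) (ha : a ≤ 13 / 16) (hb : b ≤ 1012 / 1000)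
    (hr0 : 0 ≤ r) (hr : r ≤ 4 / 23) :
    K * (s * (1 / 2 * (L - P) + a + 9 / 20 + V) + (L - P) * (l / s) + 2 * V' * r) + 3 / 4 * l <
    4 / 9 * s ^ 2 - 4 / 9 * (1 / s) - 2 / 3 * (l / s) - (s * (-1 / 2 * P + b + 9 / 20 + (2 - V)) + P * (l / s) + 2 * (4 + V') * r) := by
  have hKL : 207 / 10 * K ≤ K * L := by nlinarith
  have hs1 : 3312 / 100 ≤ s := by nlinarith
  have hs0 : 0 < s := by linarith
  set ρ := l / s with hρ
  have hρ0 : 0 ≤ ρ := by positivity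
  have hρ1 : ρ ≤ 2114 / 10000 := by rw [hρ, div_le_iff₀ hs0]; exact hl
  have t1 : K * ((L - P) * ρ) ≤ 1322 / 10000 * s := by
    have : K * ((L - P) * ρ) ≤ K * (L * (2114 / 10000)) := by
      gcongr
      · linarith
    nlinarith
  have hVr : V' * r ≤ 37 / 10 * (4 / 23) := by gcongr
  have t2 : K * (2 * V' * r) ≤ 389 / 10000 * (K * s) := by
    have : K * (2 * V' * r) ≤ K * (2 * (37 / 10 * (4 / 23))) := by
      gcongr K * ?_
      linarith
    have : K * (3312 / 100) ≤ K * s := by gcongr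
    linarith
  have t3 : 1 / s ≤ 1 / (3312 / 100) := by gcongr
  have t4 : P * ρ ≤ 12 / 10 * (2114 / 10000) := by gcongr
  have t5 : 2 * (4 + V') * r ≤ 2 * (4 + 37 / 10) * (4 / 23) := by gcongr
  have key : K * (1 / 2 * (L - P) + a + 9 / 20 + V + 389 / 10000) + 3842 / 10000 + (-1 / 2 * P + b + 9 / 20 + (2 - V))
      < 4 / 9 * (8 / 5 * K * L) := by
    have h1 : K * (-1 / 2 * P + a + 9 / 20 + 389 / 10000 + V) ≤ K * (7314 / 10000 + V) := by
      gcongr K * ?_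
      linarith
    have h2 : (K - 1) * (36 / 10 - V) ≥ 0 := mul_nonneg (by linarith) (by linarith)
    nlinarith
  have key2 := mul_lt_mul_of_pos_left key hs0
  have e : s * (4 / 9 * (8 / 5 * K * L)) = 4 / 9 * s ^ 2 := by rw [hs]; ring
  rw [e] at key2
  nlinarith

lemma gp_log_le {y c : ℝ} (n : ℕ) (hn : n ≠ 0) (hy : 0 < y) (m : ℕ) (hc : c = m / n) (h : y ^ n ≤ (2.7182818283 : ℝ) ^ m) :
    Real.log y ≤ c := by
  have h1 : Real.log (y ^ n) ≤ m := by
    rw [Real.log_le_iff_le_exp (by positivity)]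
    refine h.trans ?_
    have := Real.exp_nat_mul 1 m
    rw [mul_one] at this
    rw [this]
    gcongr
    exact Real.exp_one_gt_d9.le
  rw [Real.log_pow] at h1
  have hn' : (0 : ℝ) < n := by exact_mod_cast Nat.pos_of_ne_zero hn
  rw [hc, le_div_iff₀ hn']
  linarith

lemma gp_log_ge {y c : ℝ} (n : ℕ) (hn : n ≠ 0) (hy : 0 < y) (m : ℕ) (hc : c = m / n) (h : (2.7182818286 : ℝ) ^ m ≤ y ^ n) :
    c ≤ Real.log y := by
  have h1 : m ≤ Real.log (y ^ n) := by
    rw [Real.le_log_iff_exp_le (by positivity)]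
    refine le_trans ?_ h
    have := Real.exp_nat_mul 1 m
    rw [mul_one] at this
    rw [this]
    gcongr
    exact Real.exp_one_lt_d9.le
  rw [Real.log_pow] at h1
  have hn' : (0 : ℝ) < n := by exact_mod_cast Nat.pos_of_ne_zero hn
  rw [hc, div_le_iff₀ hn']
  linarith

/-- the bound for character sums -/
noncomputable def gpM (p : ℕ) (x : ℝ) : ℝ :=
    x ^ (1 / 2 : ℝ) * (1 / 2 * Real.log (p / Real.pi) + Real.log (9 / 4) + 9 / 20 + gpV (3 / 2))
      + |Real.log (p / Real.pi)| * gpW x + 2 * gpV (5 / 4) * x ^ (-(1 / 4) : ℝ)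

lemma gp_V_nonneg (σ : ℝ) : 0 ≤ gpV σ := tsum_nonneg fun _ => norm_nonneg _

lemma gp_main_num (hG : GRH) {p : ℕ} (hp : 10 ^ 9 ≤ p) {K x : ℝ} (hK : 1 ≤ K) (hx : x = (8 / 5 * K * Real.log p) ^ 2) :
    0 ≤ gpM p x ∧ 1 < x ∧ K * gpM p x + 3 / 4 * Real.log x <
      ∑ n ∈ Finset.range (⌊x⌋₊ + 1), ArithmeticFunction.vonMangoldt n * gpW (x / n) := by
  have hpR : (10 : ℝ) ^ 9 ≤ p := by exact_mod_cast hp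
  have hp0 : (0 : ℝ) < p := by linarith
  have hL : 207 / 10 ≤ Real.log p := by
    refine le_trans ?_ (Real.log_le_log (by norm_num) hpR)
    exact gp_log_ge 10 (by norm_num) (by norm_num) 207 (by norm_num) (by norm_num)
  have hP : 114 / 100 ≤ Real.log Real.pi := by
    refine le_trans ?_ (Real.log_le_log (by norm_num) Real.pi_gt_d2.le)
    exact gp_log_ge 50 (by norm_num) (by norm_num) 57 (by norm_num) (by norm_num)
  have hP' : Real.log Real.pi ≤ 12 / 10 := by
    refine le_trans (Real.log_le_log Real.pi_pos Real.pi_lt_d2.le) ?_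
    exact gp_log_le 10 (by norm_num) (by norm_num) 12 (by norm_num) (by norm_num)
  have ha : Real.log (9 / 4) ≤ 13 / 16 := gp_log_le 16 (by norm_num) (by norm_num) 13 (by norm_num) (by norm_num)
  have hb : Real.log (11 / 4) ≤ 1012 / 1000 := gp_log_le 250 (by norm_num) (by norm_num) 253 (by norm_num) (by norm_num)
  have hc : Real.log (7 / 4) ≤ 56 / 100 := gp_log_le 25 (by norm_num) (by norm_num) 14 (by norm_num) (by norm_num)
  have hd : Real.log (13 / 8) ≤ 1 / 2 := gp_log_le 2 (by norm_num) (by norm_num) 1 (by norm_num) (by norm_num)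
  have ha0 : 0 ≤ Real.log (9 / 4) := Real.log_nonneg (by norm_num)
  have hV := gp_V_le hG (σ := 3 / 2) (by norm_num)
  have hV' := gp_V_le hG (σ := 5 / 4) (by norm_num)
  rw [show ((3 / 2 : ℝ) + 2) / 2 = 7 / 4 by norm_num] at hV
  rw [show ((5 / 4 : ℝ) + 2) / 2 = 13 / 8 by norm_num] at hV'
  norm_num at hV hV'
  have hV1 : gpV (3 / 2) ≤ 171 / 100 := by linarith
  have hV1' : gpV (5 / 4) ≤ 37 / 10 := by linarith
  have hV0 := gp_V_nonneg (5 / 4)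
  have hV00 := gp_V_nonneg (3 / 2)
  set L := Real.log p with hLd
  set s := 8 / 5 * K * L with hs
  have hs1 : 3312 / 100 ≤ s := by nlinarith
  have hs0 : 0 < s := by linarith
  have hx1 : 1 < x := by rw [hx]; nlinarith
  have hx0 : 0 < x := by linarith
  have hsq : x ^ (1 / 2 : ℝ) = s := by rw [hx, ← Real.sqrt_eq_rpow, Real.sqrt_sq hs0.le]
  have hsq' : x ^ (-(1 / 2) : ℝ) = 1 / s := by rw [Real.rpow_neg hx0.le, hsq, one_div]
  have hl0 : 0 ≤ Real.log x := Real.log_nonneg hx1.le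
  have hl : Real.log x ≤ 2114 / 10000 * s := by
    rw [hx, Real.log_pow]
    have h2 : Real.log s = Real.log (s / 32) + 5 * Real.log 2 := by
      rw [Real.log_div hs0.ne' (by norm_num), show (32 : ℝ) = 2 ^ 5 by norm_num, Real.log_pow]; push_cast; ring
    have h3 := Real.log_le_sub_one_of_pos (show 0 < s / 32 by positivity)
    have := Real.log_two_lt_d9
    push_cast
    linarith
  have hW : gpW x = Real.log x / s := by
    unfold gpW; rw [hsq', max_eq_right hl0]; ring
  have hr0 : 0 ≤ x ^ (-(1 / 4) : ℝ) := by positivity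
  have hr : x ^ (-(1 / 4) : ℝ) ≤ 4 / 23 := by
    have h1 : ((23 / 4 : ℝ) ^ 4) ≤ x := by rw [hx]; nlinarith
    have h2 := Real.rpow_le_rpow_of_nonpos (by norm_num) h1 (show (-(1 / 4) : ℝ) ≤ 0 by norm_num)
    refine h2.trans_eq ?_
    rw [← Real.rpow_natCast, ← Real.rpow_mul (by norm_num)]
    norm_num
  have hlog : Real.log (p / Real.pi) = L - Real.log Real.pi := by
    rw [Real.log_div hp0.ne' Real.pi_pos.ne']
  have hlog0 : 0 ≤ L - Real.log Real.pi := by linarith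
  have hM : gpM p x = s * (1 / 2 * (L - Real.log Real.pi) + Real.log (9 / 4) + 9 / 20 + gpV (3 / 2)) +
      (L - Real.log Real.pi) * (Real.log x / s) + 2 * gpV (5 / 4) * x ^ (-(1 / 4) : ℝ) := by
    unfold gpM
    rw [hlog, abs_of_nonneg hlog0, hsq, hW]
  refine ⟨?_, hx1, ?_⟩
  · rw [hM]; positivity
  · refine lt_of_lt_of_le ?_ (gp_S_zeta hG hx1)
    rw [hM, hsq, hsq', hW]
    have := gp_num hK hL hs hl0 hl hV1 hV0 hV1' hP hP' ha hb hr0 hr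
    have e : 4 / 9 * x = 4 / 9 * s ^ 2 := by rw [hx]
    rw [e]
    exact this

end

section
open Complex MeasureTheory Filter Topology Set
open scoped ComplexConjugate

/-- the local sieve factor -/
noncomputable def gpfac {p : ℕ} (χ : ℕ → DirichletCharacter ℂ p) (l n : ℕ) : ℂ :=
  1 + ∑ j ∈ Finset.Ico 1 l, (-1 / ((l : ℂ) - 1)) * ((χ l) ^ j) n

lemma gp_coef {l : ℕ} (hl : l.Prime) {M : ℝ} : ∑ _j ∈ Finset.Ico 1 l, ‖(-1 / ((l : ℂ) - 1))‖ * M = M := by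
  have h1 : (1 : ℝ) < l := by exact_mod_cast hl.one_lt
  have : ‖(-1 / ((l : ℂ) - 1))‖ = 1 / ((l : ℝ) - 1) := by
    rw [norm_div, norm_neg, norm_one, show (l : ℂ) - 1 = (((l : ℝ) - 1 : ℝ) : ℂ) by push_cast; rfl, norm_real,
      Real.norm_of_nonneg (by linarith)]
  rw [this, Finset.sum_const, Nat.card_Ico, nsmul_eq_mul, Nat.cast_sub hl.one_le, Nat.cast_one]
  have : (l : ℝ) - 1 ≠ 0 := by linarith
  field_simp

lemma gp_expand {p : ℕ} (χ : ℕ → DirichletCharacter ℂ p) {l : ℕ} (N : ℕ) (b g : ℕ → ℂ) :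
    ∑ n ∈ Finset.range N, b n * (gpfac χ l n * g n) =
    ∑ n ∈ Finset.range N, b n * g n +
    ∑ j ∈ Finset.Ico 1 l, (-1 / ((l : ℂ) - 1)) * ∑ n ∈ Finset.range N, b n * (((χ l) ^ j) n * g n) := by
  simp only [gpfac, add_mul, one_mul, mul_add, Finset.sum_add_distrib, Finset.sum_mul, Finset.mul_sum]
  congr 1
  rw [Finset.sum_comm]
  refine Finset.sum_congr rfl fun j _ => Finset.sum_congr rfl fun n _ => ?_
  ring

lemma gp_sieve_a {p : ℕ} {P : Finset ℕ} (hP : ∀ l ∈ P, l.Prime) (χ : ℕ → DirichletCharacter ℂ p)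
    (hχ : ∀ l ∈ P, orderOf (χ l) = l) (N : ℕ) (b : ℕ → ℂ) {M : ℝ}
    (hM : ∀ ψ : DirichletCharacter ℂ p, ψ ≠ 1 → ‖∑ n ∈ Finset.range N, b n * ψ n‖ ≤ M) :
    ∀ T ⊆ P, ∀ ψ : DirichletCharacter ℂ p, ψ ≠ 1 → (∀ l ∈ T, (orderOf ψ).Coprime l) →
      ‖∑ n ∈ Finset.range N, b n * (ψ n * ∏ l ∈ T, gpfac χ l n)‖ ≤ 2 ^ T.card * M := by
  intro T
  induction T using Finset.induction_on with
  | empty => intro _ ψ hψ _; simpa using hM ψ hψ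
  | insert l T hlT ih =>
    intro hT ψ hψ hc
    have hl := hT (Finset.mem_insert_self l T)
    have hT' : T ⊆ P := fun y hy => hT (Finset.mem_insert_of_mem hy)
    have hlp := hP l hl
    have e : ∀ n : ℕ, b n * (ψ n * ∏ l ∈ insert l T, gpfac χ l n) = b n * (gpfac χ l n * (ψ n * ∏ l ∈ T, gpfac χ l n)) := by
      intro n; rw [Finset.prod_insert hlT]; ring
    simp only [e]
    rw [gp_expand]
    have e2 : (2 : ℝ) ^ (insert l T).card * M = 2 ^ T.card * M + ∑ _j ∈ Finset.Ico 1 l, ‖(-1 / ((l : ℂ) - 1))‖ * (2 ^ T.card * M) := by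
      rw [gp_coef hlp, Finset.card_insert_of_notMem hlT, pow_succ]; ring
    rw [e2]
    refine (norm_add_le _ _).trans (add_le_add (ih hT' ψ hψ fun y hy => hc y (Finset.mem_insert_of_mem hy)) ?_)
    refine (norm_sum_le _ _).trans (Finset.sum_le_sum fun j hj => ?_)
    rw [norm_mul]
    gcongr
    have e3 : ∀ n : ℕ, b n * ((χ l ^ j) n * (ψ n * ∏ l ∈ T, gpfac χ l n)) = b n * ((χ l ^ j * ψ) n * ∏ l ∈ T, gpfac χ l n) := by
      intro n; rw [MulChar.mul_apply]; ring
    simp only [e3]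
    have hd : orderOf (χ l ^ j) ∣ l := by
      have := orderOf_pow_dvd (x := χ l) j
      rwa [hχ l hl] at this
    have hcl := hc l (Finset.mem_insert_self l T)
    refine ih hT' _ (fun h => ?_) (fun y hy => ?_)
    · have h1 : ψ = (χ l ^ j)⁻¹ := eq_inv_of_mul_eq_one_right h
      have h2 : orderOf ψ ∣ l := by rw [h1, orderOf_inv]; exact hd
      exact hψ (orderOf_eq_one_iff.1 (Nat.Coprime.eq_one_of_dvd hcl h2))
    · have h1 := (Commute.all (χ l ^ j) ψ).orderOf_mul_dvd_mul_orderOf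
      refine Nat.Coprime.coprime_dvd_left h1 (Nat.Coprime.mul_left ?_ (hc y (Finset.mem_insert_of_mem hy)))
      refine Nat.Coprime.coprime_dvd_left hd ((Nat.coprime_primes hlp (hP y (hT' hy))).2 ?_)
      rintro rfl; exact hlT hy

lemma gp_sieve_b {p : ℕ} {P : Finset ℕ} (hP : ∀ l ∈ P, l.Prime) (χ : ℕ → DirichletCharacter ℂ p)
    (hχ : ∀ l ∈ P, orderOf (χ l) = l) (N : ℕ) (b : ℕ → ℂ) {M : ℝ}
    (hM : ∀ ψ : DirichletCharacter ℂ p, ψ ≠ 1 → ‖∑ n ∈ Finset.range N, b n * ψ n‖ ≤ M) :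
    ∀ T ⊆ P, ‖∑ n ∈ Finset.range N, b n * ∏ l ∈ T, gpfac χ l n - ∑ n ∈ Finset.range N, b n‖ ≤ (2 ^ T.card - 1) * M := by
  intro T
  induction T using Finset.induction_on with
  | empty => intro _; simp
  | insert l T hlT ih =>
    intro hT
    have hl := hT (Finset.mem_insert_self l T)
    have hT' : T ⊆ P := fun y hy => hT (Finset.mem_insert_of_mem hy)
    have hlp := hP l hl
    simp only [Finset.prod_insert hlT]
    rw [gp_expand]
    have e2 : ((2 : ℝ) ^ (insert l T).card - 1) * M = (2 ^ T.card - 1) * M + ∑ _j ∈ Finset.Ico 1 l, ‖(-1 / ((l : ℂ) - 1))‖ * (2 ^ T.card * M) := by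
      rw [gp_coef hlp, Finset.card_insert_of_notMem hlT, pow_succ]; ring
    rw [e2, add_sub_right_comm]
    refine (norm_add_le _ _).trans (add_le_add (ih hT') ?_)
    refine (norm_sum_le _ _).trans (Finset.sum_le_sum fun j hj => ?_)
    rw [norm_mul]
    gcongr
    have hd : orderOf (χ l ^ j) ∣ l := by
      have := orderOf_pow_dvd (x := χ l) j
      rwa [hχ l hl] at this
    rw [Finset.mem_Ico] at hj
    refine gp_sieve_a hP χ hχ N b hM T hT' _ (fun h => ?_) (fun y hy => ?_)
    · have := orderOf_dvd_of_pow_eq_one h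
      rw [hχ l hl] at this
      have := Nat.le_of_dvd (by omega) this
      omega
    · refine Nat.Coprime.coprime_dvd_left hd ((Nat.coprime_primes hlp (hP y (hT' hy))).2 ?_)
      rintro rfl; exact hlT hy

lemma gp_fac_zero {p : ℕ} [Fact p.Prime] (χ : ℕ → DirichletCharacter ℂ p)
    (hχ : ∀ l ∈ (p - 1).primeFactors, orderOf (χ l) = l) {n : ℕ} (hn : (n : ZMod p) ≠ 0)
    (ho : orderOf (n : ZMod p) ≠ p - 1) : ∏ l ∈ (p - 1).primeFactors, gpfac χ l n = 0 := by
  have hp := (Fact.out : p.Prime)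
  have hp1 : p - 1 ≠ 0 := by have := hp.two_le; omega
  have hdvd : orderOf (n : ZMod p) ∣ p - 1 := ZMod.orderOf_dvd_card_sub_one hn
  obtain ⟨c, hc⟩ := hdvd
  have hc1 : c ≠ 1 := by rintro rfl; rw [mul_one] at hc; exact ho hc.symm
  obtain ⟨l, hl, hlc⟩ := Nat.exists_prime_and_dvd hc1
  have hlmem : l ∈ (p - 1).primeFactors := by
    rw [Nat.mem_primeFactors]
    exact ⟨hl, hc ▸ hlc.mul_left _, hp1⟩
  refine Finset.prod_eq_zero hlmem ?_
  obtain ⟨d, rfl⟩ := hlc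
  -- the element is an l-th power
  have hpow : (n : ZMod p) ^ (orderOf (n : ZMod p) * d) = 1 := by rw [pow_mul, pow_orderOf_eq_one, one_pow]
  obtain ⟨g, hg⟩ := IsCyclic.exists_generator (α := (ZMod p)ˣ)
  have hgo : orderOf g = p - 1 := by
    rw [orderOf_eq_card_of_forall_mem_zpowers hg, Nat.card_eq_fintype_card, ZMod.card_units]
  obtain ⟨m, hm⟩ := (mem_powers_iff_mem_zpowers.2 (hg (Units.mk0 _ hn)))
  simp only at hm
  set o := orderOf (n : ZMod p) with hod
  have hgm : g ^ (m * (o * d)) = 1 := by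
    rw [pow_mul, hm]
    ext
    rw [Units.val_pow_eq_pow_val, Units.val_mk0, hpow, Units.val_one]
  have h1 := orderOf_dvd_of_pow_eq_one hgm
  rw [hgo, hc, show o * (l * d) = l * (o * d) by ring] at h1
  have hod0 : o * d ≠ 0 := by
    intro h
    apply hp1; rw [hc, show o * (l * d) = l * (o * d) by ring, h, mul_zero]
  have h2 : l ∣ m := (Nat.mul_dvd_mul_iff_right (Nat.pos_of_ne_zero hod0)).1 h1
  obtain ⟨k, rfl⟩ := h2
  have hn' : (n : ZMod p) = ((g ^ k : (ZMod p)ˣ) : ZMod p) ^ l := by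
    rw [← Units.val_pow_eq_pow_val, ← pow_mul, mul_comm k l, hm, Units.val_mk0]
  have hone : (χ l) (n : ZMod p) = 1 := by
    rw [hn', map_pow, ← MulChar.pow_apply_coe]
    have : χ l ^ l = 1 := by
      have := pow_orderOf_eq_one (χ l)
      rwa [hχ l hlmem] at this
    rw [this, MulChar.one_apply_coe]
  have hu : IsUnit (n : ZMod p) := hn.isUnit
  unfold gpfac
  have : ∀ j ∈ Finset.Ico 1 l, (-1 / ((l : ℂ) - 1)) * ((χ l) ^ j) (n : ZMod p) = -1 / ((l : ℂ) - 1) := by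
    intro j hj
    rw [Finset.mem_Ico] at hj
    rw [MulChar.pow_apply' _ (by omega), hone, one_pow, mul_one]
  rw [Finset.sum_congr rfl this, Finset.sum_const, Nat.card_Ico, nsmul_eq_mul, Nat.cast_sub hl.one_le, Nat.cast_one]
  have h1 : (l : ℂ) - 1 ≠ 0 := by
    rw [sub_ne_zero]; exact_mod_cast hl.one_lt.ne'
  field_simp
  ring

lemma gp_fac_one {p : ℕ} [Fact p.Prime] (χ : ℕ → DirichletCharacter ℂ p) {n : ℕ} (hn : (n : ZMod p) = 0) (P : Finset ℕ) :
    ∏ l ∈ P, gpfac χ l n = 1 := by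
  refine Finset.prod_eq_one fun l _ => ?_
  unfold gpfac
  rw [add_eq_left]
  refine Finset.sum_eq_zero fun j _ => ?_
  rw [hn, MulChar.map_zero, mul_zero]

lemma gpW_nonneg {y : ℝ} (hy : 0 ≤ y) : 0 ≤ gpW y := by unfold gpW; positivity

lemma gpW_le {y : ℝ} (hy : 0 < y) : gpW y ≤ 3 / 4 := by
  unfold gpW
  have h0 : 0 < y ^ (1 / 2 : ℝ) := by positivity
  rw [Real.rpow_neg hy.le, inv_mul_le_iff₀ h0]
  refine max_le (by positivity) ?_
  have h1 := Real.log_le_sub_one_of_pos (show 0 < y ^ (1 / 2 : ℝ) / Real.exp 1 by positivity)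
  rw [Real.log_div h0.ne' (Real.exp_pos 1).ne', Real.log_rpow hy, Real.log_exp] at h1
  have h2 : y ^ (1 / 2 : ℝ) / Real.exp 1 ≤ y ^ (1 / 2 : ℝ) / (8 / 3) := by
    gcongr
    linarith [Real.exp_one_gt_d9]
  linarith

lemma gp_pdiv {p : ℕ} [Fact p.Prime] {x : ℝ} (hx : 1 < x) :
    ∑ n ∈ (Finset.range (⌊x⌋₊ + 1)).filter (fun n => p ∣ n), ArithmeticFunction.vonMangoldt n * gpW (x / n) ≤ 3 / 4 * Real.log x := by
  have hp := (Fact.out : p.Prime)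
  have hx0 : 0 < x := by linarith
  have hfl : ⌊x⌋₊ ≠ 0 := (Nat.floor_pos.2 hx.le).ne'
  set m := Nat.log p ⌊x⌋₊ with hm
  have h1 : ∑ n ∈ (Finset.range (⌊x⌋₊ + 1)).filter (fun n => p ∣ n), ArithmeticFunction.vonMangoldt n * gpW (x / n) ≤
      ∑ n ∈ (p ^ m).divisors, ArithmeticFunction.vonMangoldt n * (3 / 4) := by
    rw [← Finset.sum_filter_ne_zero]
    refine (Finset.sum_le_sum_of_subset_of_nonneg (t := (p ^ m).divisors) (fun n hn' => ?_) (fun n _ _ => ?_)).trans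
      (Finset.sum_le_sum fun n hn => ?_)
    · obtain ⟨hn, hne⟩ := Finset.mem_filter.1 hn'
      rw [Finset.mem_filter, Finset.mem_range] at hn
      have hΛ : ArithmeticFunction.vonMangoldt n ≠ 0 := left_ne_zero_of_mul hne
      rw [ArithmeticFunction.vonMangoldt_ne_zero_iff, isPrimePow_nat_iff] at hΛ
      obtain ⟨q, k, hq, hk, rfl⟩ := hΛ
      have := (Nat.prime_dvd_prime_iff_eq hp hq).1 (hp.dvd_of_dvd_pow hn.2)
      subst this
      rw [Nat.mem_divisors]
      refine ⟨pow_dvd_pow _ ?_, (pow_pos hp.pos _).ne'⟩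
      exact Nat.le_log_of_pow_le hp.one_lt (by omega)
    · exact mul_nonneg ArithmeticFunction.vonMangoldt_nonneg (gpW_nonneg (by positivity))
    · have hn0 : (0 : ℝ) < n := by exact_mod_cast Nat.pos_of_mem_divisors hn
      exact mul_le_mul_of_nonneg_left (gpW_le (by positivity)) ArithmeticFunction.vonMangoldt_nonneg
  refine h1.trans ?_
  rw [← Finset.sum_mul, ArithmeticFunction.vonMangoldt_sum]
  have h2 : ((p ^ m : ℕ) : ℝ) ≤ x := (Nat.cast_le.2 (Nat.pow_log_le_self p hfl)).trans (Nat.floor_le hx0.le)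
  have := Real.log_le_log (by exact_mod_cast pow_pos hp.pos m) h2
  linarith

lemma gp_exists (hG : GRH) {p : ℕ} (hp : p.Prime) (hp9 : 10 ^ 9 ≤ p) {x : ℝ}
    (hx : x = (8 / 5 * (2 ^ (p - 1).primeFactors.card - 1) * Real.log p) ^ 2) :
    ∃ q : ℕ, q.Prime ∧ orderOf (q : ZMod p) = p - 1 ∧ (q : ℝ) ≤ x := by
  have : Fact p.Prime := ⟨hp⟩
  have hK : (1 : ℝ) ≤ 2 ^ (p - 1).primeFactors.card - 1 := by
    have h1 : (p - 1).primeFactors.card ≠ 0 := by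
      rw [Finset.card_ne_zero, Nat.nonempty_primeFactors]; omega
    have : (2 : ℝ) ^ 1 ≤ 2 ^ (p - 1).primeFactors.card := pow_le_pow_right₀ (by norm_num) (Nat.one_le_iff_ne_zero.2 h1)
    linarith
  obtain ⟨hM0, hx1, hmain⟩ := gp_main_num hG hp9 hK hx
  have hx0 : 0 < x := by linarith
  by_contra hcon
  push Not at hcon
  have hch : ∀ l : ℕ, ∃ ψ : DirichletCharacter ℂ p, l ∈ (p - 1).primeFactors → orderOf ψ = l := by
    intro l
    by_cases hl : l ∈ (p - 1).primeFactors
    · have hl' := Nat.mem_primeFactors.1 hl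
      have h1 : l ∣ Fintype.card (ZMod p) - 1 := by rw [ZMod.card]; exact hl'.2.1
      obtain ⟨ψ, hψ⟩ := MulChar.exists_mulChar_orderOf (ZMod p) h1
        (Complex.isPrimitiveRoot_exp l hl'.1.ne_zero)
      exact ⟨ψ, fun _ => hψ⟩
    · exact ⟨1, fun h => absurd h hl⟩
  choose χ hχ using hch
  set N := ⌊x⌋₊ + 1 with hN
  set b : ℕ → ℂ := fun n => ((ArithmeticFunction.vonMangoldt n * gpW (x / n) : ℝ) : ℂ) with hb
  have hM : ∀ ψ : DirichletCharacter ℂ p, ψ ≠ 1 → ‖∑ n ∈ Finset.range N, b n * ψ n‖ ≤ gpM p x := by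
    intro ψ hψ
    have := gp_S_chi hG hψ hx1.le
    unfold gpM
    convert this using 3 with n
    simp only [hb]; push_cast; ring
  have hsv := gp_sieve_b (fun l hl => (Nat.mem_primeFactors.1 hl).1) χ hχ N b hM (p - 1).primeFactors subset_rfl
  have e1 : ∑ n ∈ Finset.range N, b n * ∏ l ∈ (p - 1).primeFactors, gpfac χ l n =
      ((∑ n ∈ (Finset.range N).filter (fun n => p ∣ n), ArithmeticFunction.vonMangoldt n * gpW (x / n) : ℝ) : ℂ) := by
    rw [Finset.sum_filter, ofReal_sum]
    refine Finset.sum_congr rfl fun n hn => ?_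
    rw [Finset.mem_range] at hn
    split_ifs with hd
    · rw [gp_fac_one χ ((ZMod.natCast_eq_zero_iff n p).2 hd), mul_one]
    · have hn0 : (n : ZMod p) ≠ 0 := fun h => hd ((ZMod.natCast_eq_zero_iff n p).1 h)
      rw [ofReal_zero]
      by_cases hΛ : ArithmeticFunction.vonMangoldt n = 0
      · simp [hb, hΛ]
      rw [← ne_eq, ArithmeticFunction.vonMangoldt_ne_zero_iff, isPrimePow_nat_iff] at hΛ
      rw [gp_fac_zero χ hχ hn0 ?_, mul_zero]
      intro ho
      obtain ⟨q, k, hq, hk, rfl⟩ := hΛ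
      have hq0 : (q : ZMod p) ≠ 0 := by
        intro h; apply hn0; push_cast; rw [h, zero_pow hk.ne']
      have hqo : orderOf (q : ZMod p) = p - 1 := by
        refine Nat.dvd_antisymm (ZMod.orderOf_dvd_card_sub_one hq0) ?_
        rw [← ho]; push_cast
        exact orderOf_pow_dvd k
      have := hcon q hq hqo
      have h2 : q ≤ q ^ k := Nat.le_self_pow hk.ne' q
      have h3 : q ≤ ⌊x⌋₊ := by omega
      have h4 : (q : ℝ) ≤ x := (Nat.cast_le.2 h3).trans (Nat.floor_le hx0.le)
      linarith
  have e2 : ∑ n ∈ Finset.range N, b n = ((∑ n ∈ Finset.range N, ArithmeticFunction.vonMangoldt n * gpW (x / n) : ℝ) : ℂ) := by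
    rw [ofReal_sum]
  rw [e1, e2, ← ofReal_sub, norm_real, Real.norm_eq_abs] at hsv
  have h5 := (abs_le.1 hsv).1
  have h6 := gp_pdiv (p := p) hx1
  linarith

lemma gp_final (hG : GRH) {p : ℕ} (hp : p.Prime) (hp9 : 10 ^ 9 ≤ p) :
    ((sInf {q : ℕ | q.Prime ∧ orderOf (q : ZMod p) = p - 1} : ℕ) : ℝ) ≤
      (8 / 5 * (2 ^ (p - 1).primeFactors.card - 1) * Real.log p) ^ 2 := by
  obtain ⟨q, h1, h2, h3⟩ := gp_exists hG hp hp9 rfl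
  refine le_trans ?_ h3
  have h4 : q ∈ {q : ℕ | q.Prime ∧ orderOf (q : ZMod p) = p - 1} := ⟨h1, h2⟩
  exact_mod_cast Nat.sInf_le h4

end

/-- Assume GRH. For `p ≥ 10^9` prime, `ĝ(p) ≤ ((8/5)·(2^{ω(p-1)} - 1)·log p)²`. -/
theorem least_prime_primitive_root_bound (hGRH : GRH) (p : ℕ) (hp : p.Prime)
    (hp' : 10 ^ 9 ≤ p) :
    (leastPrimePrimitiveRoot p : ℝ) ≤
      (8 / 5 * (2 ^ (p - 1).primeFactors.card - 1) * Real.log p) ^ 2 :=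
  gp_final hGRH hp hp'
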